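/- If there exists n₀ such that f_n is odd for all n ≥ n₀, then (f_n : ℝ)/p_n tends to 3 as n → ∞. -/

import Mathlib

open Filter Pointwise

/-- `nthPrime n` is the `n`-th prime number (1-indexed): `nthPrime 1 = 2`, etc. -/
noncomputable def nthPrime (n : ℕ) : ℕ := Nat.nth Nat.Prime (n - 1)

/-- `S n` is the additive submonoid of `ℕ` generated by the primes `q ≥ nthPrime n`. -/
def S (n : ℕ) : AddSubmonoid ℕ :=
  AddSubmonoid.closure {q : ℕ | q.Prime ∧ nthPrime n ≤ q}

/-- `frob n` is the Frobenius number of `S n`: the largest natural number not in `S n`. -/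
noncomputable def frob (n : ℕ) : ℕ := sSup {m : ℕ | m ∉ S n}

/-- `genus n` is the number of natural numbers not in `S n`. -/
noncomputable def genus (n : ℕ) : ℕ := {m : ℕ | m ∉ S n}.ncard

/-- `atoms n` is the minimal generating set `S n \ {0} \ ((S n \ {0}) + (S n \ {0}))`. -/
def atoms (n : ℕ) : Set ℕ :=
  ((S n : Set ℕ) \ {0}) \ (((S n : Set ℕ) \ {0}) + ((S n : Set ℕ) \ {0}))

/-- `u n` is the largest atom of `S n`. -/
noncomputable def u (n : ℕ) : ℕ := sSup (atoms n)

/-- `e n` is the embedding dimension of `S n`: the number of atoms. -/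
noncomputable def e (n : ℕ) : ℕ := (atoms n).ncard

namespace PrimeSum
open MeasureTheory Set Topology

/-- The Fejér kernel at scale `T`, up to normalization. -/
noncomputable def fejer (T v : ℝ) : ℝ := 2 * (1 - Real.cos (T * v)) / (T * v ^ 2)

lemma fejer_nonneg {T : ℝ} (hT : 0 < T) (v : ℝ) : 0 ≤ fejer T v := by
  have := Real.cos_le_one (T * v)
  unfold fejer
  apply div_nonneg <;> [linarith; positivity]

lemma measurable_fejer (T : ℝ) : Measurable (fejer T) := by
  unfold fejer
  fun_prop

lemma fejer_mul_sq_le {T : ℝ} (hT : 0 < T) (v : ℝ) : fejer T v * v ^ 2 ≤ 4 / T := by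
  unfold fejer
  rcases eq_or_ne v 0 with rfl | hv
  · simp; positivity
  · have := Real.neg_one_le_cos (T * v)
    rw [div_mul_eq_mul_div, mul_div_mul_right _ _ (by positivity)]
    gcongr
    linarith

lemma fejer_le_self {T : ℝ} (hT : 0 < T) (v : ℝ) : fejer T v ≤ T := by
  unfold fejer
  rcases eq_or_ne v 0 with rfl | hv
  · simp; positivity
  · have := Real.one_sub_sq_div_two_le_cos (x := T * v)
    rw [div_le_iff₀ (by positivity)]
    nlinarith

lemma fejer_le {T : ℝ} (hT : 0 < T) (v : ℝ) : fejer T v ≤ (T + 4 / T) * (1 + v ^ 2)⁻¹ := by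
  rw [← div_eq_mul_inv, le_div_iff₀ (by positivity)]
  nlinarith [fejer_mul_sq_le hT v, fejer_le_self hT v]

lemma fejer_tail_le {T η v : ℝ} (hT : 0 < T) (hη : 0 < η) (hv : η ≤ |v|) :
    fejer T v ≤ 4 / T * (1 + 1 / η ^ 2) * (1 + v ^ 2)⁻¹ := by
  have h1 : η ^ 2 ≤ v ^ 2 := by rw [← sq_abs v]; gcongr
  have h2 : 0 < v ^ 2 := lt_of_lt_of_le (by positivity) h1
  have h3 := fejer_mul_sq_le hT v
  have hv0 : v ≠ 0 := by rintro rfl; simp at h2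
  rw [← div_eq_mul_inv, le_div_iff₀ (by positivity)]
  have h4 : fejer T v ≤ 4 / T / v ^ 2 := by rwa [le_div_iff₀ h2]
  have h5 : 1 + v ^ 2 ≤ v ^ 2 * (1 + 1 / η ^ 2) := by
    have : 1 ≤ v ^ 2 / η ^ 2 := by rwa [le_div_iff₀ (by positivity), one_mul]
    have h : v ^ 2 * (1 + 1 / η ^ 2) = v ^ 2 + v ^ 2 / η ^ 2 := by ring
    linarith
  calc fejer T v * (1 + v ^ 2) ≤ 4 / T / v ^ 2 * (v ^ 2 * (1 + 1 / η ^ 2)) := by gcongr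
    _ = _ := by field_simp

lemma integrable_fejer {T : ℝ} (hT : 0 < T) : Integrable (fejer T) := by
  refine (integrable_inv_one_add_sq.const_mul (T + 4 / T)).mono'
    (measurable_fejer T).aestronglyMeasurable (ae_of_all _ fun v => ?_)
  rw [Real.norm_of_nonneg (fejer_nonneg hT v)]
  exact fejer_le hT v

lemma integral_fejer {T : ℝ} (hT : 0 < T) : ∫ v, fejer T v = ∫ v, fejer 1 v := by
  have h : ∀ v, fejer T v = T * fejer 1 (T * v) := by
    intro v
    unfold fejer
    rcases eq_or_ne v 0 with rfl | hv
    · simp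
    · field_simp
  simp_rw [h]
  rw [integral_const_mul, Measure.integral_comp_mul_left, abs_of_pos (by positivity), smul_eq_mul]
  field_simp

lemma integral_fejer_pos : 0 < ∫ v, fejer 1 v := by
  rw [integral_pos_iff_support_of_nonneg (fejer_nonneg one_pos) (integrable_fejer one_pos)]
  refine lt_of_lt_of_le ?_ (measure_mono (s := Ioo (0 : ℝ) 1) ?_)
  · simp
  · intro v hv
    have h1 : Real.cos v < 1 := by
      rw [← Real.cos_zero]
      exact Real.cos_lt_cos_of_nonneg_of_le_pi_div_two le_rfl
        (by linarith [hv.2, Real.pi_gt_three]) hv.1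
    have h0 : 0 < v := hv.1
    simp only [Function.mem_support, fejer, one_mul]
    have : 0 < 1 - Real.cos v := by linarith
    positivity

lemma integral_half_fejer {T v : ℝ} (hT : 0 < T) (hv : v ≠ 0) :
    ∫ t in (0 : ℝ)..T, (((1 - t / T : ℝ)) : ℂ) * Complex.exp (Complex.I * t * v) =
      - (Complex.exp (Complex.I * T * v) - 1) / (T * v ^ 2) + Complex.I / v := by
  have hv' : (v : ℂ) ≠ 0 := by exact_mod_cast hv
  have hT' : (T : ℂ) ≠ 0 := by exact_mod_cast hT.ne'
  have hI := Complex.I_ne_zero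
  rw [intervalIntegral.integral_eq_sub_of_hasDerivAt
    (f := fun t : ℝ => (1 - (t : ℂ) / T) * Complex.exp (Complex.I * t * v) / (Complex.I * v) +
      Complex.exp (Complex.I * t * v) / (T * (Complex.I * v) ^ 2))]
  · simp only [Complex.ofReal_zero, mul_zero, zero_mul, Complex.exp_zero]
    field_simp
    simp only [show Complex.I ^ 2 = -1 from Complex.I_sq]
    ring_nf
  · intro t _
    have h1 : HasDerivAt (fun t : ℝ => (t : ℂ)) 1 t := Complex.ofRealCLM.hasDerivAt
    have h2 : HasDerivAt (fun t : ℝ => Complex.exp (Complex.I * t * v))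
        (Complex.exp (Complex.I * t * v) * (Complex.I * v)) t := by
      have := ((h1.const_mul Complex.I).mul_const (v : ℂ)).cexp
      simpa using this
    have h3 : HasDerivAt (fun t : ℝ => 1 - (t : ℂ) / T) (-(1 / T)) t := by
      simpa using (h1.div_const (T : ℂ)).const_sub 1
    refine (((h3.mul h2).div_const (Complex.I * v)).add
      (h2.div_const (T * (Complex.I * v) ^ 2))).congr_deriv ?_
    push_cast
    field_simp
    ring
  · apply Continuous.intervalIntegrable
    fun_prop

lemma integral_fejer_transform {T v : ℝ} (hT : 0 < T) (hv : v ≠ 0) :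
    ∫ t in (-T)..T, (((1 - |t| / T : ℝ)) : ℂ) * Complex.exp (Complex.I * t * v) = fejer T v := by
  have hc : Continuous fun t : ℝ =>
    (((1 - |t| / T : ℝ)) : ℂ) * Complex.exp (Complex.I * t * v) := by fun_prop
  rw [← intervalIntegral.integral_add_adjacent_intervals (hc.intervalIntegrable _ 0)
    (hc.intervalIntegrable 0 _)]
  have h1 : ∫ t in (0 : ℝ)..T, (((1 - |t| / T : ℝ)) : ℂ) * Complex.exp (Complex.I * t * v) =
      - (Complex.exp (Complex.I * T * v) - 1) / (T * v ^ 2) + Complex.I / v := by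
    rw [← integral_half_fejer hT hv]
    refine intervalIntegral.integral_congr fun t ht => ?_
    rw [uIcc_of_le hT.le] at ht
    simp only [abs_of_nonneg ht.1]
  have h2 : ∫ t in (-T)..0, (((1 - |t| / T : ℝ)) : ℂ) * Complex.exp (Complex.I * t * v) =
      - (Complex.exp (-(Complex.I * T * v)) - 1) / (T * v ^ 2) - Complex.I / v := by
    have := integral_half_fejer hT (neg_ne_zero.mpr hv)
    have h3 := intervalIntegral.integral_comp_neg (a := 0) (b := T) (fun t : ℝ =>
      (((1 - |t| / T : ℝ)) : ℂ) * Complex.exp (Complex.I * t * v))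
    rw [neg_zero] at h3
    rw [← h3]
    have h4 : (- (Complex.exp (-(Complex.I * T * v)) - 1) / (T * v ^ 2) - Complex.I / v : ℂ) =
      - (Complex.exp (Complex.I * T * (-v : ℝ)) - 1) / (T * (-v : ℝ) ^ 2)
        + Complex.I / (-v : ℝ) := by
      push_cast
      rw [div_neg]
      ring_nf
    rw [h4, ← this]
    refine intervalIntegral.integral_congr fun t ht => ?_
    rw [uIcc_of_le hT.le] at ht
    simp only [abs_neg, abs_of_nonneg ht.1]
    push_cast
    ring_nf
  rw [h1, h2]
  have h5 : Complex.exp (Complex.I * T * v) + Complex.exp (-(Complex.I * T * v)) =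
      2 * Complex.cos (T * v) := by
    rw [Complex.cos]
    ring_nf
  unfold fejer
  push_cast
  have hv' : (v : ℂ) ≠ 0 := by exact_mod_cast hv
  have hT' : (T : ℂ) ≠ 0 := by exact_mod_cast hT.ne'
  field_simp
  linear_combination -h5
end PrimeSum

namespace PrimeSum
open MeasureTheory Set Topology

lemma integrable_fejer_sub {T : ℝ} (hT : 0 < T) (u : ℝ) : Integrable fun y => fejer T (u - y) :=
  (integrable_fejer hT).comp_sub_left u

lemma integral_fejer_sub {T : ℝ} (hT : 0 < T) (u : ℝ) :
    ∫ y, fejer T (u - y) = ∫ v, fejer 1 v := by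
  rw [integral_sub_left_eq_self (fejer T), integral_fejer hT]

lemma integral_fejer_sub_compl_le {T η : ℝ} (hT : 0 < T) (hη : 0 < η) (u : ℝ) :
    ∫ y in (Icc (u - η) (u + η))ᶜ, fejer T (u - y) ≤ 4 / T * (1 + 1 / η ^ 2) * Real.pi := by
  have hi : Integrable fun y : ℝ => 4 / T * (1 + 1 / η ^ 2) * (1 + (u - y) ^ 2)⁻¹ :=
    (integrable_inv_one_add_sq.comp_sub_left u).const_mul _
  calc ∫ y in (Icc (u - η) (u + η))ᶜ, fejer T (u - y)
      ≤ ∫ y in (Icc (u - η) (u + η))ᶜ, 4 / T * (1 + 1 / η ^ 2) * (1 + (u - y) ^ 2)⁻¹ := by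
        refine setIntegral_mono_on (integrable_fejer_sub hT u).integrableOn hi.integrableOn
          measurableSet_Icc.compl fun y hy => fejer_tail_le hT hη ?_
        by_contra! h
        rw [abs_lt] at h
        exact hy ⟨by linarith, by linarith⟩
    _ ≤ ∫ y, 4 / T * (1 + 1 / η ^ 2) * (1 + (u - y) ^ 2)⁻¹ :=
        setIntegral_le_integral hi (ae_of_all _ fun y => by positivity)
    _ = _ := by
        rw [integral_const_mul, integral_sub_left_eq_self (fun y : ℝ => (1 + y ^ 2)⁻¹),
          integral_univ_inv_one_add_sq]

lemma le_integral_fejer_sub_Icc {T η : ℝ} (hT : 0 < T) (hη : 0 < η) (u : ℝ) :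
    (∫ v, fejer 1 v) - 4 / T * (1 + 1 / η ^ 2) * Real.pi ≤
      ∫ y in Icc (u - η) (u + η), fejer T (u - y) := by
  have h := integral_add_compl (measurableSet_Icc (a := u - η) (b := u + η))
    (integrable_fejer_sub hT u)
  rw [integral_fejer_sub hT] at h
  linarith [integral_fejer_sub_compl_le hT hη u]

/-- Smoothed form of the boundary behaviour of a Laplace transform. -/
lemma integral_mul_fejer_eq_of_laplace {D : ℝ → ℝ} {C T : ℝ} (hT : 0 < T) (hDm : Measurable D)
    (hDC : ∀ y, |D y| ≤ C) {G : ℂ → ℂ} (hG : ContinuousOn G {s | 1 ≤ s.re})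
    (hGe : ∀ s : ℂ, 1 < s.re →
      G s = ∫ y in Ioi (0 : ℝ), (D y : ℂ) * Complex.exp (-(s - 1) * y)) (u : ℝ) :
    ((∫ y in Ioi (0 : ℝ), D y * fejer T (u - y) : ℝ) : ℂ) =
      ∫ t in (-T)..T, Complex.exp (Complex.I * t * u) *
        (((1 - |t| / T : ℝ) : ℂ) * G (1 + Complex.I * t)) := by
  have hC : 0 ≤ C := (abs_nonneg _).trans (hDC 0)
  have key : ∀ δ : ℝ, 0 < δ →
      ∫ t in (-T)..T, Complex.exp (Complex.I * t * u) *
        (((1 - |t| / T : ℝ) : ℂ) * G (1 + δ + Complex.I * t)) =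
      ∫ y in Ioi (0 : ℝ), ((D y * Real.exp (-δ * y) * fejer T (u - y) : ℝ) : ℂ) := by
    intro δ hδ
    have h1 : ∀ t : ℝ, Complex.exp (Complex.I * t * u) *
        (((1 - |t| / T : ℝ) : ℂ) * G (1 + δ + Complex.I * t)) =
        ∫ y in Ioi (0 : ℝ), ((D y * Real.exp (-δ * y) : ℝ) : ℂ) *
          (((1 - |t| / T : ℝ) : ℂ) * Complex.exp (Complex.I * t * (u - y : ℝ))) := by
      intro t
      rw [hGe _ (by simp; exact hδ), ← integral_const_mul, ← integral_const_mul]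
      congr 1 with y
      have : Complex.exp (-(1 + δ + Complex.I * t - 1) * y) =
          Complex.exp (-δ * y) * Complex.exp (-(Complex.I * t * y)) := by
        rw [← Complex.exp_add]; ring_nf
      rw [this]
      have : Complex.exp (Complex.I * t * (u - y : ℝ)) =
          Complex.exp (Complex.I * t * u) * Complex.exp (-(Complex.I * t * y)) := by
        rw [← Complex.exp_add]; push_cast; ring_nf
      rw [this]
      push_cast
      ring
    simp_rw [h1]
    rw [intervalIntegral.integral_of_le (by linarith)]
    rw [integral_integral_swap]
    · refine integral_congr_ae ?_
      have hne : ∀ᵐ y ∂(volume.restrict (Ioi (0 : ℝ))), y ≠ u :=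
        ae_restrict_of_ae (Measure.ae_ne volume u)
      filter_upwards [hne] with y hy
      rw [integral_const_mul, ← intervalIntegral.integral_of_le (by linarith),
        integral_fejer_transform hT (sub_ne_zero.mpr hy.symm)]
      push_cast
      ring
    · have hb : Integrable (fun p : ℝ × ℝ => (1 : ℝ) * (C * Real.exp (-δ * p.2)))
          ((volume.restrict (Ioc (-T) T)).prod (volume.restrict (Ioi 0))) := by
        refine Integrable.mul_prod (f := fun _ : ℝ => (1 : ℝ))
          (g := fun y => C * Real.exp (-δ * y)) ?_ ?_
        · simp
        · exact (exp_neg_integrableOn_Ioi 0 hδ).const_mul C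
      refine hb.mono' ?_ ?_
      · apply Measurable.aestronglyMeasurable
        unfold Function.uncurry
        have : Measurable fun p : ℝ × ℝ => D p.2 := hDm.comp measurable_snd
        fun_prop
      · rw [Measure.prod_restrict]
        refine (ae_restrict_mem (measurableSet_Ioc.prod measurableSet_Ioi)).mono ?_
        rintro ⟨t, y⟩ ⟨ht, hy⟩
        simp only [Function.uncurry]
        rw [norm_mul, norm_mul, Complex.norm_real, Complex.norm_real, norm_mul,
          show Complex.I * (t : ℂ) * ((u - y : ℝ) : ℂ) = ((t * (u - y) : ℝ) : ℂ) * Complex.I by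
            push_cast; ring, Complex.norm_exp_ofReal_mul_I, Real.norm_of_nonneg (Real.exp_pos _).le,
          mul_one, one_mul]
        have h2 : ‖1 - |t| / T‖ ≤ 1 := by
          have : |t| / T ≤ 1 := by
            rw [div_le_one hT, abs_le]
            exact ⟨ht.1.le, ht.2⟩
          have : 0 ≤ |t| / T := by positivity
          rw [Real.norm_eq_abs, abs_le]
          constructor <;> linarith
        calc ‖D y‖ * Real.exp (-δ * y) * ‖1 - |t| / T‖ ≤ C * Real.exp (-δ * y) * 1 := by
              gcongr
              exact hDC y
          _ = _ := by simp
  have hδ : Tendsto (fun n : ℕ => (1 : ℝ) / (n + 1)) atTop (𝓝 0) :=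
    tendsto_one_div_add_atTop_nhds_zero_nat
  -- a uniform bound for `G` on the relevant compact rectangle
  obtain ⟨K, hK⟩ : ∃ K, ∀ s ∈ (Icc (1 : ℝ) 2) ×ℂ (Icc (-T) T), ‖G s‖ ≤ K := by
    apply IsCompact.exists_bound_of_continuousOn (isCompact_Icc.reProdIm isCompact_Icc)
    exact hG.mono fun s hs => hs.1.1
  have lim1 : Tendsto (fun n : ℕ => ∫ t in (-T)..T, Complex.exp (Complex.I * t * u) *
        (((1 - |t| / T : ℝ) : ℂ) * G (1 + ((1 : ℝ) / (n + 1) : ℝ) + Complex.I * t))) atTop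
      (𝓝 (∫ t in (-T)..T, Complex.exp (Complex.I * t * u) *
        (((1 - |t| / T : ℝ) : ℂ) * G (1 + Complex.I * t)))) := by
    refine intervalIntegral.tendsto_integral_filter_of_dominated_convergence (fun _ => 1 * K)
      ?_ ?_ ?_ ?_
    · refine Eventually.of_forall fun n => ?_
      apply Continuous.aestronglyMeasurable
      have : Continuous fun t : ℝ => G (1 + ((1 : ℝ) / (n + 1) : ℝ) + Complex.I * t) := by
        refine hG.comp_continuous (by fun_prop) fun t => ?_
        simp only [mem_ofPred_eq]
        rw [Complex.add_re, Complex.add_re, Complex.ofReal_re]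
        simp
        positivity
      exact (by fun_prop : Continuous fun t : ℝ => Complex.exp (Complex.I * t * u)).mul
        ((by fun_prop : Continuous fun t : ℝ => ((1 - |t| / T : ℝ) : ℂ)).mul this)
    · refine Eventually.of_forall fun n => ae_of_all _ fun t ht => ?_
      rw [uIoc_of_le (by linarith)] at ht
      rw [norm_mul, norm_mul, Complex.norm_real,
          show Complex.I * (t : ℂ) * u = ((t * u : ℝ) : ℂ) * Complex.I by
            push_cast; ring, Complex.norm_exp_ofReal_mul_I, one_mul]
      have h2 : ‖1 - |t| / T‖ ≤ 1 := by
        have : |t| / T ≤ 1 := by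
          rw [div_le_one hT, abs_le]
          exact ⟨ht.1.le, ht.2⟩
        have : 0 ≤ |t| / T := by positivity
        rw [Real.norm_eq_abs, abs_le]
        constructor <;> linarith
      have h3 : (1 : ℝ) / (n + 1) ≤ 1 := by
        rw [div_le_one (by positivity)]
        linarith [n.cast_nonneg (α := ℝ)]
      have h4 : (0 : ℝ) ≤ 1 / (n + 1) := by positivity
      gcongr
      apply hK
      rw [Complex.mem_reProdIm]
      have e1 : (1 + (((1 : ℝ) / (n + 1) : ℝ) : ℂ) + Complex.I * t).re = 1 + 1 / (n + 1) := by
        rw [Complex.add_re, Complex.add_re, Complex.ofReal_re]; simp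
      have e2 : (1 + (((1 : ℝ) / (n + 1) : ℝ) : ℂ) + Complex.I * t).im = t := by
        rw [Complex.add_im, Complex.add_im, Complex.ofReal_im]; simp
      rw [e1, e2]
      exact ⟨⟨by linarith, by linarith⟩, ⟨ht.1.le, ht.2⟩⟩
    · simp
    · refine ae_of_all _ fun t _ => ?_
      refine Tendsto.const_mul _ (Tendsto.const_mul _ ?_)
      have h0 : ContinuousWithinAt G {s | 1 ≤ s.re} (1 + Complex.I * t) := hG _ (by simp)
      refine h0.tendsto.comp (tendsto_nhdsWithin_iff.mpr ⟨?_, Eventually.of_forall fun n => ?_⟩)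
      · have : Tendsto (fun n : ℕ => (((1 : ℝ) / (n + 1) : ℝ) : ℂ)) atTop (𝓝 ((0 : ℝ) : ℂ)) :=
          (Complex.continuous_ofReal.tendsto 0).comp hδ
        simpa using (this.const_add 1).add_const (Complex.I * (t : ℂ))
      · simp only [mem_ofPred_eq]
        rw [Complex.add_re, Complex.add_re, Complex.ofReal_re]
        simp
        positivity
  have lim2 : Tendsto (fun n : ℕ => ∫ y in Ioi (0 : ℝ),
      ((D y * Real.exp (-((1 : ℝ) / (n + 1)) * y) * fejer T (u - y) : ℝ) : ℂ)) atTop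
      (𝓝 (∫ y in Ioi (0 : ℝ), ((D y * fejer T (u - y) : ℝ) : ℂ))) := by
    refine tendsto_integral_of_dominated_convergence (fun y => C * fejer T (u - y)) ?_ ?_ ?_ ?_
    · intro n
      apply Measurable.aestronglyMeasurable
      have := measurable_fejer T
      fun_prop
    · exact ((integrable_fejer_sub hT u).const_mul C).integrableOn
    · intro n
      refine (ae_restrict_mem measurableSet_Ioi).mono fun y hy => ?_
      have hy' : 0 < y := hy
      have h1 : Real.exp (-((1 : ℝ) / (n + 1)) * y) ≤ 1 := by
        rw [Real.exp_le_one_iff]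
        have : 0 ≤ (1 : ℝ) / (n + 1) * y := by positivity
        linarith
      rw [Complex.norm_real, norm_mul, norm_mul, Real.norm_of_nonneg (fejer_nonneg hT _),
        Real.norm_of_nonneg (Real.exp_pos _).le]
      have := fejer_nonneg hT (u - y)
      calc ‖D y‖ * Real.exp (-((1 : ℝ) / (n + 1)) * y) * fejer T (u - y)
          ≤ C * 1 * fejer T (u - y) := by gcongr; exact hDC y
        _ = _ := by ring
    · refine ae_of_all _ fun y => ?_
      refine (Complex.continuous_ofReal.tendsto _).comp ?_
      have : Tendsto (fun n : ℕ => Real.exp (-((1 : ℝ) / (n + 1)) * y)) atTop (𝓝 1) := by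
        have := (hδ.neg.mul_const y)
        simp only [neg_zero, zero_mul] at this
        simpa [Function.comp_def] using (Real.continuous_exp.tendsto 0).comp this
      simpa using (this.const_mul (D y)).mul_const (fejer T (u - y))
  rw [← integral_complex_ofReal]
  refine tendsto_nhds_unique lim2 (lim1.congr fun n => ?_)
  rw [key _ (by positivity)]

lemma tendsto_integral_mul_fejer {D : ℝ → ℝ} {C T : ℝ} (hT : 0 < T) (hDm : Measurable D)
    (hDC : ∀ y, |D y| ≤ C) {G : ℂ → ℂ} (hG : ContinuousOn G {s | 1 ≤ s.re})
    (hGe : ∀ s : ℂ, 1 < s.re →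
      G s = ∫ y in Ioi (0 : ℝ), (D y : ℂ) * Complex.exp (-(s - 1) * y)) :
    Tendsto (fun u => ∫ y in Ioi (0 : ℝ), D y * fejer T (u - y)) atTop (𝓝 0) := by
  have h1 := Real.tendsto_integral_exp_smul_cocompact ((Ioc (-T) T).indicator fun t : ℝ =>
    (((1 - |t| / T : ℝ) : ℂ) * G (1 + Complex.I * t)))
  have h2 : Tendsto (fun u : ℝ => -u / (2 * Real.pi)) atTop (cocompact ℝ) := by
    refine Tendsto.mono_right ?_ (atBot_le_cocompact)
    exact (tendsto_neg_atTop_atBot).atBot_div_const (by positivity)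
  have h3 := h1.comp h2
  have h4 : Tendsto (fun u => ((∫ y in Ioi (0 : ℝ), D y * fejer T (u - y) : ℝ) : ℂ)) atTop
      (𝓝 0) := by
    refine h3.congr fun u => ?_
    rw [integral_mul_fejer_eq_of_laplace hT hDm hDC hG hGe,
      intervalIntegral.integral_of_le (by linarith), ← integral_indicator measurableSet_Ioc]
    simp only [Function.comp]
    congr 1 with t
    by_cases ht : t ∈ Ioc (-T) T
    · rw [indicator_of_mem ht, indicator_of_mem ht, Circle.smul_def, Real.fourierChar_apply,
        smul_eq_mul]
      congr 2
      push_cast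
      have : (Real.pi : ℂ) ≠ 0 := by exact_mod_cast Real.pi_ne_zero
      field_simp
    · simp [indicator_of_notMem ht]
  have := (Complex.continuous_re.tendsto _).comp h4
  simpa [Function.comp_def] using this

/-- A Tauberian theorem of Wiener–Ikehara type. -/
theorem tendsto_of_laplace {B : ℝ → ℝ} {C c : ℝ} (hBm : Measurable B) (hB0 : ∀ y, 0 ≤ B y)
    (hBC : ∀ y, B y ≤ C) (hc : 0 ≤ c)
    (hmono : ∀ y, 0 ≤ y → ∀ h, 0 ≤ h → Real.exp (-h) * B y ≤ B (y + h))
    {G : ℂ → ℂ} (hG : ContinuousOn G {s | 1 ≤ s.re})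
    (hGe : ∀ s : ℂ, 1 < s.re →
      G s = ∫ y in Ioi (0 : ℝ), ((B y - c : ℝ) : ℂ) * Complex.exp (-(s - 1) * y)) :
    Tendsto B atTop (𝓝 c) := by
  have hC : 0 ≤ C := (hB0 0).trans (hBC 0)
  set I := ∫ v, fejer 1 v with hI
  have hIpos : 0 < I := integral_fejer_pos
  rw [Metric.tendsto_nhds]
  intro ε hε
  -- choice of parameters
  have hup : Tendsto (fun η : ℝ => Real.exp (2 * η) * (c * I + η) / (I - η)) (𝓝 0) (𝓝 c) := by
    have : ContinuousAt (fun η : ℝ => Real.exp (2 * η) * (c * I + η) / (I - η)) 0 := by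
      refine ContinuousAt.div (by fun_prop) (by fun_prop) (by simpa using hIpos.ne')
    simpa [hIpos.ne'] using this.tendsto
  have hlo : Tendsto (fun η : ℝ => Real.exp (-(2 * η)) * (c * (I - η) - C * η - η) / I) (𝓝 0)
      (𝓝 c) := by
    have : ContinuousAt (fun η : ℝ => Real.exp (-(2 * η)) * (c * (I - η) - C * η - η) / I) 0 := by
      fun_prop
    simpa [hIpos.ne'] using this.tendsto
  have hev : ∀ᶠ η in 𝓝 (0 : ℝ), Real.exp (2 * η) * (c * I + η) / (I - η) < c + ε ∧
      c - ε < Real.exp (-(2 * η)) * (c * (I - η) - C * η - η) / I ∧ η < I :=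
    (hup.eventually (gt_mem_nhds (by linarith))).and
      ((hlo.eventually (lt_mem_nhds (by linarith))).and (gt_mem_nhds hIpos))
  obtain ⟨η, ⟨hη1, hη2, hη3⟩, hη⟩ :=
    ((hev.filter_mono nhdsWithin_le_nhds).and (self_mem_nhdsWithin (s := Ioi (0 : ℝ)))).exists
  replace hη : 0 < η := hη
  obtain ⟨T, hT, hτ⟩ : ∃ T : ℝ, 0 < T ∧ 4 / T * (1 + 1 / η ^ 2) * Real.pi ≤ η := by
    refine ⟨4 * (1 + 1 / η ^ 2) * Real.pi / η, by positivity, le_of_eq ?_⟩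
    have := Real.pi_pos
    field_simp
  have hφ := tendsto_integral_mul_fejer (D := fun y => B y - c) (C := C + c) hT (by fun_prop)
    (fun y => by rw [abs_le]; constructor <;> linarith [hB0 y, hBC y]) hG hGe
  have hφ1 : ∀ᶠ u in atTop, |∫ y in Ioi (0 : ℝ), (B y - c) * fejer T (u - y)| < η := by
    have := (Metric.tendsto_nhds.mp hφ) η hη
    simpa [Real.dist_eq] using this
  have hBi : ∀ u, Integrable fun y => B y * fejer T (u - y) := fun u => by
    refine ((integrable_fejer_sub hT u).const_mul C).mono' ?_ (ae_of_all _ fun y => ?_)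
    · apply Measurable.aestronglyMeasurable
      have := measurable_fejer T
      fun_prop
    · have := fejer_nonneg hT (u - y)
      rw [norm_mul, Real.norm_of_nonneg (hB0 y), Real.norm_of_nonneg this]
      gcongr
      exact hBC y
  have hsplit : ∀ u, ∫ y in Ioi (0 : ℝ), (B y - c) * fejer T (u - y) =
      (∫ y in Ioi (0 : ℝ), B y * fejer T (u - y)) - c * ∫ y in Ioi (0 : ℝ), fejer T (u - y) := by
    intro u
    rw [← integral_const_mul, ← integral_sub (hBi u).integrableOn
      ((integrable_fejer_sub hT u).const_mul c).integrableOn]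
    simp_rw [sub_mul]
  have hup' : ∀ᶠ u in atTop, B u < c + ε := by
    have hsh : Tendsto (fun u : ℝ => u + η) atTop atTop := tendsto_atTop_add_const_right _ _ tendsto_id
    filter_upwards [hsh.eventually hφ1, eventually_gt_atTop 0] with u h1 hu
    have hsub : Icc (u + η - η) (u + η + η) ⊆ Ioi 0 := fun y hy => by
      have := hy.1
      simp only [mem_Ioi]; linarith
    have h2 : Real.exp (-(2 * η)) * B u * (I - η) ≤ ∫ y in Ioi (0 : ℝ), B y * fejer T (u + η - y) := by
      calc Real.exp (-(2 * η)) * B u * (I - η)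
          ≤ Real.exp (-(2 * η)) * B u *
            ∫ y in Icc (u + η - η) (u + η + η), fejer T (u + η - y) := by
            have := hB0 u
            gcongr
            linarith [le_integral_fejer_sub_Icc hT hη (u + η)]
        _ = ∫ y in Icc (u + η - η) (u + η + η), Real.exp (-(2 * η)) * B u * fejer T (u + η - y) := by
            rw [integral_const_mul]
        _ ≤ ∫ y in Icc (u + η - η) (u + η + η), B y * fejer T (u + η - y) := by
            refine setIntegral_mono_on ((integrable_fejer_sub hT _).const_mul _).integrableOn
              (hBi _).integrableOn measurableSet_Icc fun y hy => ?_
            have := fejer_nonneg hT (u + η - y)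
            gcongr
            have h3 := hmono u hu.le (y - u) (by linarith [hy.1])
            rw [add_sub_cancel] at h3
            refine le_trans ?_ h3
            have := hB0 u
            gcongr
            linarith [hy.2]
        _ ≤ _ := by
            refine setIntegral_mono_set (hBi _).integrableOn (ae_of_all _ fun y => ?_)
              (Eventually.of_forall hsub)
            exact mul_nonneg (hB0 y) (fejer_nonneg hT _)
    have h4 : ∫ y in Ioi (0 : ℝ), fejer T (u + η - y) ≤ I := by
      rw [hI, ← integral_fejer_sub hT (u + η)]
      exact setIntegral_le_integral (integrable_fejer_sub hT _)
        (ae_of_all _ fun y => fejer_nonneg hT _)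
    rw [hsplit] at h1
    have h5 := (abs_lt.mp h1).2
    have h6 : Real.exp (-(2 * η)) * B u * (I - η) ≤ c * I + η := by
      nlinarith
    refine lt_of_le_of_lt ?_ hη1
    rw [le_div_iff₀ (by linarith)]
    have h7 : Real.exp (2 * η) * (Real.exp (-(2 * η)) * B u * (I - η)) = B u * (I - η) := by
      rw [Real.exp_neg]
      field_simp
    rw [← h7]
    gcongr
  have hlo' : ∀ᶠ u in atTop, c - ε < B u := by
    have hsh : Tendsto (fun u : ℝ => u - η) atTop atTop := tendsto_atTop_add_const_right _ _ tendsto_id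
    filter_upwards [hsh.eventually hφ1, eventually_gt_atTop (2 * η)] with u h1 hu
    have hsub : Icc (u - η - η) (u - η + η) ⊆ Ioi 0 := fun y hy => by
      have := hy.1
      simp only [mem_Ioi]; linarith
    have h2 : ∫ y in Ioi (0 : ℝ), B y * fejer T (u - η - y) ≤ Real.exp (2 * η) * B u * I + C * η := by
      calc ∫ y in Ioi (0 : ℝ), B y * fejer T (u - η - y)
          ≤ ∫ y, B y * fejer T (u - η - y) :=
            setIntegral_le_integral (hBi _)
              (ae_of_all _ fun y => mul_nonneg (hB0 y) (fejer_nonneg hT _))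
        _ = (∫ y in Icc (u - η - η) (u - η + η), B y * fejer T (u - η - y)) +
            ∫ y in (Icc (u - η - η) (u - η + η))ᶜ, B y * fejer T (u - η - y) :=
            (integral_add_compl measurableSet_Icc (hBi _)).symm
        _ ≤ (∫ y in Icc (u - η - η) (u - η + η), Real.exp (2 * η) * B u * fejer T (u - η - y)) +
            ∫ y in (Icc (u - η - η) (u - η + η))ᶜ, C * fejer T (u - η - y) := by
            refine add_le_add ?_ ?_
            · refine setIntegral_mono_on (hBi _).integrableOn
                ((integrable_fejer_sub hT _).const_mul _).integrableOn measurableSet_Icc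
                fun y hy => ?_
              have := fejer_nonneg hT (u - η - y)
              gcongr
              have h3 := hmono y (le_of_lt (hsub hy)) (u - y) (by linarith [hy.2])
              rw [add_sub_cancel, Real.exp_neg] at h3
              have h4 : B y ≤ Real.exp (u - y) * B u := by
                rwa [inv_mul_le_iff₀ (Real.exp_pos _)] at h3
              refine h4.trans ?_
              have := hB0 u
              gcongr
              linarith [hy.1]
            · refine setIntegral_mono_on (hBi _).integrableOn
                ((integrable_fejer_sub hT _).const_mul _).integrableOn measurableSet_Icc.compl
                fun y hy => ?_
              have := fejer_nonneg hT (u - η - y)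
              gcongr
              exact hBC y
        _ ≤ _ := by
            rw [integral_const_mul, integral_const_mul]
            have := hB0 u
            gcongr
            · rw [hI, ← integral_fejer_sub hT (u - η)]
              exact setIntegral_le_integral (integrable_fejer_sub hT _)
                (ae_of_all _ fun y => fejer_nonneg hT _)
            · exact (integral_fejer_sub_compl_le hT hη _).trans hτ
    have h4 : I - η ≤ ∫ y in Ioi (0 : ℝ), fejer T (u - η - y) := by
      have h5 := le_integral_fejer_sub_Icc hT hη (u - η)
      have h6 : ∫ y in Icc (u - η - η) (u - η + η), fejer T (u - η - y) ≤
          ∫ y in Ioi (0 : ℝ), fejer T (u - η - y) :=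
        setIntegral_mono_set (integrable_fejer_sub hT _).integrableOn
          (ae_of_all _ fun y => fejer_nonneg hT _) (Eventually.of_forall hsub)
      linarith
    rw [hsplit] at h1
    have h5 := (abs_lt.mp h1).1
    have h6 : c * (I - η) - C * η - η ≤ Real.exp (2 * η) * B u * I := by
      nlinarith
    refine lt_of_lt_of_le hη2 ?_
    rw [div_le_iff₀ hIpos]
    have h7 : Real.exp (-(2 * η)) * (Real.exp (2 * η) * B u * I) = B u * I := by
      rw [Real.exp_neg]
      field_simp
    rw [← h7]
    gcongr
  filter_upwards [hup', hlo'] with u h1 h2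
  rw [Real.dist_eq, abs_lt]
  constructor <;> linarith
end PrimeSum

namespace PrimeSum
open MeasureTheory Set Topology ArithmeticFunction ArithmeticFunction.vonMangoldt

lemma sum_residueClass_le {q : ℕ} (a : ZMod q) {x : ℝ} (hx : 0 ≤ x) :
    ∑ k ∈ Finset.Icc 1 ⌊x⌋₊, residueClass a k ≤ (Real.log 4 + 4) * x := by
  refine le_trans ?_ (Chebyshev.psi_le_const_mul_self hx)
  rw [Chebyshev.psi]
  exact Finset.sum_le_sum fun k _ => residueClass_le a k

lemma isBigO_sum_residueClass {q : ℕ} (a : ZMod q) :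
    (fun n : ℕ => ∑ k ∈ Finset.Icc 1 n, residueClass a k) =O[atTop] fun n => (n : ℝ) ^ (1 : ℝ) := by
  refine Asymptotics.IsBigO.of_bound (Real.log 4 + 4) (Eventually.of_forall fun n => ?_)
  have := sum_residueClass_le a (n.cast_nonneg (α := ℝ))
  rw [Nat.floor_natCast] at this
  rw [Real.rpow_one, Real.norm_of_nonneg (Finset.sum_nonneg fun _ _ => residueClass_nonneg a _),
    Real.norm_of_nonneg (Nat.cast_nonneg _)]
  exact this

lemma LSeries_residueClass_eq_integral {q : ℕ} (a : ZMod q) {s : ℂ} (hs : 1 < s.re) :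
    LSeries (fun n => (residueClass a n : ℂ)) s = s * ∫ y in Ioi (0 : ℝ),
      ((Real.exp (-y) * ∑ k ∈ Finset.Icc 1 ⌊Real.exp y⌋₊, residueClass a k : ℝ) : ℂ) *
        Complex.exp (-(s - 1) * y) := by
  rw [LSeries_eq_mul_integral_of_nonneg _ zero_le_one hs (isBigO_sum_residueClass a)
    (residueClass_nonneg a)]
  congr 1
  rw [← Real.exp_zero, ← integral_comp_exp_Ioi]
  congr 1 with y
  have h1 : ((Real.exp y : ℝ) : ℂ) ^ (-(s + 1)) = Complex.exp (-(s + 1) * y) := by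
    rw [Complex.cpow_def_of_ne_zero (by exact_mod_cast (Real.exp_pos y).ne'), ← Complex.ofReal_log
      (Real.exp_pos y).le, Real.log_exp, mul_comm]
  rw [h1, Complex.real_smul]
  push_cast
  have h2 : Complex.exp (-(s - 1) * y) =
      Complex.exp y * Complex.exp y * Complex.exp (-(s + 1) * y) := by
    rw [← Complex.exp_add, ← Complex.exp_add]
    ring_nf
  rw [h2, Complex.exp_neg]
  have := Complex.exp_ne_zero y
  field_simp

/-- The prime number theorem for the von Mangoldt function in arithmetic progressions. -/
lemma tendsto_sum_residueClass {q : ℕ} [NeZero q] {a : ZMod q} (ha : IsUnit a) :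
    Tendsto (fun x : ℝ => (∑ k ∈ Finset.Icc 1 ⌊x⌋₊, residueClass a k) / x) atTop
      (𝓝 (q.totient : ℝ)⁻¹) := by
  set B : ℝ → ℝ := fun y => Real.exp (-y) * ∑ k ∈ Finset.Icc 1 ⌊Real.exp y⌋₊, residueClass a k
    with hB
  have hsum0 : ∀ n : ℕ, 0 ≤ ∑ k ∈ Finset.Icc 1 n, residueClass a k := fun n =>
    Finset.sum_nonneg fun _ _ => residueClass_nonneg a _
  have hB0 : ∀ y, 0 ≤ B y := fun y => mul_nonneg (Real.exp_pos _).le (hsum0 _)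
  have hBC : ∀ y, B y ≤ Real.log 4 + 4 := by
    intro y
    have := sum_residueClass_le a (Real.exp_pos y).le
    calc B y ≤ Real.exp (-y) * ((Real.log 4 + 4) * Real.exp y) := by
            simp only [hB]; gcongr
      _ = Real.log 4 + 4 := by rw [Real.exp_neg]; field_simp
  have hBm : Measurable B := by
    refine (by fun_prop : Measurable fun y : ℝ => Real.exp (-y)).mul ?_
    exact (measurable_from_nat (f := fun n => ∑ k ∈ Finset.Icc 1 n, residueClass a k)).comp
      (Nat.measurable_floor.comp Real.measurable_exp)
  have key : Tendsto B atTop (𝓝 (q.totient : ℝ)⁻¹) := by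
    refine tendsto_of_laplace hBm hB0 hBC (by positivity) ?_
      (G := fun s => (LFunctionResidueClassAux a s - (q.totient : ℂ)⁻¹) / s) ?_ ?_
    · intro y _ h hh
      have h1 : ∑ k ∈ Finset.Icc 1 ⌊Real.exp y⌋₊, residueClass a k ≤
          ∑ k ∈ Finset.Icc 1 ⌊Real.exp (y + h)⌋₊, residueClass a k := by
        refine Finset.sum_le_sum_of_subset_of_nonneg ?_ fun _ _ _ => residueClass_nonneg a _
        apply Finset.Icc_subset_Icc_right
        gcongr
        linarith
      rw [hB]
      simp only
      rw [← mul_assoc, ← Real.exp_add, neg_add, add_comm (-h)]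
      gcongr
    · refine ((continuousOn_LFunctionResidueClassAux a).sub continuousOn_const).div
        continuousOn_id fun s hs => ?_
      rintro rfl
      simp at hs
      linarith
    · intro s hs
      have hs0 : s ≠ 0 := by rintro rfl; simp at hs; linarith
      have hs1 : s - 1 ≠ 0 := by
        intro h
        rw [sub_eq_zero.mp h] at hs
        simp at hs
      rw [eqOn_LFunctionResidueClassAux ha hs]
      simp only
      rw [LSeries_residueClass_eq_integral a hs]
      have hre : (-(s - 1)).re < 0 := by simp; linarith
      have h2 := integral_exp_mul_complex_Ioi hre 0
      have hi2 := integrableOn_exp_mul_complex_Ioi hre 0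
      have hi1 : IntegrableOn (fun y : ℝ => (B y : ℂ) * Complex.exp (-(s - 1) * y)) (Ioi 0) := by
        refine Integrable.bdd_mul hi2 (c := Real.log 4 + 4) ?_ (ae_of_all _ fun y => ?_)
        · exact (Complex.measurable_ofReal.comp hBm).aestronglyMeasurable
        · rw [Complex.norm_real, Real.norm_of_nonneg (hB0 y)]
          exact hBC y
      have h3 : ∫ y in Ioi (0 : ℝ), ((B y - (q.totient : ℝ)⁻¹ : ℝ) : ℂ) *
          Complex.exp (-(s - 1) * y) = (∫ y in Ioi (0 : ℝ), (B y : ℂ) *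
          Complex.exp (-(s - 1) * y)) - (q.totient : ℂ)⁻¹ *
            ∫ y in Ioi (0 : ℝ), Complex.exp (-(s - 1) * y) := by
        rw [← integral_const_mul, ← integral_sub hi1 (hi2.const_mul _)]
        congr 1 with y
        push_cast
        ring
      rw [h3, h2]
      simp only [Complex.ofReal_zero, mul_zero, Complex.exp_zero]
      have hs1' : 1 - s ≠ 0 := by rw [← neg_sub]; exact neg_ne_zero.mpr hs1
      field_simp
      ring
  refine (key.comp Real.tendsto_log_atTop).congr' ?_
  filter_upwards [eventually_gt_atTop 0] with x hx
  simp only [Function.comp, hB]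
  rw [Real.exp_neg, Real.exp_log hx]
  field_simp

/-- Sum of `log p` over the primes `p ≤ n` in a residue class. -/
noncomputable def thetaMod {q : ℕ} (a : ZMod q) (n : ℕ) : ℝ :=
  ∑ k ∈ (Finset.Ioc 0 n).filter (fun k : ℕ => k.Prime ∧ (k : ZMod q) = a), Real.log k

lemma thetaMod_le_sum_residueClass {q : ℕ} (a : ZMod q) (n : ℕ) :
    thetaMod a n ≤ ∑ k ∈ Finset.Icc 1 n, residueClass a k := by
  rw [thetaMod, Finset.sum_filter, ← Finset.Icc_add_one_left_eq_Ioc]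
  refine Finset.sum_le_sum fun k _ => ?_
  split_ifs with h
  · rw [residueClass, indicator_of_mem (by exact h.2), vonMangoldt_apply_prime h.1]
  · exact residueClass_nonneg a k

lemma sum_residueClass_sub_thetaMod_le {q : ℕ} (a : ZMod q) (n : ℕ) :
    ∑ k ∈ Finset.Icc 1 n, residueClass a k - thetaMod a n ≤
      Chebyshev.psi n - Chebyshev.theta n := by
  rw [thetaMod, Chebyshev.psi, Chebyshev.theta, Finset.sum_filter, Finset.sum_filter,
    ← Finset.Icc_add_one_left_eq_Ioc, Nat.floor_natCast, zero_add, ← Finset.sum_sub_distrib,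
    ← Finset.sum_sub_distrib]
  refine Finset.sum_le_sum fun k _ => ?_
  by_cases hp : k.Prime
  · by_cases ha : (k : ZMod q) = a
    · rw [residueClass, indicator_of_mem (by exact ha)]
      simp [hp, ha]
    · rw [residueClass, indicator_of_notMem (by exact ha)]
      simp [hp, ha, vonMangoldt_apply_prime hp]
  · simp only [hp, false_and, if_false, sub_zero]
    exact residueClass_le a k

lemma tendsto_thetaMod {q : ℕ} [NeZero q] {a : ZMod q} (ha : IsUnit a) :
    Tendsto (fun n : ℕ => thetaMod a n / n) atTop (𝓝 (q.totient : ℝ)⁻¹) := by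
  have h1 : Tendsto (fun n : ℕ => (∑ k ∈ Finset.Icc 1 n, residueClass a k) / n) atTop
      (𝓝 (q.totient : ℝ)⁻¹) := by
    simpa [Function.comp_def] using (tendsto_sum_residueClass ha).comp
      (tendsto_natCast_atTop_atTop (R := ℝ))
  obtain ⟨C, hC⟩ := Chebyshev.psi_sub_theta_le_mul_sqrt
  have h2 : Tendsto (fun n : ℕ => C * (1 / Real.sqrt n)) atTop (𝓝 0) := by
    have : Tendsto (fun n : ℕ => Real.sqrt n) atTop atTop :=
      Real.tendsto_sqrt_atTop.comp tendsto_natCast_atTop_atTop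
    simpa using (this.inv_tendsto_atTop).const_mul C
  have h3 := h1.sub h2
  rw [sub_zero] at h3
  refine tendsto_of_tendsto_of_tendsto_of_le_of_le' h3 h1 ?_ ?_
  · filter_upwards [eventually_gt_atTop 0] with n hn
    have hn' : (0 : ℝ) < n := by exact_mod_cast hn
    have h4 := sum_residueClass_sub_thetaMod_le a n
    have h5 := hC n
    have h6 : C * (1 / Real.sqrt n) = C * Real.sqrt n / n := by
      have := Real.mul_self_sqrt hn'.le
      have h7 : 0 < Real.sqrt n := Real.sqrt_pos.mpr hn'
      rw [mul_one_div, div_eq_div_iff h7.ne' hn'.ne']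
      linear_combination -C * this
    rw [h6, ← sub_div]
    gcongr
    linarith
  · filter_upwards with n
    gcongr
    exact thetaMod_le_sum_residueClass a n

lemma exists_abs_thetaMod_sub_le {q : ℕ} [NeZero q] {a : ZMod q} (ha : IsUnit a) {δ : ℝ}
    (hδ : 0 < δ) :
    ∃ N₀ : ℕ, ∀ N ≥ N₀, ∀ n ≤ N, |thetaMod a n - n / q.totient| ≤ δ * N := by
  obtain ⟨n₀, hn₀⟩ := eventually_atTop.mp
    (((Metric.tendsto_nhds.mp (tendsto_thetaMod ha)) δ hδ).and (eventually_gt_atTop 0))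
  set K := ∑ n ∈ Finset.range n₀, |thetaMod a n - n / q.totient| with hK
  obtain ⟨N₀, hN₀⟩ := exists_nat_ge (K / δ)
  refine ⟨N₀, fun N hN n hn => ?_⟩
  by_cases h : n < n₀
  · calc |thetaMod a n - n / q.totient| ≤ K :=
        Finset.single_le_sum (f := fun n : ℕ => |thetaMod a n - n / q.totient|)
          (fun _ _ => abs_nonneg _) (Finset.mem_range.mpr h)
      _ ≤ δ * N := by
        rw [div_le_iff₀ hδ] at hN₀
        have : (N₀ : ℝ) ≤ N := by exact_mod_cast hN
        nlinarith
  · obtain ⟨h1, h2⟩ := hn₀ n (not_lt.mp h)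
    have hn' : (0 : ℝ) < n := by exact_mod_cast h2
    rw [Real.dist_eq] at h1
    have h3 : thetaMod a n - n / q.totient = n * (thetaMod a n / n - (q.totient : ℝ)⁻¹) := by
      field_simp
    rw [h3, abs_mul, abs_of_pos hn', mul_comm]
    have : (n : ℝ) ≤ N := by exact_mod_cast hn
    gcongr

/-- The prime number theorem in arithmetic progressions, as a lower bound on all subintervals of
`[0, N]`. -/
lemma exists_le_sum_log_prime {q b : ℕ} (hq : 0 < q) (hb : b.Coprime q) {δ : ℝ} (hδ : 0 < δ) :
    ∃ N₀ : ℕ, ∀ N ≥ N₀, ∀ x y : ℕ, x ≤ y → y ≤ N → ((y : ℝ) - x) / q.totient - δ * N ≤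
      ∑ k ∈ Finset.Ioc x y with k.Prime ∧ k ≡ b [MOD q], Real.log k := by
  have : NeZero q := ⟨hq.ne'⟩
  have ha : IsUnit (b : ZMod q) := (ZMod.isUnit_iff_coprime b q).mpr hb
  obtain ⟨N₀, hN₀⟩ := exists_abs_thetaMod_sub_le ha (half_pos hδ)
  refine ⟨N₀, fun N hN x y hxy hyN => ?_⟩
  have h1 := (abs_le.mp (hN₀ N hN x (hxy.trans hyN))).2
  have h2 := (abs_le.mp (hN₀ N hN y hyN)).1
  have h3 : thetaMod (b : ZMod q) x + ∑ k ∈ Finset.Ioc x y with k.Prime ∧ k ≡ b [MOD q],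
      Real.log k = thetaMod (b : ZMod q) y := by
    simp only [thetaMod, ZMod.natCast_eq_natCast_iff]
    rw [Finset.sum_filter, Finset.sum_filter, Finset.sum_filter,
      Finset.sum_Ioc_consecutive _ (Nat.zero_le _) hxy]
  rw [sub_div]
  linarith
end PrimeSum

namespace PrimeSum
open Finset

/-- The squarefree number with prime factor set `t`. -/
def primeProd (t : Finset ℕ) : ℕ := ∏ p ∈ t, p

/-- Coefficient of the indicator of `primeProd t ∣ n` in the `s`-th term of `selF`. -/
noncomputable def selCoeff (s t : Finset ℕ) : ℝ :=
  (∏ p ∈ t, (-(p : ℝ))) * ∏ p ∈ s, ((p : ℝ) - 1)⁻¹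

/-- The normalizing sum of the Selberg sieve. -/
noncomputable def selG (Q : Finset (Finset ℕ)) : ℝ := ∑ s ∈ Q, ∏ p ∈ s, ((p : ℝ) - 1)⁻¹

/-- The Selberg sieve sum, written as a truncated Ramanujan expansion. -/
noncomputable def selF (Q : Finset (Finset ℕ)) (n : ℕ) : ℝ :=
  ∑ s ∈ Q, ∏ p ∈ s, ((-(if p ∣ n then (p : ℝ) else 0) + 1) * ((p : ℝ) - 1)⁻¹)

lemma primeProd_pos {t : Finset ℕ} (ht : ∀ p ∈ t, p.Prime) : 0 < primeProd t :=
  prod_pos fun p hp => (ht p hp).pos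

lemma primeProd_dvd_iff {t : Finset ℕ} (ht : ∀ p ∈ t, p.Prime) (n : ℕ) :
    primeProd t ∣ n ↔ ∀ p ∈ t, p ∣ n :=
  ⟨fun h _ hp => (dvd_prod_of_mem _ hp).trans h,
    fun h => prod_primes_dvd n (fun p hp => (ht p hp).prime) h⟩

lemma prod_sub_one_inv_pos {s : Finset ℕ} (hs : ∀ p ∈ s, p.Prime) :
    0 < ∏ p ∈ s, ((p : ℝ) - 1)⁻¹ := by
  refine prod_pos fun p hp => inv_pos.mpr ?_
  have : (2 : ℝ) ≤ p := by exact_mod_cast (hs p hp).two_le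
  linarith

lemma selG_nonneg {Q : Finset (Finset ℕ)} (hQ : ∀ s ∈ Q, ∀ p ∈ s, p.Prime) : 0 ≤ selG Q :=
  sum_nonneg fun s hs => (prod_sub_one_inv_pos (hQ s hs)).le

lemma selG_mono {Q Q' : Finset (Finset ℕ)} (hQ : ∀ s ∈ Q, ∀ p ∈ s, p.Prime) (h : Q' ⊆ Q) :
    selG Q' ≤ selG Q :=
  sum_le_sum_of_subset_of_nonneg h fun s hs _ => (prod_sub_one_inv_pos (hQ s hs)).le

lemma selF_eq_sum {Q : Finset (Finset ℕ)} (hQ : ∀ s ∈ Q, ∀ p ∈ s, p.Prime) (n : ℕ) :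
    selF Q n = ∑ s ∈ Q, ∑ t ∈ s.powerset, selCoeff s t * if primeProd t ∣ n then 1 else 0 := by
  refine sum_congr rfl fun s hs => ?_
  rw [prod_mul_distrib, prod_add_one, sum_mul]
  refine sum_congr rfl fun t ht => ?_
  have hts := mem_powerset.mp ht
  rw [selCoeff]
  simp only [primeProd_dvd_iff fun p hp => hQ s hs p (hts hp)]
  split_ifs with h
  · rw [mul_one]
    congr 1
    exact prod_congr rfl fun p hp => by rw [if_pos (h p hp)]
  · push Not at h
    obtain ⟨p, hp, hpn⟩ := h
    rw [mul_zero, prod_eq_zero hp (by simp [hpn]), zero_mul]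

lemma selF_of_coprime {Q : Finset (Finset ℕ)} {n : ℕ} (h : ∀ s ∈ Q, ∀ p ∈ s, ¬ p ∣ n) :
    selF Q n = selG Q := by
  refine sum_congr rfl fun s hs => prod_congr rfl fun p hp => ?_
  simp [h s hs p hp]

lemma sum_powerset_powerset_eq (s₁ s₂ : Finset ℕ) (h₁ : ∀ p ∈ s₁, p.Prime)
    (h₂ : ∀ p ∈ s₂, p.Prime) :
    ∑ t₁ ∈ s₁.powerset, ∑ t₂ ∈ s₂.powerset, (∏ p ∈ t₁, (-(p : ℝ))) * (∏ p ∈ t₂, (-(p : ℝ))) *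
      ∏ p ∈ t₁ ∪ t₂, (p : ℝ)⁻¹ = if s₁ = s₂ then ∏ p ∈ s₁, ((p : ℝ) - 1) else 0 := by
  -- a prime in exactly one of the two sets makes the sum vanish
  have key : ∀ s₁ s₂ : Finset ℕ, ∀ p ∈ s₁, p ∉ s₂ → p.Prime →
      ∑ t₁ ∈ s₁.powerset, ∑ t₂ ∈ s₂.powerset, (∏ p ∈ t₁, (-(p : ℝ))) *
        (∏ p ∈ t₂, (-(p : ℝ))) * ∏ p ∈ t₁ ∪ t₂, (p : ℝ)⁻¹ = 0 := by
    intro s₁ s₂ p hp₁ hp₂ hp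
    have hp0 : (p : ℝ) ≠ 0 := by exact_mod_cast hp.ne_zero
    rw [← insert_erase hp₁, sum_powerset_insert (notMem_erase p s₁), ← sum_add_distrib]
    refine sum_eq_zero fun t₁ ht₁ => ?_
    have ht₁' : p ∉ t₁ := fun h => notMem_erase p s₁ (mem_powerset.mp ht₁ h)
    rw [← sum_add_distrib]
    refine sum_eq_zero fun t₂ ht₂ => ?_
    have hu : p ∉ t₁ ∪ t₂ := by
      rw [mem_union, not_or]
      exact ⟨ht₁', fun h => hp₂ (mem_powerset.mp ht₂ h)⟩
    rw [prod_insert ht₁', insert_union, prod_insert hu]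
    field_simp
    ring
  have comm : ∀ s₁ s₂ : Finset ℕ, ∑ t₁ ∈ s₁.powerset, ∑ t₂ ∈ s₂.powerset,
        (∏ p ∈ t₁, (-(p : ℝ))) * (∏ p ∈ t₂, (-(p : ℝ))) * ∏ p ∈ t₁ ∪ t₂, (p : ℝ)⁻¹ =
      ∑ t₁ ∈ s₂.powerset, ∑ t₂ ∈ s₁.powerset, (∏ p ∈ t₁, (-(p : ℝ))) * (∏ p ∈ t₂, (-(p : ℝ))) *
        ∏ p ∈ t₁ ∪ t₂, (p : ℝ)⁻¹ := by
    intro s₁ s₂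
    rw [sum_comm]
    refine sum_congr rfl fun t₁ _ => sum_congr rfl fun t₂ _ => ?_
    rw [union_comm, mul_comm (∏ p ∈ t₂, (-(p : ℝ)))]
  split_ifs with h
  · subst h
    induction s₁ using Finset.induction_on with
    | empty => simp
    | insert p s hps ih =>
      have hp : p.Prime := h₁ p (mem_insert_self p s)
      have hp0 : (p : ℝ) ≠ 0 := by exact_mod_cast hp.ne_zero
      have hs : ∀ q ∈ s, q.Prime := fun q hq => h₁ q (mem_insert_of_mem hq)
      rw [prod_insert hps, ← ih hs hs, sum_powerset_insert hps, mul_sum, ← sum_add_distrib]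
      refine sum_congr rfl fun t₁ ht₁ => ?_
      have ht₁' : p ∉ t₁ := fun h => hps (mem_powerset.mp ht₁ h)
      rw [sum_powerset_insert hps, sum_powerset_insert hps, mul_sum, ← sum_add_distrib,
        ← sum_add_distrib, ← sum_add_distrib]
      refine sum_congr rfl fun t₂ ht₂ => ?_
      have ht₂' : p ∉ t₂ := fun h => hps (mem_powerset.mp ht₂ h)
      have hu : p ∉ t₁ ∪ t₂ := by
        rw [mem_union, not_or]
        exact ⟨ht₁', ht₂'⟩
      rw [prod_insert ht₁', prod_insert ht₂', insert_union, insert_union, union_insert,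
        insert_idem, prod_insert hu]
      field_simp
      ring
  · by_cases h' : s₁ ⊆ s₂
    · obtain ⟨p, hp₂, hp₁⟩ := not_subset.mp fun hss => h (h'.antisymm hss)
      rw [comm]
      exact key s₂ s₁ p hp₂ hp₁ (h₂ p hp₂)
    · obtain ⟨p, hp₁, hp₂⟩ := not_subset.mp h'
      exact key s₁ s₂ p hp₁ hp₂ (h₁ p hp₁)

lemma exists_dvd_iff_modEq {D V : ℕ} (hD : 0 < D) (hDV : D.Coprime V) (b : ℕ) :
    ∃ r < D, ∀ x : ℕ, D ∣ V * x + b ↔ x ≡ r [MOD D] := by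
  have : NeZero D := ⟨hD.ne'⟩
  set u := ZMod.unitOfCoprime V hDV.symm
  refine ⟨(-(u⁻¹ : (ZMod D)ˣ) * (b : ZMod D)).val, ZMod.val_lt _, fun x => ?_⟩
  rw [← ZMod.natCast_eq_zero_iff, ← ZMod.natCast_eq_natCast_iff, ZMod.natCast_zmod_val]
  have hu : ((V : ℕ) : ZMod D) = u := (ZMod.coe_unitOfCoprime V hDV.symm).symm
  push_cast
  rw [hu]
  constructor
  · intro h
    have : (x : ZMod D) = (u⁻¹ : (ZMod D)ˣ) * (u * x + b) - (u⁻¹ : (ZMod D)ˣ) * b := by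
      rw [mul_add, ← mul_assoc, Units.inv_mul]
      ring
    rw [this, h]
    ring
  · intro h
    rw [h, ← mul_assoc, mul_neg, Units.mul_inv]
    ring

/-- Counting the terms of a progression divisible by `D`. -/
lemma abs_card_dvd_sub_le {D V : ℕ} (hD : 0 < D) (hDV : D.Coprime V) (b y : ℕ) :
    |(∑ x ∈ range y, if D ∣ V * x + b then (1 : ℝ) else 0) - y / D| ≤ 1 := by
  obtain ⟨r, -, hr⟩ := exists_dvd_iff_modEq hD hDV b
  simp_rw [hr]
  rw [sum_boole, ← Nat.count_eq_card_filter_range]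
  have h := Nat.count_modEq_card_eq_ceil y hD r
  have h1 := Int.ceil_lt_add_one (((y : ℚ) - (r % D : ℕ)) / D)
  have h2 := Int.le_ceil (((y : ℚ) - (r % D : ℕ)) / D)
  rw [← h] at h1 h2
  have hDq : (0 : ℝ) < D := by exact_mod_cast hD
  have h3 : ((Nat.count (fun x => x ≡ r [MOD D]) y : ℕ) : ℝ) <
      ((y : ℝ) - (r % D : ℕ)) / D + 1 := by
    have := (Rat.cast_lt (K := ℝ)).mpr h1
    push_cast at this
    exact_mod_cast this
  have h4 : ((y : ℝ) - (r % D : ℕ)) / D ≤ ((Nat.count (fun x => x ≡ r [MOD D]) y : ℕ) : ℝ) := by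
    have := (Rat.cast_le (K := ℝ)).mpr h2
    push_cast at this
    exact_mod_cast this
  have h5 : ((r % D : ℕ) : ℝ) / D ≤ 1 := by
    rw [div_le_one hDq]
    exact_mod_cast (Nat.mod_lt r hD).le
  have h6 : (0 : ℝ) ≤ ((r % D : ℕ) : ℝ) / D := by positivity
  rw [sub_div] at h3 h4
  rw [abs_le]
  constructor <;> linarith

lemma primeProd_union_dvd_iff {t₁ t₂ : Finset ℕ} (h₁ : ∀ p ∈ t₁, p.Prime)
    (h₂ : ∀ p ∈ t₂, p.Prime) (n : ℕ) :
    primeProd (t₁ ∪ t₂) ∣ n ↔ primeProd t₁ ∣ n ∧ primeProd t₂ ∣ n := by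
  rw [primeProd_dvd_iff h₁, primeProd_dvd_iff h₂, primeProd_dvd_iff]
  · simp only [mem_union, or_imp, forall_and]
  · simp only [mem_union, or_imp, forall_and]
    exact ⟨h₁, h₂⟩

lemma sum_powerset_abs_selCoeff_le {s : Finset ℕ} (hs : ∀ p ∈ s, p.Prime) :
    ∑ t ∈ s.powerset, |selCoeff s t| ≤ 3 ^ #s := by
  have h1 : ∑ t ∈ s.powerset, |selCoeff s t| =
      ∏ p ∈ s, (((p : ℝ) + 1) * ((p : ℝ) - 1)⁻¹) := by
    rw [prod_mul_distrib, prod_add_one, sum_mul]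
    refine sum_congr rfl fun t ht => ?_
    rw [selCoeff, abs_mul, abs_of_pos (prod_sub_one_inv_pos hs), abs_prod]
    congr 1
    exact prod_congr rfl fun p _ => by simp
  rw [h1, ← prod_const]
  refine prod_le_prod (fun p hp => ?_) fun p hp => ?_ <;>
    have : (2 : ℝ) ≤ p := by exact_mod_cast (hs p hp).two_le
  · have : (0 : ℝ) < (p : ℝ) - 1 := by linarith
    positivity
  · rw [← div_eq_mul_inv, div_le_iff₀ (by linarith)]
    linarith

/-- The mean value of `selF ^ 2` on progressions. -/
lemma abs_sum_selF_sq_sub_le {Q : Finset (Finset ℕ)} (hQ : ∀ s ∈ Q, ∀ p ∈ s, p.Prime) {V : ℕ}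
    (hV : ∀ s ∈ Q, ∀ p ∈ s, p.Coprime V) (b y : ℕ) :
    |∑ x ∈ range y, selF Q (V * x + b) ^ 2 - y * selG Q| ≤ (∑ s ∈ Q, (3 : ℝ) ^ #s) ^ 2 := by
  have hQt : ∀ s ∈ Q, ∀ t ∈ s.powerset, ∀ p ∈ t, p.Prime := fun s hs t ht p hp =>
    hQ s hs p (mem_powerset.mp ht hp)
  have hcop : ∀ s ∈ Q, ∀ t ∈ s.powerset, ∀ s' ∈ Q, ∀ t' ∈ s'.powerset,
      (primeProd (t ∪ t')).Coprime V := by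
    intro s hs t ht s' hs' t' ht'
    refine Nat.Coprime.prod_left fun p hp => ?_
    rcases mem_union.mp hp with h | h
    · exact hV s hs p (mem_powerset.mp ht h)
    · exact hV s' hs' p (mem_powerset.mp ht' h)
  have h1 : ∑ x ∈ range y, selF Q (V * x + b) ^ 2 =
      ∑ s ∈ Q, ∑ t ∈ s.powerset, ∑ s' ∈ Q, ∑ t' ∈ s'.powerset, selCoeff s t * selCoeff s' t' *
        ∑ x ∈ range y, if primeProd (t ∪ t') ∣ V * x + b then (1 : ℝ) else 0 := by
    simp_rw [mul_sum]
    simp only [sum_comm (s := _) (t := range y)]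
    refine sum_congr rfl fun x _ => ?_
    rw [sq, selF_eq_sum hQ]
    simp_rw [sum_mul, mul_sum]
    refine sum_congr rfl fun s hs => sum_congr rfl fun t ht => sum_congr rfl fun s' hs' =>
      sum_congr rfl fun t' ht' => ?_
    have := primeProd_union_dvd_iff (hQt s hs t ht) (hQt s' hs' t' ht') (V * x + b)
    by_cases h1 : primeProd t ∣ V * x + b <;> by_cases h2 : primeProd t' ∣ V * x + b <;>
      simp [this, h1, h2]
  have h2 : y * selG Q = ∑ s ∈ Q, ∑ t ∈ s.powerset, ∑ s' ∈ Q, ∑ t' ∈ s'.powerset,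
      selCoeff s t * selCoeff s' t' * ((y : ℝ) / primeProd (t ∪ t')) := by
    have h3 : ∀ s ∈ Q, ∑ t ∈ s.powerset, ∑ s' ∈ Q, ∑ t' ∈ s'.powerset,
        selCoeff s t * selCoeff s' t' * ((y : ℝ) / primeProd (t ∪ t')) =
        y * ∏ p ∈ s, ((p : ℝ) - 1)⁻¹ := by
      intro s hs
      rw [sum_comm]
      have h4 : ∀ s' ∈ Q, ∑ t ∈ s.powerset, ∑ t' ∈ s'.powerset,
          selCoeff s t * selCoeff s' t' * ((y : ℝ) / primeProd (t ∪ t')) =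
          y * (∏ p ∈ s, ((p : ℝ) - 1)⁻¹) * (∏ p ∈ s', ((p : ℝ) - 1)⁻¹) *
          if s = s' then ∏ p ∈ s, ((p : ℝ) - 1) else 0 := by
        intro s' hs'
        rw [← sum_powerset_powerset_eq s s' (hQ s hs) (hQ s' hs'), mul_sum]
        refine sum_congr rfl fun t _ => ?_
        rw [mul_sum]
        refine sum_congr rfl fun t' _ => ?_
        rw [selCoeff, selCoeff, primeProd, Nat.cast_prod, div_eq_mul_inv, ← prod_inv_distrib]
        ring
      rw [sum_congr rfl h4]
      simp_rw [mul_ite, mul_zero]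
      rw [sum_ite_eq, if_pos hs, mul_assoc (_ * _), ← prod_mul_distrib]
      have h5 : ∏ p ∈ s, (((p : ℝ) - 1)⁻¹ * ((p : ℝ) - 1)) = 1 := by
        refine prod_eq_one fun p hp => ?_
        have : (2 : ℝ) ≤ p := by exact_mod_cast (hQ s hs p hp).two_le
        exact inv_mul_cancel₀ (by linarith)
      rw [h5, mul_one]
    rw [sum_congr rfl h3, selG, mul_sum]
  rw [h1, h2]
  simp_rw [← sum_sub_distrib]
  calc _ ≤ ∑ s ∈ Q, ∑ t ∈ s.powerset, ∑ s' ∈ Q, ∑ t' ∈ s'.powerset,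
        |selCoeff s t| * |selCoeff s' t'| := by
        refine (abs_sum_le_sum_abs _ _).trans (sum_le_sum fun s hs => ?_)
        refine (abs_sum_le_sum_abs _ _).trans (sum_le_sum fun t ht => ?_)
        refine (abs_sum_le_sum_abs _ _).trans (sum_le_sum fun s' hs' => ?_)
        refine (abs_sum_le_sum_abs _ _).trans (sum_le_sum fun t' ht' => ?_)
        rw [← mul_sub, abs_mul, abs_mul]
        refine mul_le_of_le_one_right (by positivity) (abs_card_dvd_sub_le (primeProd_pos ?_)
          (hcop s hs t ht s' hs' t' ht') b y)
        intro p hp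
        rcases mem_union.mp hp with h | h
        · exact hQt s hs t ht p h
        · exact hQt s' hs' t' ht' p h
    _ = (∑ s ∈ Q, ∑ t ∈ s.powerset, |selCoeff s t|) ^ 2 := by
        rw [sq]
        simp_rw [sum_mul, mul_sum]
    _ ≤ _ := by
        have : 0 ≤ ∑ s ∈ Q, ∑ t ∈ s.powerset, |selCoeff s t| :=
          sum_nonneg fun _ _ => sum_nonneg fun _ _ => abs_nonneg _
        gcongr with s hs
        exact sum_powerset_abs_selCoeff_le (hQ s hs)
end PrimeSum

namespace PrimeSum
open Finset

/-- The additive character `x ↦ exp (2πix)` on the reals. -/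
noncomputable def ee (x : ℝ) : ℂ := Complex.exp (Complex.I * (2 * Real.pi * x : ℝ))

lemma norm_ee (x : ℝ) : ‖ee x‖ = 1 := by
  rw [ee, mul_comm, Complex.norm_exp_ofReal_mul_I]

lemma ee_zero : ee 0 = 1 := by simp [ee]

lemma ee_add (x y : ℝ) : ee (x + y) = ee x * ee y := by
  rw [ee, ee, ee, ← Complex.exp_add]
  push_cast
  ring_nf

lemma ee_int (n : ℤ) : ee n = 1 := by
  rw [ee, Complex.exp_eq_one_iff]
  exact ⟨n, by push_cast; ring⟩

lemma ee_nat_mul (x : ℝ) (n : ℕ) : ee (n * x) = ee x ^ n := by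
  induction n with
  | zero => simp [ee_zero]
  | succ n ih => rw [pow_succ, ← ih, ← ee_add]; push_cast; ring_nf

lemma ee_add_int (x : ℝ) (n : ℤ) : ee (x + n) = ee x := by rw [ee_add, ee_int, mul_one]

lemma norm_ee_sub_one_le (x : ℝ) : ‖ee x - 1‖ ≤ 2 * Real.pi * |x| := by
  refine (Real.norm_exp_I_mul_ofReal_sub_one_le (x := 2 * Real.pi * x)).trans ?_
  rw [Real.norm_eq_abs, abs_mul, abs_of_pos Real.two_pi_pos]

lemma le_norm_ee_sub_one {x c : ℝ} (h : ∀ n : ℤ, c ≤ |x - n|) : 4 * c ≤ ‖ee x - 1‖ := by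
  set y := x - round x with hy
  have hxy : ee x = ee y := by
    rw [← ee_add_int y (round x), hy, sub_add_cancel]
  have hy2 : |y| ≤ 1 / 2 := abs_sub_round x
  have hc : c ≤ |y| := h (round x)
  have hpi := Real.pi_pos
  have h1 : |2 * Real.pi * y / 2| ≤ Real.pi / 2 := by
    rw [show 2 * Real.pi * y / 2 = Real.pi * y by ring, abs_mul, abs_of_pos hpi]
    nlinarith
  have h2 := Real.mul_abs_le_abs_sin h1
  rw [hxy, ee, Complex.norm_exp_I_mul_ofReal_sub_one, Real.norm_eq_abs, abs_mul, abs_two]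
  rw [show 2 * Real.pi * y / 2 = Real.pi * y by ring, abs_mul, abs_of_pos hpi] at h2
  have h3 : 2 / Real.pi * (Real.pi * |y|) = 2 * |y| := by field_simp
  rw [show 2 * Real.pi * y / 2 = Real.pi * y by ring]
  linarith

/-- Geometric sums of additive characters. -/
lemma norm_sum_ee_le {α c : ℝ} (hc : 0 < c) (h : ∀ n : ℤ, c ≤ |α - n|) (L : ℕ) :
    ‖∑ x ∈ range L, ee (x * α)‖ ≤ 1 / (2 * c) := by
  have h1 := le_norm_ee_sub_one h
  have h2 : ee α ≠ 1 := fun h0 => by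
    rw [h0, sub_self, norm_zero] at h1
    linarith
  simp_rw [ee_nat_mul]
  rw [geom_sum_eq h2, norm_div, div_le_div_iff₀ (by linarith) (by linarith)]
  have h3 : ‖ee α ^ L - 1‖ ≤ 2 := (norm_sub_le _ _).trans (by
    rw [norm_pow, norm_ee, one_pow, norm_one]; norm_num)
  nlinarith

/-- Partial summation against an additive character. -/
lemma norm_sum_mul_ee_le {c : ℕ → ℝ} {E : ℝ} {L : ℕ}
    (h : ∀ y ≤ L, |∑ x ∈ range y, c x| ≤ E) (β : ℝ) :
    ‖∑ x ∈ range L, c x * ee (x * β)‖ ≤ E * (1 + 2 * Real.pi * |β| * L) := by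
  have h1 : ∀ L : ℕ, ∑ x ∈ range L, c x * ee (x * β) =
      (∑ x ∈ range L, c x : ℝ) * ee (L * β) -
      ∑ y ∈ range L, (∑ x ∈ range (y + 1), c x : ℝ) * (ee (y * β) * (ee β - 1)) := by
    intro L
    induction L with
    | zero => simp
    | succ L ih =>
      rw [sum_range_succ, ih, sum_range_succ (fun y => _ * (ee (y * β) * (ee β - 1)))]
      have : ee ((L + 1 : ℕ) * β) = ee (L * β) * ee β := by
        rw [← ee_add]; push_cast; ring_nf
      rw [this, sum_range_succ c]
      push_cast
      ring
  have hn : ∀ r : ℝ, ‖(r : ℂ)‖ = |r| := fun r => by rw [Complex.norm_real, Real.norm_eq_abs]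
  rw [h1]
  refine (norm_sub_le _ _).trans ?_
  rw [norm_mul, norm_ee, mul_one, mul_add, mul_one, hn]
  refine add_le_add (h L le_rfl) ((norm_sum_le _ _).trans ?_)
  have h2 : ∀ y ∈ range L, ‖((∑ x ∈ range (y + 1), c x : ℝ) : ℂ) * (ee (y * β) * (ee β - 1))‖ ≤
      E * (2 * Real.pi * |β|) := by
    intro y hy
    rw [norm_mul, norm_mul, norm_ee, one_mul, hn]
    have h3 := h (y + 1) (mem_range.mp hy)
    exact mul_le_mul h3 (norm_ee_sub_one_le β) (norm_nonneg _) ((abs_nonneg _).trans h3)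
  refine (sum_le_sum h2).trans ?_
  rw [sum_const, card_range, nsmul_eq_mul]
  apply le_of_eq
  ring

/-- Upper bound for `1 / ‖j / k‖`. -/
noncomputable def invDist (k : ℕ) (j : ZMod k) : ℝ :=
  (k : ℝ) / (j.val : ℝ) + (k : ℝ) / ((k : ℝ) - j.val)

lemma invDist_nonneg {k : ℕ} [NeZero k] (j : ZMod k) : 0 ≤ invDist k j := by
  have : (j.val : ℝ) < k := by exact_mod_cast j.val_lt
  have : (0 : ℝ) < k - j.val := by linarith
  unfold invDist
  positivity

lemma sum_range_zmod {k : ℕ} [NeZero k] (φ : ZMod k → ℝ) :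
    ∑ r ∈ range k, φ (r : ZMod k) = ∑ j : ZMod k, φ j := by
  refine sum_nbij' (fun r => (r : ZMod k)) ZMod.val (fun _ _ => mem_univ _)
    (fun j _ => mem_range.mpr j.val_lt) (fun r hr => ?_) (fun j _ => ZMod.natCast_zmod_val j)
    fun _ _ => rfl
  exact ZMod.val_cast_of_lt (mem_range.mp hr)

lemma sum_range_mul_zmod {k : ℕ} [NeZero k] (φ : ZMod k → ℝ) (q : ℕ) :
    ∑ r ∈ range (k * q), φ (r : ZMod k) = q * ∑ j : ZMod k, φ j := by
  induction q with
  | zero => simp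
  | succ q ih =>
    rw [mul_add, mul_one, sum_range_add, ih, ← sum_range_zmod φ]
    push_cast
    simp
    ring

lemma sum_invDist_le {k : ℕ} [NeZero k] : ∑ j, invDist k j ≤ 2 * k * (1 + Real.log k) := by
  have h := harmonic_le_one_add_log k
  have hH : ((harmonic k : ℚ) : ℝ) = ∑ i ∈ range k, ((i : ℝ) + 1)⁻¹ := by
    rw [harmonic]; push_cast; rfl
  rw [hH] at h
  have e : ∀ r ∈ range k, invDist k (r : ZMod k) = (k : ℝ) / r + k / ((k : ℝ) - r) := fun r hr => by
    rw [invDist, ZMod.val_cast_of_lt (mem_range.mp hr)]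
  rw [← sum_range_zmod, sum_congr rfl e, sum_add_distrib]
  have h1 : ∑ r ∈ range k, (k : ℝ) / ((k : ℝ) - r) = k * ∑ i ∈ range k, ((i : ℝ) + 1)⁻¹ := by
    rw [mul_sum, ← sum_range_reflect]
    refine sum_congr rfl fun r hr => ?_
    have := mem_range.mp hr
    rw [Nat.sub_sub, Nat.cast_sub (by omega), div_eq_mul_inv]
    push_cast
    congr 2
    ring
  have h2 : ∑ r ∈ range k, (k : ℝ) / r ≤ k * ∑ i ∈ range k, ((i : ℝ) + 1)⁻¹ := by
    obtain ⟨m, hm⟩ : ∃ m, k = m + 1 := ⟨k - 1, by have := NeZero.pos k; omega⟩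
    have : ∑ r ∈ range (m + 1), (k : ℝ) / r = k * ∑ i ∈ range m, ((i : ℝ) + 1)⁻¹ := by
      rw [sum_range_succ', Nat.cast_zero, div_zero, add_zero, mul_sum]
      push_cast
      rfl
    rw [show range k = range (m + 1) by rw [hm], this, sum_range_succ]
    gcongr
    simp
    positivity
  rw [h1]
  have hk : (0 : ℝ) ≤ k := by positivity
  nlinarith

/-- Average of `1 / ‖Da / k‖` over an initial segment. -/
lemma sum_range_invDist_le {k : ℕ} [NeZero k] (a : (ZMod k)ˣ) (Y : ℕ) :
    ∑ D ∈ range Y, invDist k (D * a) ≤ 2 * (Y + k) * (1 + Real.log k) := by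
  have hk : 0 < k := NeZero.pos k
  have h1 : Y ≤ k * (Y / k + 1) := by
    have := Nat.div_add_mod Y k
    have := Nat.mod_lt Y hk
    rw [mul_add, mul_one]; omega
  have h2 : ∑ D ∈ range Y, invDist k (D * a) ≤ ∑ D ∈ range (k * (Y / k + 1)), invDist k (D * a) :=
    sum_le_sum_of_subset_of_nonneg (range_subset_range.mpr h1) fun _ _ _ => invDist_nonneg _
  refine h2.trans ?_
  rw [sum_range_mul_zmod (fun j : ZMod k => invDist k (j * a)),
    Fintype.sum_equiv (Units.mulRight a) (fun j : ZMod k => invDist k (j * a)) (invDist k) fun _ => rfl]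
  have h3 : ((Y / k : ℕ) : ℝ) * k ≤ Y := by exact_mod_cast Nat.div_mul_le_self Y k
  have h4 := sum_invDist_le (k := k)
  have h5 : 0 ≤ Real.log k := Real.log_natCast_nonneg k
  have h6 : (0 : ℝ) ≤ ((Y / k + 1 : ℕ) : ℝ) := by positivity
  calc _ ≤ ((Y / k + 1 : ℕ) : ℝ) * (2 * k * (1 + Real.log k)) := by gcongr
    _ = 2 * (((Y / k : ℕ) : ℝ) * k + k) * (1 + Real.log k) := by push_cast; ring
    _ ≤ _ := by gcongr

/-- The terms of a progression divisible by `D` form a progression. -/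
lemma exists_sum_dvd_eq {D V : ℕ} (hD : 0 < D) (hDV : D.Coprime V) (b L : ℕ) :
    ∃ r Y : ℕ, D ∣ V * r + b ∧ Y ≤ L / D + 1 ∧ ∀ {R : Type} [AddCommMonoid R] (φ : ℕ → R),
      ∑ x ∈ range L, (if D ∣ V * x + b then φ x else 0) = ∑ y ∈ range Y, φ (r + D * y) := by
  obtain ⟨r, hrD, hr⟩ := exists_dvd_iff_modEq hD hDV b
  have hY : ∀ y, y < (L - r + D - 1) / D ↔ r + D * y < L := fun y => by
    rw [← Nat.succ_le_iff, Nat.le_div_iff_mul_le hD, Nat.succ_mul, mul_comm]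
    omega
  refine ⟨r, (L - r + D - 1) / D, (hr r).mpr rfl, ?_, fun φ => ?_⟩
  · rw [← Nat.add_div_right L hD]
    exact Nat.div_le_div_right (by omega)
  have h4 : ∀ x, x ≡ r [MOD D] → x = r + D * (x / D) := fun x hx => by
    rw [Nat.ModEq, Nat.mod_eq_of_lt hrD] at hx
    rw [← hx, Nat.mod_add_div]
  have h3 : ∀ x, x ≡ r [MOD D] → (x - r) / D = x / D := fun x hx => by
    conv_lhs => rw [h4 x hx]
    rw [Nat.add_sub_cancel_left, Nat.mul_div_cancel_left _ hD]
  rw [← sum_filter]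
  refine (sum_nbij' (fun y => r + D * y) (fun x => (x - r) / D) (fun y hy => ?_) (fun x hx => ?_)
    (fun y _ => ?_) (fun x hx => ?_) fun _ _ => rfl).symm
  · rw [mem_filter, mem_range, hr]
    exact ⟨(hY y).mp (mem_range.mp hy), by simp [Nat.ModEq]⟩
  · obtain ⟨hx, hxr⟩ := mem_filter.mp hx
    rw [mem_range, hY, h3 x ((hr x).mp hxr), ← h4 x ((hr x).mp hxr)]
    exact mem_range.mp hx
  · rw [Nat.add_sub_cancel_left, Nat.mul_div_cancel_left _ hD]
  · have hxr := (hr x).mp (mem_filter.mp hx).2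
    rw [h3 x hxr, ← h4 x hxr]

/-- An additive character summed over the multiples of `D` in a progression. -/
lemma norm_sum_dvd_ee_le {α c : ℝ} (hc : 0 < c) {D V : ℕ} (hD : 0 < D) (hDV : D.Coprime V)
    (h : ∀ n : ℤ, c ≤ |D * α - n|) (b L : ℕ) :
    ‖∑ x ∈ range L, if D ∣ V * x + b then ee (x * α) else 0‖ ≤ 1 / (2 * c) := by
  obtain ⟨r, Y, -, -, h1⟩ := exists_sum_dvd_eq hD hDV b L
  rw [h1]
  have h2 : ∀ y : ℕ, ee ((r + D * y : ℕ) * α) = ee (r * α) * ee (y * (D * α)) := fun y => by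
    rw [← ee_add]
    push_cast
    ring_nf
  simp_rw [h2]
  rw [← mul_sum, norm_mul, norm_ee, one_mul]
  exact norm_sum_ee_le hc h Y

/-- Denominators `D` not divisible by `k` keep `Dα` away from the integers for `α` near `a / k`. -/
lemma invDist_le_abs_sub {k : ℕ} [NeZero k] {α : ℝ} {a : ℤ} {D : ℕ} (hD : (D * a : ZMod k) ≠ 0)
    (hα : |α - a / k| * (2 * D * k) ≤ 1) (n : ℤ) :
    1 / (2 * invDist k (D * a)) ≤ |D * α - n| ∧ 0 < invDist k (D * a) := by
  have hk : (0 : ℝ) < k := by exact_mod_cast NeZero.pos k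
  set j := (D * a : ZMod k) with hj
  have hj0 : (1 : ℝ) ≤ j.val := by
    exact_mod_cast Nat.one_le_iff_ne_zero.mpr fun h => hD ((ZMod.val_eq_zero j).mp h)
  have hjk : (j.val : ℝ) + 1 ≤ k := by exact_mod_cast j.val_lt
  have hjk' : (0 : ℝ) < k - j.val := by linarith
  have hpos : 0 < invDist k j := by
    unfold invDist
    positivity
  refine ⟨?_, hpos⟩
  obtain ⟨q, hq⟩ : ∃ q : ℤ, (D * a : ℤ) = j.val + k * q := by
    have h1 : ((D * a - j.val : ℤ) : ZMod k) = 0 := by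
      push_cast
      rw [ZMod.natCast_zmod_val, hj, sub_self]
    obtain ⟨q, hq⟩ := (ZMod.intCast_zmod_eq_zero_iff_dvd _ _).mp h1
    exact ⟨q, by linarith⟩
  have hq' : (D * a : ℝ) = j.val + k * q := by exact_mod_cast hq
  -- distance of `j / k` from the integers
  have h1 : 1 / invDist k j ≤ |(j.val : ℝ) / k - (n - q : ℤ)| ∧
      1 / k ≤ |(j.val : ℝ) / k - (n - q : ℤ)| := by
    rcases le_or_gt (n - q) 0 with h | h
    · have h2 : ((n - q : ℤ) : ℝ) ≤ 0 := by exact_mod_cast h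
      have h3 : (j.val : ℝ) / k ≤ |(j.val : ℝ) / k - (n - q : ℤ)| :=
        le_trans (by linarith) (le_abs_self _)
      refine ⟨le_trans ?_ h3, le_trans ?_ h3⟩
      · rw [← one_div_div (k : ℝ)]
        apply one_div_le_one_div_of_le (by positivity)
        unfold invDist
        linarith [div_pos hk hjk']
      · gcongr
    · have h2 : (1 : ℝ) ≤ ((n - q : ℤ) : ℝ) := by exact_mod_cast h
      have h3 : ((k : ℝ) - j.val) / k ≤ |(j.val : ℝ) / k - (n - q : ℤ)| := by
        rw [abs_sub_comm, sub_div, div_self hk.ne']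
        exact le_trans (by linarith) (le_abs_self _)
      refine ⟨le_trans ?_ h3, le_trans ?_ h3⟩
      · rw [← one_div_div (k : ℝ)]
        apply one_div_le_one_div_of_le (by positivity)
        unfold invDist
        have : 0 < (k : ℝ) / j.val := by positivity
        linarith
      · gcongr
        linarith
  have h2 : |D * α - n - ((j.val : ℝ) / k - (n - q : ℤ))| ≤ 1 / (2 * k) := by
    have : D * α - n - ((j.val : ℝ) / k - (n - q : ℤ)) = D * (α - a / k) := by
      push_cast
      field_simp
      linarith
    rw [this, abs_mul, Nat.abs_cast, le_div_iff₀ (by positivity)]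
    linarith
  have h3 := abs_sub_abs_le_abs_sub ((j.val : ℝ) / k - (n - q : ℤ)) (D * α - n)
  rw [abs_sub_comm ((j.val : ℝ) / k - (n - q : ℤ)) (D * α - n)] at h3
  have h4 : 1 / (2 * (k : ℝ)) = 1 / k / 2 := by field_simp
  have h5 : 1 / (2 * invDist k j) = 1 / invDist k j / 2 := by field_simp
  rw [h5]
  rw [h4] at h2
  linarith [h1.1, h1.2]
end PrimeSum

namespace PrimeSum
open Finset

/-- A family of prime factor sets closed under passing to divisors. -/
structure SieveSet (Q : Finset (Finset ℕ)) (z R V : ℕ) : Prop where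
  prime : ∀ s ∈ Q, ∀ p ∈ s, p.Prime
  lt : ∀ s ∈ Q, ∀ p ∈ s, z < p
  coprime : ∀ s ∈ Q, ∀ p ∈ s, p.Coprime V
  le : ∀ s ∈ Q, primeProd s ≤ R
  down : ∀ s ∈ Q, ∀ t ⊆ s, t ∈ Q

/-- Coefficient of the indicator of `primeProd t ∣ n` in `selF Q n`. -/
noncomputable def selL (Q : Finset (Finset ℕ)) (t : Finset ℕ) : ℝ :=
  ∑ s ∈ Q with t ⊆ s, selCoeff s t

lemma SieveSet.selF_eq {Q : Finset (Finset ℕ)} {z R V : ℕ} (hQ : SieveSet Q z R V) (n : ℕ) :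
    selF Q n = ∑ t ∈ Q, selL Q t * if primeProd t ∣ n then 1 else 0 := by
  rw [selF_eq_sum hQ.prime]
  simp_rw [selL, sum_mul]
  refine sum_comm' fun s t => ?_
  rw [mem_powerset, mem_filter]
  exact ⟨fun h => ⟨h, hQ.down s h.1 t h.2⟩, fun h => h.1⟩

lemma SieveSet.abs_selL_le {Q : Finset (Finset ℕ)} {z R V : ℕ} (hQ : SieveSet Q z R V)
    {t : Finset ℕ} (ht : t ∈ Q) : |selL Q t| ≤ 2 ^ #t * selG Q := by
  have h1 : ∀ s ∈ Q.filter (t ⊆ ·), |selCoeff s t| ≤ 2 ^ #t * ∏ p ∈ s \ t, ((p : ℝ) - 1)⁻¹ := by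
    intro s hs
    have hst := (mem_filter.mp hs).2
    have hs := (mem_filter.mp hs).1
    rw [selCoeff, abs_mul, abs_of_pos (prod_sub_one_inv_pos (hQ.prime s hs)), abs_prod,
      ← prod_sdiff hst, mul_left_comm, mul_comm, ← prod_mul_distrib, ← prod_const]
    refine mul_le_mul_of_nonneg_right (prod_le_prod (fun p hp => ?_) fun p hp => ?_)
      (prod_sub_one_inv_pos fun p hp => hQ.prime s hs p (mem_sdiff.mp hp).1).le <;>
    have : (2 : ℝ) ≤ p := by exact_mod_cast (hQ.prime t ht p hp).two_le
    · have : (0 : ℝ) < (p : ℝ) - 1 := by linarith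
      positivity
    · rw [abs_neg, Nat.abs_cast, ← div_eq_mul_inv, div_le_iff₀ (by linarith)]
      linarith
  refine (abs_sum_le_sum_abs _ _).trans ((sum_le_sum h1).trans ?_)
  rw [← mul_sum]
  refine mul_le_mul_of_nonneg_left ?_ (by positivity)
  have hinj : Set.InjOn (fun s => s \ t) (Q.filter (t ⊆ ·) : Finset (Finset ℕ)) := by
    intro s hs s' hs' h
    have h2 := (mem_filter.mp (mem_coe.mp hs)).2
    have h3 := (mem_filter.mp (mem_coe.mp hs')).2
    rw [← sdiff_union_of_subset h2, ← sdiff_union_of_subset h3]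
    exact congrArg (· ∪ t) h
  refine (sum_image (f := fun s : Finset ℕ => ∏ p ∈ s, ((p : ℝ) - 1)⁻¹) hinj).symm.trans_le ?_
  refine selG_mono hQ.prime fun s hs => ?_
  obtain ⟨s', hs', rfl⟩ := mem_image.mp hs
  exact hQ.down s' (mem_filter.mp hs').1 _ sdiff_subset

lemma primeFactors_primeProd {t : Finset ℕ} (ht : ∀ p ∈ t, p.Prime) :
    (primeProd t).primeFactors = t := Nat.primeFactors_prod ht

lemma sum_powerset_two_pow (s : Finset ℕ) : ∑ t ∈ s.powerset, (2 : ℝ) ^ #t = 3 ^ #s := by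
  have h := prod_add_one (f := fun _ : ℕ => (2 : ℝ)) s
  simp only [prod_const] at h
  rw [← h]
  norm_num

/-- Weighted sums over pairs of divisors, grouped by their least common multiple. -/
lemma SieveSet.sum_sum_le {Q : Finset (Finset ℕ)} {z R V : ℕ} (hQ : SieveSet Q z R V) {K : ℝ}
    (hK : ∀ s ∈ Q, (16 : ℝ) ^ #s ≤ K) {φ : ℕ → ℝ} (hφ : ∀ D, 0 ≤ φ D) :
    ∑ t₁ ∈ Q, ∑ t₂ ∈ Q, 2 ^ #t₁ * 2 ^ #t₂ * φ (primeProd (t₁ ∪ t₂)) ≤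
      K ^ 2 * ∑ D ∈ range (R ^ 2 + 1), φ D := by
  rw [← sum_product']
  have hp : ∀ x ∈ Q ×ˢ Q, ∀ p ∈ x.1 ∪ x.2, p.Prime := fun x hx p hp => by
    rw [mem_product] at hx
    rcases mem_union.mp hp with h | h
    exacts [hQ.prime _ hx.1 p h, hQ.prime _ hx.2 p h]
  have hmaps : ∀ x ∈ Q ×ˢ Q, primeProd (x.1 ∪ x.2) ∈ range (R ^ 2 + 1) := by
    intro x hx
    have hx' := mem_product.mp hx
    have h1 : primeProd (x.1 ∪ x.2) ≤ primeProd x.1 * primeProd x.2 := by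
      refine Nat.le_of_dvd (Nat.mul_pos (primeProd_pos (hQ.prime _ hx'.1))
        (primeProd_pos (hQ.prime _ hx'.2))) ?_
      rw [primeProd_union_dvd_iff (hQ.prime _ hx'.1) (hQ.prime _ hx'.2)]
      exact ⟨dvd_mul_right _ _, dvd_mul_left _ _⟩
    rw [mem_range, Nat.lt_succ_iff, sq]
    exact h1.trans (Nat.mul_le_mul (hQ.le _ hx'.1) (hQ.le _ hx'.2))
  rw [← sum_fiberwise_of_maps_to hmaps, mul_sum]
  refine sum_le_sum fun D _ => ?_
  have h1 : ∀ x ∈ (Q ×ˢ Q).filter (fun x => primeProd (x.1 ∪ x.2) = D),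
      (2 : ℝ) ^ #x.1 * 2 ^ #x.2 * φ (primeProd (x.1 ∪ x.2)) = 2 ^ #x.1 * 2 ^ #x.2 * φ D := by
    intro x hx
    rw [(mem_filter.mp hx).2]
  rw [sum_congr rfl h1, ← sum_mul]
  refine mul_le_mul_of_nonneg_right ?_ (hφ D)
  rcases ((Q ×ˢ Q).filter (fun x => primeProd (x.1 ∪ x.2) = D)).eq_empty_or_nonempty with h | h
  · rw [h, sum_empty]
    positivity
  obtain ⟨x, hx⟩ := h
  have hu : ∀ x ∈ (Q ×ˢ Q).filter (fun x => primeProd (x.1 ∪ x.2) = D),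
      D.primeFactors = x.1 ∪ x.2 := fun x hx => by
    rw [← (mem_filter.mp hx).2, primeFactors_primeProd (hp x (mem_filter.mp hx).1)]
  have h2 : (Q ×ˢ Q).filter (fun x => primeProd (x.1 ∪ x.2) = D) ⊆
      D.primeFactors.powerset ×ˢ D.primeFactors.powerset := by
    intro y hy
    rw [mem_product, mem_powerset, mem_powerset, hu y hy]
    exact ⟨subset_union_left, subset_union_right⟩
  refine (sum_le_sum_of_subset_of_nonneg h2 fun _ _ _ => by positivity).trans ?_
  rw [sum_product' (f := fun a b : Finset ℕ => (2 : ℝ) ^ #a * 2 ^ #b)]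
  simp_rw [← mul_sum, ← sum_mul, sum_powerset_two_pow]
  have hx' := mem_product.mp (mem_filter.mp hx).1
  have h3 : #D.primeFactors ≤ #x.1 + #x.2 := by
    rw [hu x hx]
    exact card_union_le _ _
  calc (3 : ℝ) ^ #D.primeFactors * 3 ^ #D.primeFactors = 9 ^ #D.primeFactors := by
        rw [← mul_pow]; norm_num
    _ ≤ 16 ^ #D.primeFactors := by gcongr; norm_num
    _ ≤ 16 ^ (#x.1 + #x.2) := by gcongr; norm_num
    _ = 16 ^ #x.1 * 16 ^ #x.2 := pow_add _ _ _
    _ ≤ K * K := mul_le_mul (hK _ hx'.1) (hK _ hx'.2) (by positivity)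
        (le_trans (by positivity) (hK _ hx'.1))
    _ = K ^ 2 := by ring

/-- If some prime factor of `k` does not occur in the sieve, the exponential sum is small near
fractions with denominator `k`. -/
lemma SieveSet.norm_sum_selF_sq_ee_le {Q : Finset (Finset ℕ)} {z R V : ℕ}
    (hQ : SieveSet Q z R V) {K : ℝ} (hK : ∀ s ∈ Q, (16 : ℝ) ^ #s ≤ K) {k p : ℕ} [NeZero k]
    (hp : p.Prime) (hpk : p ∣ k) (hpQ : ∀ s ∈ Q, p ∉ s) {α : ℝ} (a : (ZMod k)ˣ) {a' : ℤ}
    (ha : (a' : ZMod k) = a) (hα : |α - a' / k| * (2 * (R ^ 2 : ℕ) * k) ≤ 1) (b L : ℕ) :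
    ‖∑ x ∈ range L, ((selF Q (V * x + b) ^ 2 : ℝ) : ℂ) * ee (x * α)‖ ≤
      selG Q ^ 2 * (K ^ 2 * (2 * ((R ^ 2 + 1 : ℕ) + k) * (1 + Real.log k))) := by
  have hG := selG_nonneg hQ.prime
  have h1 : ∑ x ∈ range L, ((selF Q (V * x + b) ^ 2 : ℝ) : ℂ) * ee (x * α) =
      ∑ t₁ ∈ Q, ∑ t₂ ∈ Q, ((selL Q t₁ * selL Q t₂ : ℝ) : ℂ) *
        ∑ x ∈ range L, if primeProd (t₁ ∪ t₂) ∣ V * x + b then ee (x * α) else 0 := by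
    simp_rw [mul_sum]
    simp only [sum_comm (s := Q) (t := range L)]
    refine sum_congr rfl fun x _ => ?_
    rw [sq, hQ.selF_eq]
    push_cast
    simp_rw [sum_mul, mul_sum, sum_mul]
    refine sum_congr rfl fun t₁ h₁ => sum_congr rfl fun t₂ h₂ => ?_
    have := primeProd_union_dvd_iff (hQ.prime t₁ h₁) (hQ.prime t₂ h₂) (V * x + b)
    by_cases h3 : primeProd t₁ ∣ V * x + b <;> by_cases h4 : primeProd t₂ ∣ V * x + b <;>
      simp [this, h3, h4]
  rw [h1]
  calc _ ≤ ∑ t₁ ∈ Q, ∑ t₂ ∈ Q, (2 ^ #t₁ * selG Q) * (2 ^ #t₂ * selG Q) *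
        invDist k (primeProd (t₁ ∪ t₂) * a) := by
        refine (norm_sum_le _ _).trans (sum_le_sum fun t₁ h₁ => ?_)
        refine (norm_sum_le _ _).trans (sum_le_sum fun t₂ h₂ => ?_)
        have hu : ∀ q ∈ t₁ ∪ t₂, q.Prime ∧ q.Coprime V ∧ q ≠ p := fun q hq => by
          rcases mem_union.mp hq with h | h
          exacts [⟨hQ.prime _ h₁ q h, hQ.coprime _ h₁ q h, fun e => hpQ _ h₁ (e ▸ h)⟩,
            ⟨hQ.prime _ h₂ q h, hQ.coprime _ h₂ q h, fun e => hpQ _ h₂ (e ▸ h)⟩]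
        have hDpos := primeProd_pos fun q hq => (hu q hq).1
        have hDV : (primeProd (t₁ ∪ t₂)).Coprime V := Nat.Coprime.prod_left fun q hq => (hu q hq).2.1
        have hDR : primeProd (t₁ ∪ t₂) ≤ R ^ 2 := by
          have h1 : primeProd (t₁ ∪ t₂) ≤ primeProd t₁ * primeProd t₂ := by
            refine Nat.le_of_dvd (Nat.mul_pos (primeProd_pos (hQ.prime _ h₁))
              (primeProd_pos (hQ.prime _ h₂))) ?_
            rw [primeProd_union_dvd_iff (hQ.prime _ h₁) (hQ.prime _ h₂)]
            exact ⟨dvd_mul_right _ _, dvd_mul_left _ _⟩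
          rw [sq]
          exact h1.trans (Nat.mul_le_mul (hQ.le _ h₁) (hQ.le _ h₂))
        have hDk : ((primeProd (t₁ ∪ t₂) : ℕ) * (a' : ZMod k)) ≠ 0 := by
          rw [ha]
          intro h0
          have h0 : ((primeProd (t₁ ∪ t₂) : ℕ) : ZMod k) = 0 := by
            simpa using h0
          rw [ZMod.natCast_eq_zero_iff] at h0
          obtain ⟨q, hq, hpq⟩ := (hp.prime.dvd_finsetProd_iff _).mp (hpk.trans h0)
          exact (hu q hq).2.2 ((Nat.prime_dvd_prime_iff_eq hp (hu q hq).1).mp hpq).symm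
        have hα' : |α - a' / k| * (2 * (primeProd (t₁ ∪ t₂) : ℕ) * k) ≤ 1 := by
          refine le_trans ?_ hα
          have : ((primeProd (t₁ ∪ t₂) : ℕ) : ℝ) ≤ (R ^ 2 : ℕ) := by exact_mod_cast hDR
          gcongr
        have h5 := fun n => invDist_le_abs_sub hDk hα' n
        have h6 := norm_sum_dvd_ee_le (by have := (h5 0).2; positivity) hDpos hDV
          (fun n => (h5 n).1) b L
        rw [norm_mul, Complex.norm_real, Real.norm_eq_abs, abs_mul]
        have h7 := (h5 0).2
        rw [ha] at h6 h7
        have h8 : 1 / (2 * (1 / (2 * invDist k ((primeProd (t₁ ∪ t₂) : ℕ) * a)))) =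
            invDist k ((primeProd (t₁ ∪ t₂) : ℕ) * a) := by
          field_simp
        rw [h8] at h6
        gcongr
        · exact hQ.abs_selL_le h₁
        · exact hQ.abs_selL_le h₂
    _ = selG Q ^ 2 * ∑ t₁ ∈ Q, ∑ t₂ ∈ Q, 2 ^ #t₁ * 2 ^ #t₂ *
        invDist k ((primeProd (t₁ ∪ t₂) : ℕ) * a) := by
        simp_rw [mul_sum]
        refine sum_congr rfl fun _ _ => sum_congr rfl fun _ _ => ?_
        ring
    _ ≤ _ := by
        refine mul_le_mul_of_nonneg_left ?_ (by positivity)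
        refine (hQ.sum_sum_le hK (φ := fun D => invDist k (D * a))
          fun D => invDist_nonneg _).trans ?_
        exact mul_le_mul_of_nonneg_left (sum_range_invDist_le a _) (by positivity)

end PrimeSum

namespace PrimeSum
open Finset

/-- The members of `Q` divisible by `p`, with `p` removed. -/
def sieveDiv (Q : Finset (Finset ℕ)) (p : ℕ) : Finset (Finset ℕ) :=
  {s ∈ Q | p ∈ s}.image fun s => s.erase p

lemma selF_split (Q : Finset (Finset ℕ)) (p n : ℕ) :
    selF Q n = selF {s ∈ Q | p ∉ s} n +
      ((-(if p ∣ n then (p : ℝ) else 0) + 1) * ((p : ℝ) - 1)⁻¹) * selF (sieveDiv Q p) n := by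
  have hinj : Set.InjOn (fun s : Finset ℕ => s.erase p) ({s ∈ Q | p ∈ s} : Finset (Finset ℕ)) := by
    intro s hs s' hs' h
    have h2 := (mem_filter.mp (mem_coe.mp hs)).2
    have h3 := (mem_filter.mp (mem_coe.mp hs')).2
    rw [← insert_erase h2, ← insert_erase h3]
    exact congrArg (insert p) h
  rw [selF, ← sum_filter_not_add_sum_filter Q (p ∈ ·)]
  congr 1
  rw [selF, sieveDiv, sum_image hinj, mul_sum]
  refine sum_congr rfl fun s hs => ?_
  exact (mul_prod_erase s (fun p => (-(if p ∣ n then (p : ℝ) else 0) + 1) * ((p : ℝ) - 1)⁻¹)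
    (mem_filter.mp hs).2).symm

lemma SieveSet.mono {Q Q' : Finset (Finset ℕ)} {z R V : ℕ} (hQ : SieveSet Q z R V)
    (h : Q' ⊆ Q) (h' : ∀ s ∈ Q', ∀ t ⊆ s, t ∈ Q') : SieveSet Q' z R V :=
  ⟨fun s hs => hQ.prime s (h hs), fun s hs => hQ.lt s (h hs), fun s hs => hQ.coprime s (h hs),
    fun s hs => hQ.le s (h hs), h'⟩

lemma SieveSet.filter_notMem {Q : Finset (Finset ℕ)} {z R V : ℕ} (hQ : SieveSet Q z R V) (p : ℕ) :
    SieveSet {s ∈ Q | p ∉ s} z R V :=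
  hQ.mono (filter_subset _ _) fun s hs t hts => mem_filter.mpr
    ⟨hQ.down s (mem_filter.mp hs).1 t hts, fun h => (mem_filter.mp hs).2 (hts h)⟩

lemma SieveSet.sieveDiv_subset {Q : Finset (Finset ℕ)} {z R V : ℕ} (hQ : SieveSet Q z R V)
    (p : ℕ) : sieveDiv Q p ⊆ {s ∈ Q | p ∉ s} := by
  intro s hs
  obtain ⟨s', hs', rfl⟩ := mem_image.mp hs
  exact mem_filter.mpr ⟨hQ.down s' (mem_filter.mp hs').1 _ (erase_subset _ _), notMem_erase _ _⟩

lemma abs_sq_sub_sq_le {A B g u i : ℝ} (hu0 : 0 ≤ u) (hu1 : u ≤ 1) (hi : 0 ≤ i)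
    (hg : |g| ≤ u ∨ (g = -1 ∧ i = 1)) :
    |(A + g * B) ^ 2 - A ^ 2| ≤ 2 * (A ^ 2 + B ^ 2) * (u + i) := by
  have h1 : (A + g * B) ^ 2 - A ^ 2 = g * (2 * (A * B)) + g ^ 2 * B ^ 2 := by ring
  have h2 : |2 * (A * B)| ≤ A ^ 2 + B ^ 2 := by
    rw [abs_le]; constructor <;> nlinarith [sq_nonneg (A + B), sq_nonneg (A - B)]
  have key : ∀ v : ℝ, 0 ≤ v → v ≤ 1 → |g| ≤ v →
      |(A + g * B) ^ 2 - A ^ 2| ≤ 2 * (A ^ 2 + B ^ 2) * v := by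
    intro v hv0 hv1 hgv
    have h4 : g ^ 2 ≤ v := by
      rw [← sq_abs]
      nlinarith [abs_nonneg g]
    rw [h1]
    refine (abs_add_le _ _).trans ?_
    rw [abs_mul, abs_of_nonneg (by positivity : 0 ≤ g ^ 2 * B ^ 2)]
    have h5 : |g| * |2 * (A * B)| ≤ v * (A ^ 2 + B ^ 2) :=
      mul_le_mul hgv h2 (abs_nonneg _) hv0
    have h6 : g ^ 2 * B ^ 2 ≤ v * B ^ 2 := by gcongr
    nlinarith [mul_nonneg hv0 (sq_nonneg A)]
  have h0 : 0 ≤ 2 * (A ^ 2 + B ^ 2) := by positivity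
  rcases hg with hg | ⟨hg, rfl⟩
  · refine (key u hu0 hu1 hg).trans ?_
    gcongr
    linarith
  · refine (key 1 zero_le_one le_rfl (by rw [hg]; norm_num)).trans ?_
    gcongr
    linarith

/-- Removing a prime from the sieve changes the majorant little on average. -/
lemma SieveSet.sum_abs_sub_le {Q : Finset (Finset ℕ)} {z R V : ℕ} (hz : 0 < z)
    (hQ : SieveSet Q z R V) {p : ℕ} (hp : p.Prime) (hzp : z < p) (hpV : p.Coprime V) (b L : ℕ) :
    ∑ x ∈ range L, |selF Q (V * x + b) ^ 2 - selF {s ∈ Q | p ∉ s} (V * x + b) ^ 2| ≤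
      8 * (L * selG Q / z) + 4 * selG Q + 8 * (∑ s ∈ Q, (3 : ℝ) ^ #s) ^ 2 := by
  set G := selG Q
  set E := (∑ s ∈ Q, (3 : ℝ) ^ #s) ^ 2
  set u := ((p : ℝ) - 1)⁻¹ with hu
  have hzp' : (z : ℝ) + 1 ≤ p := by exact_mod_cast hzp
  have hz' : (1 : ℝ) ≤ z := by exact_mod_cast hz
  have hu0 : 0 < u := inv_pos.mpr (by linarith)
  have huz : u ≤ 1 / z := by
    rw [hu, one_div]
    exact inv_anti₀ (by linarith) (by linarith)
  have hz1 : 1 / (z : ℝ) ≤ 1 := by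
    rw [div_le_one (by linarith)]
    exact hz'
  have hG : 0 ≤ G := selG_nonneg hQ.prime
  have hE : 0 ≤ E := sq_nonneg _
  -- mean values
  have hmean : ∀ Q' ⊆ ({s ∈ Q | p ∉ s} : Finset (Finset ℕ)),
      ∑ x ∈ range L, selF Q' (V * x + b) ^ 2 * (u + if p ∣ V * x + b then 1 else 0) ≤
      2 * (L * G / z) + G + 2 * E := by
    intro Q' hQ'
    have hsub : Q' ⊆ Q := hQ'.trans (filter_subset _ _)
    have hE' : (∑ s ∈ Q', (3 : ℝ) ^ #s) ^ 2 ≤ E := by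
      refine pow_le_pow_left₀ (by positivity) ?_ 2
      exact sum_le_sum_of_subset_of_nonneg hsub fun _ _ _ => by positivity
    have hG' : selG Q' ≤ G := selG_mono hQ.prime hsub
    have h1 := (abs_le.mp (abs_sum_selF_sq_sub_le (fun s hs => hQ.prime s (hsub hs)) (V := V)
      (fun s hs => hQ.coprime s (hsub hs)) b L)).2
    obtain ⟨r, Y, -, hY, h2⟩ := exists_sum_dvd_eq hp.pos hpV b L
    have h3 := (abs_le.mp (abs_sum_selF_sq_sub_le (fun s hs => hQ.prime s (hsub hs)) (V := V * p)
      (fun s hs q hq => Nat.Coprime.mul_right (hQ.coprime s (hsub hs) q hq)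
        ((Nat.coprime_primes (hQ.prime s (hsub hs) q hq) hp).mpr fun e =>
          (mem_filter.mp (hQ' hs)).2 (e ▸ hq))) (V * r + b) Y)).2
    have h4 : ∑ x ∈ range L, selF Q' (V * x + b) ^ 2 * (if p ∣ V * x + b then (1 : ℝ) else 0) =
        ∑ y ∈ range Y, selF Q' (V * p * y + (V * r + b)) ^ 2 := by
      simp_rw [mul_ite, mul_one, mul_zero]
      rw [h2]
      refine sum_congr rfl fun y _ => ?_
      ring_nf
    simp_rw [mul_add]
    rw [sum_add_distrib, h4, ← sum_mul]
    have hY' : (Y : ℝ) ≤ L / z + 1 := by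
      have h5 : ((L / p : ℕ) : ℝ) ≤ L / p := Nat.cast_div_le
      have h6 : (Y : ℝ) ≤ (L / p : ℕ) + 1 := by exact_mod_cast hY
      have h7 : (L : ℝ) / p ≤ L / z := by gcongr
      linarith
    have h8 : (∑ x ∈ range L, selF Q' (V * x + b) ^ 2) * u ≤ L * G / z + E := by
      calc _ ≤ (L * G + E) * u := by
            refine mul_le_mul_of_nonneg_right ?_ hu0.le
            have : (L : ℝ) * selG Q' ≤ L * G := by gcongr
            linarith
        _ ≤ (L * G + E) * (1 / z) := by gcongr
        _ ≤ L * G / z + E * 1 := by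
            rw [add_mul, mul_one_div]
            gcongr
        _ = _ := by ring
    have h9 : (Y : ℝ) * selG Q' ≤ (L / z + 1) * G := by
      refine mul_le_mul hY' hG' (selG_nonneg fun s hs => hQ.prime s (hsub hs)) (by positivity)
    have h10 : ((L : ℝ) / z + 1) * G = L * G / z + G := by ring
    linarith
  have hA := hmean _ subset_rfl
  have hB := hmean _ (hQ.sieveDiv_subset p)
  calc _ ≤ ∑ x ∈ range L, 2 * (selF {s ∈ Q | p ∉ s} (V * x + b) ^ 2 +
        selF (sieveDiv Q p) (V * x + b) ^ 2) * (u + if p ∣ V * x + b then 1 else 0) := by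
        refine sum_le_sum fun x _ => ?_
        rw [selF_split Q p]
        refine abs_sq_sub_sq_le hu0.le (huz.trans hz1) (by split_ifs <;> norm_num) ?_
        by_cases h : p ∣ V * x + b
        · right
          rw [if_pos h, if_pos h]
          refine ⟨?_, rfl⟩
          have : (p : ℝ) - 1 ≠ 0 := by linarith
          field_simp
          ring
        · left
          rw [if_neg h, neg_zero, zero_add, one_mul, abs_of_pos hu0]
    _ = 2 * ∑ x ∈ range L, selF {s ∈ Q | p ∉ s} (V * x + b) ^ 2 *
          (u + if p ∣ V * x + b then 1 else 0) + 2 * ∑ x ∈ range L,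
          selF (sieveDiv Q p) (V * x + b) ^ 2 * (u + if p ∣ V * x + b then 1 else 0) := by
        rw [mul_sum, mul_sum, ← sum_add_distrib]
        refine sum_congr rfl fun x _ => ?_
        ring
    _ ≤ _ := by linarith

/-- Fourier decay of the Selberg majorant, uniformly in the frequency. -/
lemma SieveSet.norm_sum_selF_sq_sub_ee_le {Q : Finset (Finset ℕ)} {z R V : ℕ} (hz : 0 < z)
    (hQ : SieveSet Q z R V) {K : ℝ} (hK : ∀ s ∈ Q, (16 : ℝ) ^ #s ≤ K) {X : ℕ} (hX : 0 < X)
    (hRX : 2 * R ^ 2 ≤ X) (b L : ℕ) (α : ℝ) :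
    ‖∑ x ∈ range L, ((selF Q (V * x + b) ^ 2 - selG Q : ℝ) : ℂ) * ee (x * α)‖ ≤
      8 * (L * selG Q / z) + ((∑ s ∈ Q, (3 : ℝ) ^ #s) ^ 2 * (9 + 2 * Real.pi * (L / X)) +
        4 * selG Q + 2 * selG Q * X +
        selG Q ^ 2 * (K ^ 2 * (2 * ((R ^ 2 + 1 : ℕ) + X) * (1 + Real.log X)))) := by
  set G := selG Q with hGdef
  set E := (∑ s ∈ Q, (3 : ℝ) ^ #s) ^ 2 with hEdef
  have hz' : (0 : ℝ) < z := by exact_mod_cast hz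
  have hX' : (0 : ℝ) < X := by exact_mod_cast hX
  have hG : 0 ≤ G := selG_nonneg hQ.prime
  have hE : 0 ≤ E := sq_nonneg _
  have hlogX : 0 ≤ Real.log X := Real.log_natCast_nonneg X
  have hpi := Real.pi_pos
  have hT : 0 ≤ G ^ 2 * (K ^ 2 * (2 * ((R ^ 2 + 1 : ℕ) + X) * (1 + Real.log X))) := by positivity
  have hLG : 0 ≤ 8 * (L * G / z) := by positivity
  obtain ⟨q, hq, hqX⟩ := Real.exists_rat_abs_sub_le_and_den_le α hX
  have hk0 : (0 : ℝ) < q.den := by exact_mod_cast q.pos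
  rcases Nat.lt_or_ge 1 q.den with hk | hk
  · have : NeZero q.den := ⟨q.den_nz⟩
    obtain ⟨a, ha⟩ : ∃ a : (ZMod q.den)ˣ, ((q.num : ℤ) : ZMod q.den) = a := by
      have h := (ZMod.coe_int_isUnit_iff_isCoprime q.num q.den).mpr
        (by rw [Int.isCoprime_iff_gcd_eq_one, Int.gcd_comm]; exact q.reduced)
      exact ⟨h.unit, rfl⟩
    have hqα : ∀ D : ℕ, D ≤ R ^ 2 ∨ D = 1 → |α - q.num / q.den| * (2 * D * q.den) ≤ 1 := by
      intro D hD
      have h1 : (q : ℝ) = q.num / q.den := Rat.cast_def q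
      rw [← h1]
      have h2 : (2 * D : ℝ) ≤ X + 1 := by
        rcases hD with hD | rfl
        · have : (2 * D : ℝ) ≤ X := by exact_mod_cast (Nat.mul_le_mul_left 2 hD).trans hRX
          linarith
        · have : (1 : ℝ) ≤ X := by exact_mod_cast hX
          push_cast
          linarith
      calc |α - q| * (2 * D * q.den) ≤ 1 / ((X + 1) * q.den) * ((X + 1) * q.den) := by gcongr
        _ = 1 := by field_simp
    have hX1 : (q.den : ℝ) ≤ X := by exact_mod_cast hqX
    -- the main term is small
    have hmain : ‖∑ x ∈ range L, ee (x * α)‖ ≤ 2 * X := by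
      have h1 : ((1 : ℕ) * (q.num : ZMod q.den)) ≠ 0 := by
        have : Fact (1 < q.den) := ⟨hk⟩
        rw [ha, Nat.cast_one, one_mul]
        exact a.ne_zero
      have h5 := fun n => invDist_le_abs_sub h1 (hqα 1 (Or.inr rfl)) n
      have h7 := (h5 0).2
      simp only [Nat.cast_one, one_mul] at h5 h7 h1
      have h6 := norm_sum_ee_le (α := α) (by positivity) (fun n => (h5 n).1) L
      refine h6.trans ?_
      have h8 : 1 / (2 * (1 / (2 * invDist q.den (q.num : ZMod q.den)))) =
          invDist q.den (q.num : ZMod q.den) := by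
        field_simp
      rw [h8, invDist]
      set j := (q.num : ZMod q.den)
      have hj0 : (1 : ℝ) ≤ j.val := by
        exact_mod_cast Nat.one_le_iff_ne_zero.mpr fun h => h1 ((ZMod.val_eq_zero j).mp h)
      have hjk : (j.val : ℝ) + 1 ≤ q.den := by exact_mod_cast j.val_lt
      have h9 : (q.den : ℝ) / j.val ≤ q.den := div_le_self hk0.le hj0
      have h10 : (q.den : ℝ) / (q.den - j.val) ≤ q.den := div_le_self hk0.le (by linarith)
      linarith
    have hmain' : ‖∑ x ∈ range L, (G : ℂ) * ee (x * α)‖ ≤ 2 * G * X := by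
      rw [← mul_sum, norm_mul, Complex.norm_real, Real.norm_eq_abs, abs_of_nonneg hG]
      nlinarith
    obtain ⟨p, hp, hpk⟩ := Nat.exists_prime_and_dvd hk.ne'
    have hQ' := hQ.filter_notMem p
    have hGA : selG {s ∈ Q | p ∉ s} ≤ G := selG_mono hQ.prime (filter_subset _ _)
    have hA : ‖∑ x ∈ range L, ((selF {s ∈ Q | p ∉ s} (V * x + b) ^ 2 : ℝ) : ℂ) * ee (x * α)‖ ≤
        G ^ 2 * (K ^ 2 * (2 * ((R ^ 2 + 1 : ℕ) + X) * (1 + Real.log X))) := by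
      refine (hQ'.norm_sum_selF_sq_ee_le (fun s hs => hK s (mem_filter.mp hs).1) hp hpk
        (fun s hs => (mem_filter.mp hs).2) a ha (hqα _ (Or.inl le_rfl)) b L).trans ?_
      have := selG_nonneg hQ'.prime
      have h1 : Real.log q.den ≤ Real.log X := Real.log_le_log hk0 hX1
      gcongr
    have hdiff : ‖∑ x ∈ range L, ((selF Q (V * x + b) ^ 2 -
        selF {s ∈ Q | p ∉ s} (V * x + b) ^ 2 : ℝ) : ℂ) * ee (x * α)‖ ≤
        8 * (L * G / z) + 4 * G + 8 * E := by
      by_cases hpQ : ∃ s ∈ Q, p ∈ s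
      · obtain ⟨s, hs, hps⟩ := hpQ
        refine le_trans ?_ (hQ.sum_abs_sub_le hz hp (hQ.lt s hs p hps) (hQ.coprime s hs p hps) b L)
        refine (norm_sum_le _ _).trans (sum_le_sum fun x _ => ?_)
        rw [norm_mul, norm_ee, mul_one, Complex.norm_real, Real.norm_eq_abs]
      · push Not at hpQ
        rw [filter_true_of_mem hpQ]
        simp only [sub_self, Complex.ofReal_zero, zero_mul, sum_const_zero, norm_zero]
        positivity
    have hdec : ∑ x ∈ range L, ((selF Q (V * x + b) ^ 2 - G : ℝ) : ℂ) * ee (x * α) =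
        ∑ x ∈ range L, ((selF Q (V * x + b) ^ 2 -
          selF {s ∈ Q | p ∉ s} (V * x + b) ^ 2 : ℝ) : ℂ) * ee (x * α) +
        ∑ x ∈ range L, ((selF {s ∈ Q | p ∉ s} (V * x + b) ^ 2 : ℝ) : ℂ) * ee (x * α) -
        ∑ x ∈ range L, (G : ℂ) * ee (x * α) := by
      rw [← sum_add_distrib, ← sum_sub_distrib]
      refine sum_congr rfl fun x _ => ?_
      push_cast
      ring
    rw [hdec]
    refine (norm_sub_le _ _).trans ((add_le_add_left (norm_add_le _ _) _).trans ?_)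
    have hEL : E * 8 ≤ E * (9 + 2 * Real.pi * (L / X)) := by
      have : 0 ≤ 2 * Real.pi * ((L : ℝ) / X) := by positivity
      gcongr
      linarith
    linarith
  · have hk1 : q.den = 1 := le_antisymm hk q.pos
    have hqn : (q : ℝ) = q.num := by
      rw [Rat.cast_def, hk1]
      simp
    set β := α - q.num with hβ
    have hαβ : ∀ x : ℕ, ee (x * α) = ee (x * β) := fun x => by
      have : (x : ℝ) * α = x * β + ((x * q.num : ℤ) : ℝ) := by
        push_cast
        rw [hβ]
        ring
      rw [this, ee_add_int]
    have hβX : |β| ≤ 1 / X := by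
      rw [hqn, hk1] at hq
      refine hq.trans ?_
      gcongr
      push_cast
      linarith
    simp_rw [hαβ]
    have h1 : ∀ y ≤ L, |∑ x ∈ range y, (selF Q (V * x + b) ^ 2 - G)| ≤ E := by
      intro y _
      rw [sum_sub_distrib, sum_const, card_range, nsmul_eq_mul]
      exact abs_sum_selF_sq_sub_le hQ.prime hQ.coprime b y
    refine (norm_sum_mul_ee_le h1 β).trans ?_
    have h2 : E * (1 + 2 * Real.pi * |β| * L) ≤ E * (9 + 2 * Real.pi * (L / X)) := by
      have : 2 * Real.pi * |β| * L ≤ 2 * Real.pi * (1 / X) * L := by gcongr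
      have h3 : 2 * Real.pi * (1 / X) * L = 2 * Real.pi * ((L : ℝ) / X) := by ring
      exact mul_le_mul_of_nonneg_left (by linarith) hE
    have h4 : 0 ≤ 4 * G + 2 * G * X := by positivity
    linarith

end PrimeSum

namespace PrimeSum
open Finset

/-- Squarefree numbers up to `R` all of whose prime factors exceed `z`. -/
def sieveQ (z R : ℕ) : Finset (Finset ℕ) :=
  {s ∈ ({p ∈ Ioc z R | p.Prime} : Finset ℕ).powerset | primeProd s ≤ R}

lemma mem_sieveQ {z R : ℕ} {s : Finset ℕ} :
    s ∈ sieveQ z R ↔ (∀ p ∈ s, p.Prime ∧ z < p) ∧ primeProd s ≤ R := by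
  rw [sieveQ, mem_filter, mem_powerset]
  constructor
  · rintro ⟨h1, h2⟩
    refine ⟨fun p hp => ?_, h2⟩
    have := h1 hp
    rw [mem_filter, mem_Ioc] at this
    exact ⟨this.2, this.1.1⟩
  · rintro ⟨h1, h2⟩
    refine ⟨fun p hp => ?_, h2⟩
    rw [mem_filter, mem_Ioc]
    refine ⟨⟨(h1 p hp).2, le_trans ?_ h2⟩, (h1 p hp).1⟩
    exact Nat.le_of_dvd (primeProd_pos fun p hp => (h1 p hp).1) (dvd_prod_of_mem _ hp)

lemma sieveSet_sieveQ (z R w : ℕ) (h : w ≤ z) : SieveSet (sieveQ z R) z R (primorial w) where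
  prime s hs p hp := ((mem_sieveQ.mp hs).1 p hp).1
  lt s hs p hp := ((mem_sieveQ.mp hs).1 p hp).2
  coprime s hs p hp := by
    obtain ⟨h1, h2⟩ := (mem_sieveQ.mp hs).1 p hp
    rw [h1.coprime_iff_not_dvd, h1.dvd_primorial_iff]
    omega
  le s hs := (mem_sieveQ.mp hs).2
  down s hs t hts := by
    obtain ⟨h1, h2⟩ := mem_sieveQ.mp hs
    refine mem_sieveQ.mpr ⟨fun p hp => h1 p (hts hp), le_trans ?_ h2⟩
    exact Nat.le_of_dvd (primeProd_pos fun p hp => (h1 p hp).1) (prod_dvd_prod_of_subset _ _ _ hts)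

lemma one_le_selG_sieveQ {z R : ℕ} (hR : 0 < R) : 1 ≤ selG (sieveQ z R) := by
  have h : ∅ ∈ sieveQ z R := mem_sieveQ.mpr ⟨by simp, Nat.succ_le_of_lt hR⟩
  have h1 := (sieveSet_sieveQ z R z le_rfl).prime
  calc (1 : ℝ) = ∏ p ∈ (∅ : Finset ℕ), ((p : ℝ) - 1)⁻¹ := by simp
    _ ≤ _ := single_le_sum (f := fun s : Finset ℕ => ∏ p ∈ s, ((p : ℝ) - 1)⁻¹)
      (fun s hs => (prod_sub_one_inv_pos (h1 s hs)).le) h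

lemma sum_factoredNumbers_inv_le (s T : Finset ℕ) (hT : ∀ m ∈ T, m ∈ Nat.factoredNumbers s) :
    ∑ m ∈ T, (m : ℝ)⁻¹ ≤ ∏ p ∈ s with p.Prime, (1 - (p : ℝ)⁻¹)⁻¹ := by
  set f : ℕ →* ℝ := ⟨⟨fun n => (n : ℝ)⁻¹, by simp⟩, fun a b => by simp [mul_comm]⟩ with hf
  have h := (EulerProduct.summable_and_hasSum_factoredNumbers_prod_filter_prime_geometric
    (f := f) (fun {p} hp => by
      have : (1 : ℝ) < p := by exact_mod_cast hp.one_lt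
      change ‖(p : ℝ)⁻¹‖ < 1
      rw [norm_inv, Real.norm_natCast]
      exact inv_lt_one_of_one_lt₀ this) s).2
  have h2 := sum_le_hasSum (T.subtype (· ∈ Nat.factoredNumbers s))
    (fun m _ => by change 0 ≤ ((m : ℕ) : ℝ)⁻¹; positivity) h
  have h3 : ∑ m ∈ T.subtype (· ∈ Nat.factoredNumbers s), f m = ∑ m ∈ T, (m : ℝ)⁻¹ :=
    sum_subtype_of_mem (p := (· ∈ Nat.factoredNumbers s)) (fun m : ℕ => (m : ℝ)⁻¹) hT
  rw [h3] at h2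
  exact h2

/-- Lower bound for the normalizing sum of the sieve. -/
lemma log_le_prod_mul_selG (z R : ℕ) :
    Real.log R ≤ (∏ p ∈ Nat.primesLE z, (1 - (p : ℝ)⁻¹)⁻¹) * selG (sieveQ z R) := by
  have hS := sieveSet_sieveQ z R z le_rfl
  have h1 : Real.log R ≤ ∑ n ∈ Icc 1 R, (n : ℝ)⁻¹ := by
    rcases Nat.eq_zero_or_pos R with rfl | hR
    · simp
    have := log_add_one_le_harmonic R
    rw [harmonic_eq_sum_Icc] at this
    push_cast at this
    refine le_trans (Real.log_le_log (by exact_mod_cast hR) (by linarith)) this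
  set φ : ℕ → Finset ℕ := fun n => {p ∈ n.primeFactors | z < p} with hφ
  have hpr : ∀ n, ∀ p ∈ φ n, p.Prime := fun n p hp =>
    Nat.prime_of_mem_primeFactors (mem_filter.mp hp).1
  have hdvd : ∀ n, primeProd (φ n) ∣ n := fun n =>
    (primeProd_dvd_iff (hpr n) n).mpr fun p hp => Nat.dvd_of_mem_primeFactors (mem_filter.mp hp).1
  have hmaps : ∀ n ∈ Icc 1 R, φ n ∈ sieveQ z R := by
    intro n hn
    have hn' := mem_Icc.mp hn
    exact mem_sieveQ.mpr ⟨fun p hp => ⟨hpr n p hp, (mem_filter.mp hp).2⟩,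
      (Nat.le_of_dvd hn'.1 (hdvd n)).trans hn'.2⟩
  refine h1.trans ?_
  rw [← sum_fiberwise_of_maps_to hmaps, selG, mul_sum]
  refine sum_le_sum fun s hs => ?_
  have hsp : ∀ p ∈ s, p.Prime := hS.prime s hs
  have hs0 : 0 < primeProd s := primeProd_pos hsp
  set A := (Icc 1 R).filter fun n => φ n = s with hA
  have hAdvd : ∀ n ∈ A, primeProd s * (n / primeProd s) = n := fun n hn => by
    have := (mem_filter.mp hn).2
    exact Nat.mul_div_cancel' (this ▸ hdvd n)
  have hinj : Set.InjOn (fun n => n / primeProd s) (A : Set ℕ) := by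
    intro n hn m hm h
    rw [← hAdvd n (mem_coe.mp hn), ← hAdvd m (mem_coe.mp hm)]
    exact congrArg (primeProd s * ·) h
  have h2 : ∑ n ∈ A, (n : ℝ)⁻¹ =
      (primeProd s : ℝ)⁻¹ * ∑ m ∈ A.image (fun n => n / primeProd s), (m : ℝ)⁻¹ := by
    rw [sum_image hinj, mul_sum]
    refine sum_congr rfl fun n hn => ?_
    rw [← mul_inv, ← Nat.cast_mul, hAdvd n hn]
  have h3 := sum_factoredNumbers_inv_le (s ∪ Nat.primesLE z) (A.image fun n => n / primeProd s) (by
    intro m hm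
    obtain ⟨n, hn, rfl⟩ := mem_image.mp hm
    rw [Nat.mem_factoredNumbers']
    intro p hp hpn
    have hpn : p ∣ n := hpn.trans (Nat.div_dvd_of_dvd ⟨_, (hAdvd n hn).symm⟩)
    have hn0 : n ≠ 0 := by
      have := (mem_Icc.mp (mem_filter.mp hn).1).1
      omega
    rw [mem_union]
    rcases Nat.lt_or_ge z p with h | h
    · left
      rw [← (mem_filter.mp hn).2]
      exact mem_filter.mpr ⟨Nat.mem_primeFactors.mpr ⟨hp, hpn, hn0⟩, h⟩
    · right
      exact Nat.mem_primesLE.mpr ⟨h, hp⟩)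
  have h4 : (s ∪ Nat.primesLE z).filter Nat.Prime = s ∪ Nat.primesLE z := by
    refine filter_true_of_mem fun p hp => ?_
    rcases mem_union.mp hp with h | h
    exacts [hsp p h, (Nat.mem_primesLE.mp h).2]
  have hdisj : Disjoint s (Nat.primesLE z) := by
    rw [disjoint_left]
    intro p hp hp'
    have := hS.lt s hs p hp
    have := (Nat.mem_primesLE.mp hp').1
    omega
  rw [h4, prod_union hdisj] at h3
  have h5 : (primeProd s : ℝ)⁻¹ * ∏ p ∈ s, (1 - (p : ℝ)⁻¹)⁻¹ = ∏ p ∈ s, ((p : ℝ) - 1)⁻¹ := by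
    rw [primeProd, Nat.cast_prod, ← prod_inv_distrib, ← prod_mul_distrib]
    refine prod_congr rfl fun p hp => ?_
    have : (p : ℝ) ≠ 0 := by exact_mod_cast (hsp p hp).ne_zero
    rw [← mul_inv]
    congr 1
    field_simp
  rw [h2, ← h5]
  calc _ ≤ (primeProd s : ℝ)⁻¹ * ((∏ p ∈ s, (1 - (p : ℝ)⁻¹)⁻¹) *
        ∏ p ∈ Nat.primesLE z, (1 - (p : ℝ)⁻¹)⁻¹) := by gcongr
    _ = _ := by ring

lemma totient_primorial (w : ℕ) :
    ((primorial w).totient : ℝ) / primorial w = ∏ p ∈ Nat.primesLE w, (1 - (p : ℝ)⁻¹) := by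
  have h := Nat.totient_eq_mul_prod_factors (primorial w)
  rw [primeFactors_primorial] at h
  have h' : ((primorial w).totient : ℝ) =
      primorial w * ∏ p ∈ Nat.primesLE w, (1 - (p : ℝ)⁻¹) := by
    have h' := congrArg (Rat.cast (K := ℝ)) h
    push_cast at h'
    exact h'
  rw [h', mul_div_assoc, mul_comm, div_mul_cancel₀]
  exact_mod_cast primorial_ne_zero w

lemma one_sub_inv_prime_pos {p : ℕ} (hp : p.Prime) : 0 < 1 - (p : ℝ)⁻¹ := by
  have : (1 : ℝ) < p := by exact_mod_cast hp.one_lt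
  have := inv_lt_one_of_one_lt₀ this
  linarith

/-- Euler factors over a dyadic block. -/
lemma prod_dyadic_le {j : ℕ} (hj : 0 < j) :
    ∏ p ∈ ({p ∈ Ioc (2 ^ j) (2 ^ (j + 1)) | p.Prime} : Finset ℕ), (1 - (p : ℝ)⁻¹)⁻¹ ≤
      Real.exp (4 / j) := by
  set P := ({p ∈ Ioc (2 ^ j) (2 ^ (j + 1)) | p.Prime} : Finset ℕ) with hP
  have hmem : ∀ p ∈ P, p.Prime ∧ 2 ^ j < p ∧ p ≤ 2 ^ (j + 1) := fun p hp => by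
    rw [hP, mem_filter, mem_Ioc] at hp
    exact ⟨hp.2, hp.1⟩
  have h1 : ∀ p ∈ P, (1 - (p : ℝ)⁻¹)⁻¹ ≤ Real.exp (1 / 2 ^ j) := by
    intro p hp
    obtain ⟨hpp, h2, -⟩ := hmem p hp
    have h3 : (2 : ℝ) ^ j + 1 ≤ p := by exact_mod_cast h2
    have h4 : (0 : ℝ) < 2 ^ j := by positivity
    have h5 : (1 - (p : ℝ)⁻¹)⁻¹ = 1 / ((p : ℝ) - 1) + 1 := by
      have : (p : ℝ) ≠ 0 := by linarith
      have : (p : ℝ) - 1 ≠ 0 := by linarith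
      field_simp
      ring
    rw [h5]
    refine le_trans ?_ (Real.add_one_le_exp _)
    gcongr
    linarith
  have hlog4 : Real.log 4 = 2 * Real.log 2 := by
    rw [show (4 : ℝ) = 2 ^ 2 by norm_num, Real.log_pow]; norm_num
  have hlog2 : 0 < Real.log 2 := Real.log_pos (by norm_num)
  have hcard : (#P : ℝ) * j ≤ 4 * 2 ^ j := by
    have h2 := Chebyshev.theta_le_log4_mul_x (x := (2 : ℝ) ^ (j + 1)) (by positivity)
    have h3 : (#P : ℝ) * (j * Real.log 2) ≤ Chebyshev.theta ((2 : ℝ) ^ (j + 1)) := by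
      have h4 : ∑ p ∈ P, Real.log p ≤ Chebyshev.theta ((2 : ℝ) ^ (j + 1)) := by
        rw [Chebyshev.theta]
        refine sum_le_sum_of_subset_of_nonneg (fun p hp => ?_) fun p _ _ =>
          Real.log_natCast_nonneg p
        obtain ⟨hpp, -, h2⟩ := hmem p hp
        rw [mem_filter, mem_Ioc]
        refine ⟨⟨hpp.pos, Nat.le_floor ?_⟩, hpp⟩
        exact_mod_cast h2
      refine le_trans ?_ h4
      rw [← nsmul_eq_mul]
      refine card_nsmul_le_sum _ _ _ fun p hp => ?_
      rw [← Real.log_pow]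
      refine Real.log_le_log (by positivity) ?_
      exact_mod_cast (hmem p hp).2.1.le
    rw [hlog4] at h2
    have : (#P : ℝ) * j * Real.log 2 ≤ 4 * 2 ^ j * Real.log 2 := by
      rw [pow_succ] at h2 h3
      linarith
    exact le_of_mul_le_mul_right this hlog2
  have hj' : (0 : ℝ) < j := by exact_mod_cast hj
  calc _ ≤ ∏ _p ∈ P, Real.exp (1 / 2 ^ j) :=
        prod_le_prod (fun p hp => (inv_pos.mpr (one_sub_inv_prime_pos (hmem p hp).1)).le) h1
    _ = Real.exp (#P * (1 / 2 ^ j)) := by rw [prod_const, ← Real.exp_nat_mul]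
    _ ≤ _ := by
        refine Real.exp_le_exp.mpr ?_
        rw [mul_one_div, div_le_div_iff₀ (by positivity) hj']
        exact hcard

/-- Euler factors over a long range. -/
lemma prod_primesLE_le {θ : ℝ} {J : ℕ} (hJ : 0 < J) (hθ : Real.exp (4 / J) ≤ θ) (i : ℕ) :
    ∏ p ∈ Nat.primesLE (2 ^ (J + i)), (1 - (p : ℝ)⁻¹)⁻¹ ≤
      θ ^ i * ∏ p ∈ Nat.primesLE (2 ^ J), (1 - (p : ℝ)⁻¹)⁻¹ := by
  induction i with
  | zero => simp
  | succ i ih =>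
    have h1 : Nat.primesLE (2 ^ (J + (i + 1))) = Nat.primesLE (2 ^ (J + i)) ∪
        ({p ∈ Ioc (2 ^ (J + i)) (2 ^ (J + i + 1)) | p.Prime} : Finset ℕ) := by
      ext p
      have : 2 ^ (J + i) ≤ 2 ^ (J + (i + 1)) := Nat.pow_le_pow_right (by norm_num) (by omega)
      rw [mem_union, Nat.mem_primesLE, Nat.mem_primesLE, mem_filter, mem_Ioc, add_assoc]
      constructor
      · intro h
        rcases Nat.lt_or_ge (2 ^ (J + i)) p with h' | h'
        exacts [Or.inr ⟨⟨h', h.1⟩, h.2⟩, Or.inl ⟨h', h.2⟩]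
      · rintro (h | h)
        exacts [⟨h.1.trans this, h.2⟩, ⟨h.1.2, h.2⟩]
    have hdisj : Disjoint (Nat.primesLE (2 ^ (J + i)))
        ({p ∈ Ioc (2 ^ (J + i)) (2 ^ (J + i + 1)) | p.Prime} : Finset ℕ) := by
      rw [disjoint_left]
      intro p hp hp'
      have h2 := (Nat.mem_primesLE.mp hp).1
      have h3 := (mem_Ioc.mp (mem_filter.mp hp').1).1
      omega
    rw [h1, prod_union hdisj, pow_succ θ i, mul_comm (θ ^ i) θ, mul_comm, mul_assoc]
    have h4 := prod_dyadic_le (j := J + i) (by omega)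
    have hθ0 : 0 < θ := (Real.exp_pos _).trans_le hθ
    refine mul_le_mul (h4.trans (le_trans ?_ hθ)) ih ?_ hθ0.le
    · have : (0 : ℝ) < J := by exact_mod_cast hJ
      gcongr
      omega
    · exact prod_nonneg fun p hp => (inv_pos.mpr (one_sub_inv_prime_pos (Nat.mem_primesLE.mp hp).2)).le

lemma primeProd_injOn (z R : ℕ) : Set.InjOn primeProd (sieveQ z R : Set (Finset ℕ)) := by
  intro s hs t ht h
  have hS := (sieveSet_sieveQ z R z le_rfl).prime
  rw [← primeFactors_primeProd (hS s (mem_coe.mp hs)),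
    ← primeFactors_primeProd (hS t (mem_coe.mp ht)), h]

lemma image_primeProd_subset (z R : ℕ) : (sieveQ z R).image primeProd ⊆ Icc 1 R := by
  intro n hn
  obtain ⟨s, hs, rfl⟩ := mem_image.mp hn
  have hS := sieveSet_sieveQ z R z le_rfl
  exact mem_Icc.mpr ⟨primeProd_pos (hS.prime s hs), hS.le s hs⟩

lemma card_sieveQ_le (z R : ℕ) : #(sieveQ z R) ≤ R := by
  rw [← card_image_of_injOn (primeProd_injOn z R)]
  simpa using card_le_card (image_primeProd_subset z R)

lemma selG_sieveQ_le {z R : ℕ} {K : ℝ} (hK : ∀ s ∈ sieveQ z R, (16 : ℝ) ^ #s ≤ K) (hK0 : 0 ≤ K) :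
    selG (sieveQ z R) ≤ K * (1 + Real.log R) := by
  have hS := sieveSet_sieveQ z R z le_rfl
  have h1 : ∀ s ∈ sieveQ z R, ∏ p ∈ s, ((p : ℝ) - 1)⁻¹ ≤ K * (primeProd s : ℝ)⁻¹ := by
    intro s hs
    refine le_trans ?_ (mul_le_mul_of_nonneg_right (hK s hs) (by positivity))
    rw [primeProd, Nat.cast_prod, ← prod_inv_distrib, ← prod_const, ← prod_mul_distrib]
    refine prod_le_prod (fun p hp => ?_) fun p hp => ?_ <;>
    have h2 : (2 : ℝ) ≤ p := by exact_mod_cast (hS.prime s hs p hp).two_le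
    · exact inv_nonneg.mpr (by linarith)
    · rw [← div_eq_mul_inv, ← one_div, div_le_div_iff₀ (by linarith) (by linarith)]
      linarith
  refine (sum_le_sum h1).trans ?_
  rw [← mul_sum]
  refine mul_le_mul_of_nonneg_left ?_ hK0
  rw [← sum_image (f := fun n : ℕ => (n : ℝ)⁻¹) (primeProd_injOn z R)]
  refine (sum_le_sum_of_subset_of_nonneg (image_primeProd_subset z R)
    fun _ _ _ => inv_nonneg.mpr (Nat.cast_nonneg _)).trans ?_
  have := harmonic_le_one_add_log R
  rw [harmonic_eq_sum_Icc] at this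
  push_cast at this
  exact this

lemma sum_three_pow_sq_le {z R : ℕ} {K : ℝ} (hK : ∀ s ∈ sieveQ z R, (16 : ℝ) ^ #s ≤ K) :
    (∑ s ∈ sieveQ z R, (3 : ℝ) ^ #s) ^ 2 ≤ R ^ 2 * K ^ 2 := by
  rcases (sieveQ z R).eq_empty_or_nonempty with h | ⟨s, hs⟩
  · rw [h]
    simp only [sum_empty, zero_pow two_ne_zero]
    positivity
  have hK0 : 0 ≤ K := le_trans (by positivity) (hK s hs)
  rw [← mul_pow]
  refine pow_le_pow_left₀ (by positivity) ?_ 2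
  have h1 : ∀ s ∈ sieveQ z R, (3 : ℝ) ^ #s ≤ K := fun s hs =>
    le_trans (by gcongr; norm_num) (hK s hs)
  refine (sum_le_card_nsmul _ _ _ h1).trans ?_
  rw [nsmul_eq_mul]
  gcongr
  exact_mod_cast card_sieveQ_le z R

lemma sixteen_pow_card_le {J R : ℕ} {z : ℕ} (hJ : 0 < J) (hz : 2 ^ J ≤ z) {s : Finset ℕ}
    (hs : s ∈ sieveQ z R) : (16 : ℝ) ^ #s ≤ (R : ℝ) ^ (4 / J : ℝ) := by
  obtain ⟨h1, h2⟩ := mem_sieveQ.mp hs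
  have h3 : (2 ^ J) ^ #s ≤ R := by
    refine le_trans ?_ h2
    rw [← prod_const]
    exact prod_le_prod' fun p hp => hz.trans (h1 p hp).2.le
  have h4 : ((2 : ℝ) ^ J) ^ #s ≤ R := by exact_mod_cast h3
  have hJ' : (J : ℝ) ≠ 0 := by exact_mod_cast hJ.ne'
  calc (16 : ℝ) ^ #s = (((2 : ℝ) ^ J) ^ #s) ^ (4 / J : ℝ) := by
        rw [← pow_mul, ← Real.rpow_natCast, ← Real.rpow_natCast, ← Real.rpow_mul (by norm_num),
          show (16 : ℝ) = 2 ^ (4 : ℝ) by norm_num, ← Real.rpow_mul (by norm_num)]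
        congr 1
        push_cast
        field_simp
    _ ≤ _ := Real.rpow_le_rpow (by positivity) h4 (by positivity)

end PrimeSum

namespace PrimeSum
open Finset

/-- The upper bound sieve weight, normalized to have average one. -/
noncomputable def sieveWeight (z R n : ℕ) : ℝ := selF (sieveQ z R) n ^ 2 / selG (sieveQ z R)

lemma sieveWeight_nonneg {z R : ℕ} (hR : 0 < R) (n : ℕ) : 0 ≤ sieveWeight z R n :=
  div_nonneg (sq_nonneg _) (zero_le_one.trans (one_le_selG_sieveQ hR))

lemma sieveWeight_prime {z R p : ℕ} (hR : 0 < R) (hp : p.Prime) (h : R < p) :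
    sieveWeight z R p = selG (sieveQ z R) := by
  have hG := one_le_selG_sieveQ (z := z) hR
  have hS := sieveSet_sieveQ z R z le_rfl
  rw [sieveWeight, selF_of_coprime, pow_two, mul_div_assoc, div_self (by linarith), mul_one]
  intro s hs q hq hqp
  have h1 := (Nat.prime_dvd_prime_iff_eq (hS.prime s hs q hq) hp).mp hqp
  have h2 : primeProd s ≤ R := hS.le s hs
  have h3 : q ≤ primeProd s :=
    Nat.le_of_dvd (primeProd_pos (hS.prime s hs)) (dvd_prod_of_mem _ hq)
  omega

/-- Pseudorandomness of the sieve weight, with a numerical error term. -/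
lemma norm_sum_sieveWeight_sub_one_le {z R w N X : ℕ} {Y : ℝ} (hz : 0 < z) (hw : w ≤ z)
    (hR : 0 < R) (hK : ∀ s ∈ sieveQ z R, (16 : ℝ) ^ #s ≤ Y) (hN : 0 < N)
    (hRY : (R : ℝ) ^ 2 * Y ^ 10 ≤ N) (hXN : X ≤ N) (hX1 : (N : ℝ) ≤ X * Y ^ 5)
    (hX2 : X * Y ^ 5 ≤ 2 * (N : ℝ)) (hYN : Y ^ 5 ≤ N) (hY : 32 * (1 + Real.log N) ^ 2 ≤ Y)
    (b L : ℕ) (hL : L ≤ N) (α : ℝ) :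
    ‖∑ x ∈ range L, ((sieveWeight z R (primorial w * x + b) - 1 : ℝ) : ℂ) * ee (x * α)‖ ≤
      8 * (L / z) + N / Y := by
  have hlogN : 0 ≤ Real.log N := Real.log_natCast_nonneg N
  have hY32 : 32 ≤ Y := by nlinarith
  have hY0 : 0 < Y := by linarith
  have hN' : (0 : ℝ) < N := by exact_mod_cast hN
  have hX0 : 0 < X := by
    rcases Nat.eq_zero_or_pos X with rfl | h
    · simp only [Nat.cast_zero, zero_mul] at hX1
      linarith
    · exact h
  have hX0' : (0 : ℝ) < X := by exact_mod_cast hX0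
  have hR1 : (1 : ℝ) ≤ R := by exact_mod_cast hR
  have hRX : 2 * R ^ 2 ≤ X := by
    have h1 : (2 : ℝ) * R ^ 2 ≤ X := by
      have h2 : (R : ℝ) ^ 2 * Y ^ 10 ≤ X * Y ^ 5 := hRY.trans hX1
      have h3 : (R : ℝ) ^ 2 * Y ^ 5 ≤ X := by
        refine le_of_mul_le_mul_right (a := Y ^ 5) ?_ (by positivity)
        calc _ = (R : ℝ) ^ 2 * Y ^ 10 := by ring
          _ ≤ _ := h2
      have h4 : 2 ≤ Y ^ 5 := by
        calc (2 : ℝ) ≤ 2 ^ 5 := by norm_num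
          _ ≤ Y ^ 5 := by gcongr; linarith
      nlinarith [sq_nonneg (R : ℝ)]
    exact_mod_cast h1
  set G := selG (sieveQ z R) with hG
  have hG1 : 1 ≤ G := one_le_selG_sieveQ hR
  have hG2 : G ≤ Y * (1 + Real.log N) := by
    refine (selG_sieveQ_le hK hY0.le).trans ?_
    have : (R : ℝ) ≤ N := by
      have h5 : R ≤ R ^ 2 := Nat.le_self_pow (by norm_num) R
      exact_mod_cast (show R ≤ N by omega)
    gcongr
  have h3 := sum_three_pow_sq_le hK
  have hmain := (sieveSet_sieveQ z R w hw).norm_sum_selF_sq_sub_ee_le hz hK hX0 hRX b L α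
  have heq : ∑ x ∈ range L, ((sieveWeight z R (primorial w * x + b) - 1 : ℝ) : ℂ) * ee (x * α) =
      ((G⁻¹ : ℝ) : ℂ) * ∑ x ∈ range L,
        ((selF (sieveQ z R) (primorial w * x + b) ^ 2 - G : ℝ) : ℂ) * ee (x * α) := by
    rw [mul_sum]
    refine sum_congr rfl fun x _ => ?_
    rw [← mul_assoc, ← Complex.ofReal_mul, sieveWeight, ← hG]
    congr 2
    field_simp
  rw [heq, norm_mul, Complex.norm_real, Real.norm_of_nonneg (by positivity), ← hG] at *
  have hG0 : 0 < G := by linarith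
  rw [inv_mul_le_iff₀ hG0]
  refine hmain.trans ?_
  set ℓ := 1 + Real.log N with hℓ
  have hℓ1 : 1 ≤ ℓ := by linarith
  have hLX : (L : ℝ) / X ≤ Y ^ 5 := by
    rw [div_le_iff₀ hX0', mul_comm]
    exact le_trans (by exact_mod_cast hL) hX1
  have hD : (0 : ℝ) < N / Y := by positivity
  have t1 : (∑ s ∈ sieveQ z R, (3 : ℝ) ^ #s) ^ 2 * (9 + 2 * Real.pi * (L / X)) ≤
      16 / 32 ^ 2 * (N / Y) := by
    have hb : 9 + 2 * Real.pi * ((L : ℝ) / X) ≤ 16 * Y ^ 5 := by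
      have h5 : 2 * Real.pi ≤ 7 := by linarith [Real.pi_lt_d2]
      have h6 : (1 : ℝ) ≤ Y ^ 5 := one_le_pow₀ (by linarith)
      have h7 : 2 * Real.pi * ((L : ℝ) / X) ≤ 7 * Y ^ 5 := by gcongr
      linarith
    calc _ ≤ (R ^ 2 * Y ^ 2) * (16 * Y ^ 5) := by gcongr
      _ = 16 / Y ^ 2 * (R ^ 2 * Y ^ 10) / Y := by field_simp
      _ ≤ 16 / 32 ^ 2 * N / Y := by gcongr
      _ = _ := by ring
  have t2 : (4 : ℝ) ≤ 4 / 32 * (N / Y) := by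
    have : Y ^ 5 / (32 * Y) ≤ N / (32 * Y) := by gcongr
    have h5 : (1 : ℝ) ≤ Y ^ 5 / (32 * Y) := by
      rw [le_div_iff₀ (by positivity)]
      have : (1 : ℝ) ≤ Y ^ 3 := one_le_pow₀ (by linarith)
      nlinarith [mul_pos hY0 hY0]
    calc (4 : ℝ) ≤ 4 * (N / (32 * Y)) := by linarith
      _ = _ := by field_simp
  have hXle : (X : ℝ) ≤ 2 * N / Y ^ 5 := by rwa [le_div_iff₀ (by positivity)]
  have hY5 : ∀ k : ℕ, N / Y ^ (k + 1) ≤ 1 / 32 ^ k * (N / Y) := fun k => by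
    rw [pow_succ, one_div, ← div_div, div_eq_mul_inv (N : ℝ), mul_comm (N : ℝ), mul_div_assoc]
    gcongr
  have t3 : 2 * (X : ℝ) ≤ 4 / 32 * (N / Y) := by
    have h5 := hY5 4
    have : 2 * (N : ℝ) / Y ^ 5 = 2 * (N / Y ^ 5) := by ring
    norm_num at h5
    linarith
  have t4 : G * (Y ^ 2 * (2 * ((R ^ 2 + 1 : ℕ) + X) * (1 + Real.log X))) ≤ 8 / 32 * (N / Y) := by
    have h5 : ((R ^ 2 + 1 : ℕ) : ℝ) + X ≤ 4 * (N / Y ^ 5) := by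
      have h6 : (1 : ℝ) ≤ N / Y ^ 5 := by rwa [le_div_iff₀ (by positivity), one_mul]
      have h7 : (R : ℝ) ^ 2 ≤ N / Y ^ 5 := by
        rw [le_div_iff₀ (by positivity)]
        refine le_trans ?_ hRY
        gcongr
        · linarith
        · norm_num
      push_cast
      have : 2 * (N : ℝ) / Y ^ 5 = 2 * (N / Y ^ 5) := by ring
      linarith
    have h6 : 1 + Real.log X ≤ ℓ := by
      rw [hℓ]
      gcongr
    have h8 : 0 ≤ Real.log X := Real.log_natCast_nonneg X
    calc _ ≤ (Y * ℓ) * (Y ^ 2 * (2 * (4 * (N / Y ^ 5)) * ℓ)) := by gcongr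
      _ = 8 * (ℓ ^ 2) * N / Y ^ 2 := by field_simp; ring
      _ ≤ 8 * (Y / 32) * N / Y ^ 2 := by gcongr; linarith
      _ = _ := by field_simp
  have t1' := t1.trans (le_mul_of_one_le_left (by positivity) hG1)
  calc _ = 8 * (L * G / z) + ((∑ s ∈ sieveQ z R, (3 : ℝ) ^ #s) ^ 2 * (9 + 2 * Real.pi * (L / X))
      + G * (4 + 2 * X + G * (Y ^ 2 * (2 * ((R ^ 2 + 1 : ℕ) + X) * (1 + Real.log X))))) := by ring
    _ ≤ 8 * (L * G / z) + (G * (16 / 32 ^ 2 * (N / Y)) + G * (4 / 32 * (N / Y) + 4 / 32 * (N / Y)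
      + 8 / 32 * (N / Y))) := by gcongr
    _ ≤ 8 * (L * G / z) + G * (N / Y) := by
        have : 0 < G * (N / Y) := by positivity
        linarith
    _ = _ := by ring

/-- The majorant property of the sieve weight on primes. -/
lemma log_le_mul_selG {θ A : ℝ} {J R N : ℕ} (hJ : 0 < J) (hθ : Real.exp (4 / J) ≤ θ)
    (hA : Real.log N ≤ A * Real.log R) (hA0 : 0 ≤ A) (i : ℕ) :
    ((primorial (2 ^ J)).totient : ℝ) / primorial (2 ^ J) * Real.log N ≤
      A * θ ^ i * selG (sieveQ (2 ^ (J + i)) R) := by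
  have h1 := log_le_prod_mul_selG (2 ^ (J + i)) R
  have h2 := prod_primesLE_le hJ hθ i
  have hS := (sieveSet_sieveQ (2 ^ (J + i)) R _ le_rfl).prime
  have hG := selG_nonneg hS
  have hP : ∀ p ∈ Nat.primesLE (2 ^ J), 0 < 1 - (p : ℝ)⁻¹ := fun p hp =>
    one_sub_inv_prime_pos (Nat.mem_primesLE.mp hp).2
  have hpos := prod_pos hP
  rw [totient_primorial]
  rw [prod_inv_distrib (s := Nat.primesLE (2 ^ J))] at h2
  set P := ∏ p ∈ Nat.primesLE (2 ^ J), (1 - (p : ℝ)⁻¹)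
  calc P * Real.log N ≤ P * (A * ((θ ^ i * P⁻¹) * selG (sieveQ (2 ^ (J + i)) R))) := by
        gcongr
        refine hA.trans ?_
        gcongr
        refine h1.trans ?_
        gcongr
    _ = _ := by field_simp

/-- A uniform family of pseudorandom majorants for the primes in residue classes. -/
theorem exists_majorant {η θ : ℝ} (hη : 0 < η) (hθ : 1 < θ) :
    ∃ κ : ℝ, 0 < κ ∧ κ < 1 ∧ ∃ J₀ : ℕ, ∀ J ≥ J₀, ∃ N₀ : ℕ, ∀ N ≥ N₀, ∃ R : ℕ, R ^ 2 ≤ N ∧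
      ∀ m ≥ J, ∃ ν : ℕ → ℝ, (∀ n, 0 ≤ ν n) ∧
        (∀ p : ℕ, p.Prime → R < p →
          ((primorial (2 ^ J)).totient : ℝ) / primorial (2 ^ J) * Real.log N ≤
            (2 + η) * θ ^ (m - J) * ν p) ∧
        ∀ (b L : ℕ) (α : ℝ), L ≤ N →
          ‖∑ x ∈ range L, ((ν (primorial (2 ^ J) * x + b) - 1 : ℝ) : ℂ) * ee (x * α)‖ ≤
            8 * (L / 2 ^ m) + (N : ℝ) ^ (1 - κ) := by
  obtain ⟨κ, hκ0, hκ1, hκ2⟩ : ∃ κ : ℝ, 0 < κ ∧ κ ≤ 1 / 100 ∧ 12 * κ * (2 + η) ≤ η := by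
    refine ⟨min (1 / 100) (η / (12 * (2 + η))), lt_min (by norm_num) (by positivity),
      min_le_left _ _, ?_⟩
    have h := min_le_right (1 / 100 : ℝ) (η / (12 * (2 + η)))
    rw [le_div_iff₀ (by positivity)] at h
    linarith
  refine ⟨κ, hκ0, by linarith, ?_⟩
  have hlogθ : 0 < Real.log θ := Real.log_pos hθ
  obtain ⟨J₀, hJ₀⟩ := exists_nat_gt (max (4 / κ) (4 / Real.log θ))
  refine ⟨J₀ + 1, fun J hJ => ?_⟩
  have hJ0 : 0 < J := by omega
  have hJ' : (0 : ℝ) < J := by exact_mod_cast hJ0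
  have hJ₀' : max (4 / κ) (4 / Real.log θ) < J :=
    hJ₀.trans_le (by exact_mod_cast (by omega : J₀ ≤ J))
  have hJκ : (4 / J : ℝ) ≤ κ := by
    have := (le_max_left _ _).trans_lt hJ₀'
    rw [div_lt_iff₀ hκ0] at this
    rw [div_le_iff₀ hJ']
    linarith
  have hJθ : Real.exp (4 / J) ≤ θ := by
    rw [← Real.le_log_iff_exp_le (by linarith)]
    have := (le_max_right _ _).trans_lt hJ₀'
    rw [div_lt_iff₀ hlogθ] at this
    rw [div_le_iff₀ hJ']
    linarith
  have hev : ∀ᶠ N : ℕ in atTop, 32 * (1 + Real.log N) ^ 2 ≤ (N : ℝ) ^ κ ∧ 1 ≤ N := by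
    refine Filter.Eventually.and ?_ (eventually_ge_atTop 1)
    have h1 : Asymptotics.IsLittleO atTop (fun x : ℝ => 1 + Real.log x)
        fun x : ℝ => x ^ (κ / 2) := by
      refine Asymptotics.IsLittleO.add ?_ (isLittleO_log_rpow_atTop (by positivity))
      exact Asymptotics.isLittleO_const_left.mpr (Or.inr
        (tendsto_norm_atTop_atTop.comp (tendsto_rpow_atTop (by positivity))))
    have h2 := (h1.bound (c := 1 / 8) (by norm_num)).and (eventually_ge_atTop 1)
    filter_upwards [tendsto_natCast_atTop_atTop.eventually h2] with N hN
    obtain ⟨h3, h4⟩ := hN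
    have h5 : 0 ≤ Real.log (N : ℝ) := Real.log_nonneg h4
    rw [Real.norm_of_nonneg (by linarith), Real.norm_of_nonneg (by positivity)] at h3
    have h6 : (N : ℝ) ^ κ = ((N : ℝ) ^ (κ / 2)) ^ 2 := by
      rw [← Real.rpow_natCast, ← Real.rpow_mul (by positivity)]
      congr 1
      push_cast
      ring
    rw [h6]
    have h7 := pow_le_pow_left₀ (by linarith) h3 2
    rw [mul_pow] at h7
    nlinarith [sq_nonneg ((N : ℝ) ^ (κ / 2))]
  obtain ⟨N₀, hN₀⟩ := eventually_atTop.mp hev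
  refine ⟨N₀, fun N hN => ?_⟩
  obtain ⟨hY, hN1⟩ := hN₀ N hN
  have hN1' : (1 : ℝ) ≤ N := by exact_mod_cast hN1
  have hNpos : (0 : ℝ) < N := by linarith
  have hlogN : 0 ≤ Real.log N := Real.log_natCast_nonneg N
  set Y : ℝ := (N : ℝ) ^ κ with hYdef
  have hY32 : 32 ≤ Y := by nlinarith
  have hYpow : ∀ k : ℕ, Y ^ k = (N : ℝ) ^ (k * κ) := fun k => by
    rw [hYdef, ← Real.rpow_natCast, ← Real.rpow_mul hNpos.le, mul_comm]
  set r : ℝ := (N : ℝ) ^ (1 / 2 - 5 * κ) with hr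
  have hr2 : r ^ 2 * Y ^ 10 = N := by
    rw [hYpow, hr, ← Real.rpow_natCast, ← Real.rpow_mul hNpos.le, ← Real.rpow_add hNpos]
    convert Real.rpow_one (N : ℝ) using 2
    push_cast
    ring
  have hrlow : (N : ℝ) ^ (1 / 2 - 6 * κ) + 1 ≤ r := by
    have h1 : r = Y * (N : ℝ) ^ (1 / 2 - 6 * κ) := by
      rw [hr, hYdef, ← Real.rpow_add hNpos]
      congr 1
      ring
    have h2 : 1 ≤ (N : ℝ) ^ (1 / 2 - 6 * κ) := Real.one_le_rpow hN1' (by linarith)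
    rw [h1]
    nlinarith
  set R := ⌊r⌋₊ with hRdef
  have hRr : (R : ℝ) ≤ r := Nat.floor_le (by positivity)
  have hRlow : (N : ℝ) ^ (1 / 2 - 6 * κ) ≤ R := by
    have := Nat.lt_floor_add_one r
    linarith
  have hR1 : (1 : ℝ) ≤ R := le_trans (Real.one_le_rpow hN1' (by linarith)) hRlow
  have hR0 : 0 < R := by exact_mod_cast hR1
  have hRY : (R : ℝ) ^ 2 * Y ^ 10 ≤ N := by
    rw [← hr2]
    gcongr
  have hR2 : (R : ℝ) ^ 2 ≤ N := by
    refine le_trans ?_ hRY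
    exact le_mul_of_one_le_right (by positivity) (one_le_pow₀ (by linarith))
  have hY5 : Y ^ 5 ≤ N := by
    rw [hYpow]
    conv_rhs => rw [← Real.rpow_one (N : ℝ)]
    exact Real.rpow_le_rpow_of_exponent_le hN1' (by push_cast; linarith)
  have hY5' : 0 < Y ^ 5 := by positivity
  set X := ⌈(N : ℝ) / Y ^ 5⌉₊ with hX
  have hX1 : (N : ℝ) ≤ X * Y ^ 5 := by
    rw [← div_le_iff₀ hY5']
    exact Nat.le_ceil _
  have hX2 : X * Y ^ 5 ≤ 2 * (N : ℝ) := by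
    have h1 : (X : ℝ) < N / Y ^ 5 + 1 := Nat.ceil_lt_add_one (by positivity)
    calc (X : ℝ) * Y ^ 5 ≤ (N / Y ^ 5 + 1) * Y ^ 5 := by gcongr
      _ = N + Y ^ 5 := by field_simp
      _ ≤ _ := by linarith
  have hXN : X ≤ N := by
    refine Nat.ceil_le.mpr (div_le_self hNpos.le ?_)
    exact one_le_pow₀ (by linarith)
  have hA : Real.log N ≤ (2 + η) * Real.log R := by
    have h1 := Real.log_le_log (by positivity) hRlow
    rw [Real.log_rpow hNpos] at h1
    nlinarith
  refine ⟨R, by exact_mod_cast hR2, fun m hm => ⟨sieveWeight (2 ^ m) R,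
    sieveWeight_nonneg hR0, fun p hp hRp => ?_, fun b L α hL => ?_⟩⟩
  · rw [sieveWeight_prime hR0 hp hRp]
    have := log_le_mul_selG hJ0 hJθ hA (by linarith) (m - J)
    rwa [Nat.add_sub_cancel' hm] at this
  · have hJm : 2 ^ J ≤ 2 ^ m := Nat.pow_le_pow_right (by norm_num) hm
    have hK : ∀ s ∈ sieveQ (2 ^ m) R, (16 : ℝ) ^ #s ≤ Y := fun s hs => by
      refine (sixteen_pow_card_le hJ0 hJm hs).trans ?_
      have hRN : (R : ℝ) ≤ N := by nlinarith
      refine (Real.rpow_le_rpow (by positivity) hRN (by positivity)).trans ?_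
      exact Real.rpow_le_rpow_of_exponent_le hN1' hJκ
    have h := norm_sum_sieveWeight_sub_one_le (by positivity) hJm hR0 hK hN1 hRY hXN hX1 hX2 hY5
      hY b L hL α
    push_cast at h ⊢
    rwa [Real.rpow_sub hNpos, Real.rpow_one]

end PrimeSum

namespace PrimeSum
open Finset ZMod

/-- Fourier transform on `ZMod M`. -/
noncomputable def ft {M : ℕ} [NeZero M] (f : ZMod M → ℝ) (r : ZMod M) : ℂ :=
  ∑ x, (f x : ℂ) * stdAddChar (r * x)

/-- Convolution on `ZMod M`. -/
def cv {M : ℕ} [NeZero M] (f g : ZMod M → ℝ) (x : ZMod M) : ℝ := ∑ y, f y * g (x - y)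

variable {M : ℕ} [NeZero M]

lemma sum_stdAddChar (x : ZMod M) :
    ∑ r : ZMod M, stdAddChar (r * x) = if x = 0 then (M : ℂ) else 0 := by
  rw [AddChar.sum_mulShift x (isPrimitive_stdAddChar M), ZMod.card]
  split_ifs <;> simp

lemma norm_stdAddChar (x : ZMod M) : ‖stdAddChar x‖ = 1 := AddChar.norm_apply _ _

lemma sum_ft_mul (f : ZMod M → ℝ) (x : ZMod M) :
    ∑ r, ft f r * stdAddChar (-(r * x)) = M * f x := by
  simp_rw [ft, sum_mul]
  rw [sum_comm]
  have : ∀ y, ∑ r : ZMod M, (f y : ℂ) * stdAddChar (r * y) * stdAddChar (-(r * x)) =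
      f y * if y - x = 0 then (M : ℂ) else 0 := fun y => by
    rw [← sum_stdAddChar, mul_sum]
    refine sum_congr rfl fun r _ => ?_
    rw [mul_assoc, ← AddChar.map_add_eq_mul]
    congr 2
    ring
  simp_rw [this, sub_eq_zero]
  rw [sum_eq_single x (fun y _ h => by simp [h]) (by simp)]
  simp [mul_comm]

lemma ft_cv (f g : ZMod M → ℝ) (r : ZMod M) : ft (cv f g) r = ft f r * ft g r := by
  simp_rw [ft, cv]
  push_cast
  simp_rw [sum_mul]
  rw [sum_comm]
  refine sum_congr rfl fun y _ => ?_
  rw [mul_sum, ← Equiv.sum_comp (Equiv.addRight y)]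
  refine sum_congr rfl fun x _ => ?_
  simp only [Equiv.coe_addRight, add_sub_cancel_right, mul_add, AddChar.map_add_eq_mul]
  ring

lemma ft_neg (f : ZMod M → ℝ) (r : ZMod M) :
    ft (fun x => f (-x)) r = (starRingEnd ℂ) (ft f r) := by
  simp_rw [ft, map_sum, map_mul, Complex.conj_ofReal, ← AddChar.map_neg_eq_conj]
  rw [← Equiv.sum_comp (Equiv.neg (ZMod M))]
  simp

lemma sum_norm_ft_sq (f : ZMod M → ℝ) : ∑ r, ‖ft f r‖ ^ 2 = M * ∑ x, f x ^ 2 := by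
  have h : ((∑ r, ‖ft f r‖ ^ 2 : ℝ) : ℂ) = ((M * ∑ x, f x ^ 2 : ℝ) : ℂ) := by
    push_cast
    have h1 := sum_ft_mul (cv f fun x => f (-x)) 0
    simp_rw [ft_cv, ft_neg, Complex.mul_conj', mul_zero, neg_zero, AddChar.map_zero_eq_one,
      mul_one] at h1
    rw [h1, cv]
    push_cast
    congr 1
    refine sum_congr rfl fun x _ => ?_
    rw [zero_sub, neg_neg, pow_two]
  exact_mod_cast h

lemma norm_ft_le {f : ZMod M → ℝ} (hf : ∀ x, 0 ≤ f x) (r : ZMod M) : ‖ft f r‖ ≤ ∑ x, f x := by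
  refine (norm_sum_le _ _).trans (sum_le_sum fun x _ => ?_)
  rw [norm_mul, norm_stdAddChar, mul_one, Complex.norm_real, Real.norm_of_nonneg (hf x)]

lemma cv_nonneg {f g : ZMod M → ℝ} (hf : ∀ x, 0 ≤ f x) (hg : ∀ x, 0 ≤ g x) (x : ZMod M) :
    0 ≤ cv f g x := sum_nonneg fun y _ => mul_nonneg (hf y) (hg _)

lemma sum_cv (f g : ZMod M → ℝ) : ∑ x, cv f g x = (∑ x, f x) * ∑ x, g x := by
  simp_rw [cv]
  rw [sum_comm, sum_mul]
  refine sum_congr rfl fun y _ => ?_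
  rw [← mul_sum]
  congr 1
  exact Equiv.sum_comp (Equiv.subRight y) g

lemma cv_comm (f g : ZMod M → ℝ) (x : ZMod M) : cv f g x = cv g f x := by
  rw [cv, cv, ← Equiv.sum_comp (Equiv.subLeft x)]
  refine sum_congr rfl fun y _ => ?_
  simp [mul_comm]

/-- Expanding a quadratic form of a trigonometric polynomial. -/
lemma sum_mul_norm_sq_eq (V : ZMod M → ℝ) (S : Finset (ZMod M)) (c : ZMod M → ℂ) :
    ((∑ x, V x * ‖∑ r ∈ S, c r * stdAddChar (r * x)‖ ^ 2 : ℝ) : ℂ) =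
      ∑ r ∈ S, ∑ s ∈ S, c r * (starRingEnd ℂ) (c s) * ft V (r - s) := by
  push_cast
  simp_rw [← Complex.mul_conj', map_sum, map_mul, ← AddChar.map_neg_eq_conj, sum_mul_sum,
    mul_sum, ft, mul_sum]
  rw [sum_comm]
  refine sum_congr rfl fun r _ => ?_
  rw [sum_comm]
  refine sum_congr rfl fun s _ => sum_congr rfl fun x _ => ?_
  rw [sub_mul, sub_eq_add_neg, AddChar.map_add_eq_mul]
  ring

/-- Large spectrum bound from a pseudorandom majorant. -/
lemma card_mul_le {f V u : ZMod M → ℝ} {A H E δ : ℝ} (hf : ∀ x, 0 ≤ f x) (hfV : ∀ x, f x ≤ H * V x)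
    (hH : 0 ≤ H) (hu : ∀ x, u x ≤ 1) (hE : ∀ r, ‖ft V r - ft u r‖ ≤ E)
    (hA : ∑ x, f x ≤ A * M) (hδ : 0 < δ) (hsmall : A * H * E ≤ δ ^ 2 * M / 2)
    {S : Finset (ZMod M)} (hS : ∀ r ∈ S, δ * M ≤ ‖ft f r‖) : #S * δ ^ 2 ≤ 2 * A * H := by
  have hM : (0 : ℝ) < M := by exact_mod_cast NeZero.pos M
  have hF0 : 0 ≤ ∑ x, f x := sum_nonneg fun x _ => hf x
  have hA0 : 0 ≤ A := by
    by_contra h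
    push Not at h
    nlinarith
  choose c hc1 hc2 using fun r => RCLike.exists_norm_eq_mul_self (ft f r)
  have hc2 : ∀ r, ((‖ft f r‖ : ℝ) : ℂ) = c r * ft f r := hc2
  set T : ZMod M → ℂ := fun x => ∑ r ∈ S, c r * stdAddChar (r * x) with hT
  have h1 : #S * (δ * M) ≤ ∑ x, f x * ‖T x‖ := by
    have h2 : ((∑ r ∈ S, ‖ft f r‖ : ℝ) : ℂ) = ∑ x, f x * T x := by
      push_cast
      rw [sum_congr rfl fun r _ => hc2 r]
      simp_rw [hT, ft, mul_sum]
      rw [sum_comm]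
      refine sum_congr rfl fun x _ => sum_congr rfl fun r _ => ?_
      ring
    calc #S * (δ * M) ≤ ∑ r ∈ S, ‖ft f r‖ := by
          rw [← nsmul_eq_mul]
          exact card_nsmul_le_sum _ _ _ hS
      _ = ‖((∑ r ∈ S, ‖ft f r‖ : ℝ) : ℂ)‖ := by
          rw [Complex.norm_real, Real.norm_of_nonneg (sum_nonneg fun _ _ => norm_nonneg _)]
      _ ≤ _ := by
          rw [h2]
          refine (norm_sum_le _ _).trans (sum_le_sum fun x _ => ?_)
          rw [norm_mul, Complex.norm_real, Real.norm_of_nonneg (hf x)]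
  have h2 : (∑ x, f x * ‖T x‖) ^ 2 ≤ (∑ x, f x) * ∑ x, f x * ‖T x‖ ^ 2 :=
    sum_sq_le_sum_mul_sum_of_sq_le_mul _ (fun x _ => hf x)
      (fun x _ => mul_nonneg (hf x) (sq_nonneg _)) fun x _ => le_of_eq (by ring)
  have h3 : ∑ x, f x * ‖T x‖ ^ 2 ≤ H * ∑ x, V x * ‖T x‖ ^ 2 := by
    rw [mul_sum]
    refine sum_le_sum fun x _ => ?_
    rw [← mul_assoc]
    exact mul_le_mul_of_nonneg_right (hfV x) (sq_nonneg _)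
  have h4 : ∑ x, V x * ‖T x‖ ^ 2 ≤ ∑ x, u x * ‖T x‖ ^ 2 + #S * (#S * E) := by
    have h5 : ‖((∑ x, V x * ‖T x‖ ^ 2 : ℝ) : ℂ) - ((∑ x, u x * ‖T x‖ ^ 2 : ℝ) : ℂ)‖ ≤
        #S * (#S * E) := by
      rw [sum_mul_norm_sq_eq, sum_mul_norm_sq_eq, ← sum_sub_distrib]
      simp_rw [← sum_sub_distrib, ← mul_sub]
      rw [← nsmul_eq_mul, ← nsmul_eq_mul]
      refine (norm_sum_le _ _).trans (sum_le_card_nsmul _ _ _ fun r _ => ?_)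
      refine (norm_sum_le _ _).trans (sum_le_card_nsmul _ _ _ fun s _ => ?_)
      rw [norm_mul, norm_mul, RCLike.norm_conj, hc1, hc1, one_mul, one_mul]
      exact hE _
    rw [← Complex.ofReal_sub, Complex.norm_real] at h5
    linarith [Real.le_norm_self (∑ x, V x * ‖T x‖ ^ 2 - ∑ x, u x * ‖T x‖ ^ 2)]
  have h6 : ∑ x, u x * ‖T x‖ ^ 2 ≤ #S * M := by
    have h7 : ∑ x, (fun _ => (1 : ℝ)) x * ‖T x‖ ^ 2 = #S * M := by
      have h8 := sum_mul_norm_sq_eq (M := M) (fun _ => (1 : ℝ)) S c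
      have h9 : ∀ r : ZMod M, ft (fun _ : ZMod M => (1 : ℝ)) r = if r = 0 then (M : ℂ) else 0 :=
        fun r => by
          rw [← sum_stdAddChar, ft]
          exact sum_congr rfl fun x _ => by rw [Complex.ofReal_one, one_mul, mul_comm]
      simp_rw [h9, sub_eq_zero] at h8
      have h10 : ∑ r ∈ S, ∑ s ∈ S, c r * (starRingEnd ℂ) (c s) * (if r = s then (M : ℂ) else 0) =
          ((#S * M : ℝ) : ℂ) := by
        push_cast
        rw [← nsmul_eq_mul, ← sum_const]
        refine sum_congr rfl fun r hr => ?_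
        rw [sum_eq_single_of_mem r hr fun s _ h => by simp [h.symm], if_pos rfl, Complex.mul_conj',
          hc1]
        simp
      rw [h10] at h8
      exact_mod_cast h8
    rw [← h7]
    refine sum_le_sum fun x _ => mul_le_mul_of_nonneg_right (hu x) (sq_nonneg _)
  rcases S.eq_empty_or_nonempty with hS0 | hS0
  · rw [hS0]
    simp only [card_empty, Nat.cast_zero, zero_mul]
    positivity
  have hSc : (0 : ℝ) < #S := by exact_mod_cast hS0.card_pos
  have h11 : (#S * (δ * M)) ^ 2 ≤ (A * M) * (H * (#S * M + #S * (#S * E))) := by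
    calc _ ≤ (∑ x, f x * ‖T x‖) ^ 2 := by gcongr
      _ ≤ _ := h2
      _ ≤ (∑ x, f x) * (H * (#S * M + #S * (#S * E))) := by
          gcongr
          refine h3.trans ?_
          gcongr
          linarith
      _ ≤ _ := by
          refine mul_le_mul_of_nonneg_right hA ?_
          have : 0 ≤ E := (norm_nonneg _).trans (hE 0)
          positivity
  have h12 : A * H * E * (M * #S * #S) ≤ δ ^ 2 * M / 2 * (M * #S * #S) := by gcongr
  have h13 : #S * δ ^ 2 * (#S * M ^ 2) ≤ 2 * A * H * (#S * M ^ 2) := by nlinarith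
  exact le_of_mul_le_mul_right h13 (by positivity)

end PrimeSum

namespace PrimeSum
open Finset ZMod

variable {M : ℕ} [NeZero M]

/-- A function on `ZMod M` bounded by a family of increasingly pseudorandom weights. -/
structure Dominated (f : ZMod M → ℝ) (A H θ τ : ℝ) (J : ℕ) : Prop where
  nonneg : ∀ x, 0 ≤ f x
  sum_le : ∑ x, f x ≤ A * M
  maj : ∀ i : ℕ, ∃ V u : ZMod M → ℝ, (∀ x, f x ≤ H * θ ^ i * V x) ∧ (∀ x, u x ≤ 1) ∧
    ∀ r, ‖ft V r - ft u r‖ ≤ M * (4 / 2 ^ (J + i) + τ)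

lemma Dominated.card_le {f : ZMod M → ℝ} {A H θ τ : ℝ} {J : ℕ} (hf : Dominated f A H θ τ J)
    (hA : 1 ≤ A) (hH : 0 ≤ H) (hH3 : H ≤ 3) (hθ : 1 ≤ θ) (hθ4 : θ ^ 4 ≤ 3 / 2) (hτ : 0 ≤ τ)
    (hJ : 48 * A ≤ 2 ^ J) {j : ℕ} (hj : 12 * A * 6 ^ j * τ ≤ 1) :
    (#{r | (1 / 2) ^ j * (M : ℝ) ≤ ‖ft f r‖} : ℝ) ≤ 6 * A * 6 ^ j := by
  obtain ⟨V, u, h1, h2, h3⟩ := hf.maj (4 * j)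
  have hM : (0 : ℝ) < M := by exact_mod_cast NeZero.pos M
  have hθj : θ ^ (4 * j) ≤ (3 / 2) ^ j := by
    rw [pow_mul]
    gcongr
  have hHθ : H * θ ^ (4 * j) ≤ 3 * (3 / 2) ^ j := by gcongr
  have hδ : ((1 : ℝ) / 2) ^ j * (1 / 2) ^ j = (1 / 4) ^ j := by rw [← mul_pow]; norm_num
  have hsmall : A * (H * θ ^ (4 * j)) * (M * (4 / 2 ^ (J + 4 * j) + τ)) ≤
      ((1 / 2) ^ j) ^ 2 * M / 2 := by
    rw [pow_two, hδ]
    have e1 : A * (3 * (3 / 2) ^ j) * (4 / 2 ^ (J + 4 * j)) ≤ (1 / 4 : ℝ) ^ j / 4 := by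
      have e2 : (3 / 2 : ℝ) ^ j ≤ 4 ^ j := by gcongr; norm_num
      have e3 : (2 : ℝ) ^ (J + 4 * j) = 2 ^ J * (4 ^ j * 4 ^ j) := by
        rw [pow_add, pow_mul, ← mul_pow]
        norm_num
      calc _ ≤ A * (3 * 4 ^ j) * (4 / 2 ^ (J + 4 * j)) := by gcongr
        _ = 12 * A / 2 ^ J * (1 / 4) ^ j := by
            rw [e3, one_div_pow]
            field_simp
            ring
        _ ≤ 1 / 4 * (1 / 4) ^ j := by
            refine mul_le_mul_of_nonneg_right ?_ (by positivity)
            rw [div_le_iff₀ (by positivity)]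
            linarith
        _ = _ := by ring
    have e4 : A * (3 * (3 / 2) ^ j) * τ ≤ (1 / 4 : ℝ) ^ j / 4 := by
      have e5 : (3 / 2 : ℝ) ^ j = 6 ^ j * (1 / 4) ^ j := by rw [← mul_pow]; norm_num
      calc _ = 12 * A * 6 ^ j * τ * ((1 / 4) ^ j / 4) := by rw [e5]; ring
        _ ≤ 1 * ((1 / 4) ^ j / 4) := by gcongr
        _ = _ := one_mul _
    calc _ ≤ A * (3 * (3 / 2) ^ j) * (M * (4 / 2 ^ (J + 4 * j) + τ)) := by gcongr
      _ = M * (A * (3 * (3 / 2) ^ j) * (4 / 2 ^ (J + 4 * j)) + A * (3 * (3 / 2) ^ j) * τ) := by ring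
      _ ≤ M * ((1 / 4 : ℝ) ^ j / 4 + (1 / 4 : ℝ) ^ j / 4) := by gcongr
      _ = _ := by ring
  have h4 := card_mul_le (S := {r | (1 / 2) ^ j * (M : ℝ) ≤ ‖ft f r‖}) (δ := (1 / 2) ^ j)
    hf.nonneg h1 (by positivity) h2 h3 hf.sum_le (by positivity) hsmall
    fun r hr => (mem_filter.mp hr).2
  rw [pow_two, hδ] at h4
  have e6 : (6 : ℝ) ^ j = (3 / 2) ^ j * 4 ^ j := by rw [← mul_pow]; norm_num
  have e7 : (1 / 4 : ℝ) ^ j * 4 ^ j = 1 := by rw [← mul_pow]; norm_num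
  have h5 := mul_le_mul_of_nonneg_right h4 (by positivity : (0 : ℝ) ≤ 4 ^ j)
  rw [mul_assoc, e7, mul_one] at h5
  calc _ ≤ _ := h5
    _ ≤ 2 * A * (3 * (3 / 2) ^ j) * 4 ^ j := by gcongr
    _ = _ := by rw [e6]; ring

/-- Contribution of the small Fourier coefficients to the third moment. -/
lemma sum_cube_le {ι : Type*} [Fintype ι] {F : ι → ℝ} (hF : ∀ r, 0 ≤ F r) {M B D : ℝ} (hM : 0 ≤ M)
    {j₁ : ℕ} (hB : ∀ j ≤ j₁, (#{r | (1 / 2) ^ j * M ≤ F r} : ℝ) ≤ B * 6 ^ j)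
    (hD : ∑ r, F r ^ 2 ≤ D * M ^ 2) {j : ℕ} (hj : j ≤ j₁) :
    ∑ r with F r < (1 / 2) ^ j * M, F r ^ 3 ≤
      (24 * B * (3 / 4) ^ j + D * (1 / 2) ^ j₁) * M ^ 3 := by
  have hB0 : 0 ≤ B := by
    have := (Nat.cast_nonneg _).trans (hB 0 (Nat.zero_le _))
    simpa using this
  induction hj using Nat.decreasingInduction with
  | self =>
    have h1 : ∑ r with F r < (1 / 2) ^ j₁ * M, F r ^ 3 ≤ (1 / 2) ^ j₁ * M * (D * M ^ 2) := by
      refine le_trans ?_ (mul_le_mul_of_nonneg_left hD (by positivity))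
      rw [mul_sum]
      refine (sum_le_sum fun r hr => ?_).trans
        (sum_le_sum_of_subset_of_nonneg (filter_subset _ _) fun r _ _ => by positivity)
      rw [pow_succ' _ 2]
      exact mul_le_mul_of_nonneg_right (mem_filter.mp hr).2.le (sq_nonneg _)
    have h2 : 0 ≤ 24 * B * (3 / 4) ^ j₁ * M ^ 3 := by positivity
    nlinarith
  | of_succ j hj ih =>
    have h1 : ∑ r with F r < (1 / 2) ^ j * M, F r ^ 3 ≤
        ∑ r with F r < (1 / 2) ^ (j + 1) * M, F r ^ 3 +
        ∑ r with F r < (1 / 2) ^ j * M ∧ (1 / 2) ^ (j + 1) * M ≤ F r, F r ^ 3 := by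
      rw [← sum_filter_add_sum_filter_not _ (fun r => F r < (1 / 2) ^ (j + 1) * M)]
      rw [filter_filter, filter_filter]
      simp_rw [not_lt]
      gcongr ?_ + _
      exact sum_le_sum_of_subset_of_nonneg (fun r hr => by
        simp only [mem_filter] at hr ⊢; tauto) fun r _ _ => pow_nonneg (hF r) 3
    have h2 : ∑ r with F r < (1 / 2) ^ j * M ∧ (1 / 2) ^ (j + 1) * M ≤ F r, F r ^ 3 ≤
        (B * 6 ^ (j + 1)) * ((1 / 2) ^ j * M) ^ 3 := by
      refine (sum_le_card_nsmul _ _ (((1 / 2) ^ j * M) ^ 3) fun r hr => ?_).trans ?_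
      · have := (mem_filter.mp hr).2.1
        exact pow_le_pow_left₀ (hF r) this.le 3
      · rw [nsmul_eq_mul]
        refine mul_le_mul_of_nonneg_right (le_trans ?_ (hB (j + 1) hj)) (by positivity)
        exact_mod_cast card_le_card fun r hr => by
          simp only [mem_filter] at hr ⊢; tauto
    refine h1.trans ((add_le_add ih h2).trans (le_of_eq ?_))
    have e1 : (6 : ℝ) ^ (j + 1) * ((1 / 2) ^ j) ^ 3 = 6 * (3 / 4) ^ j := by
      rw [← pow_mul, mul_comm j 3, pow_mul, pow_succ, mul_comm _ (6 : ℝ), mul_assoc, ← mul_pow]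
      norm_num
    rw [mul_pow, ← mul_assoc, mul_assoc B, e1, pow_succ (3 / 4 : ℝ)]
    ring

lemma Dominated.sum_cube_le {f : ZMod M → ℝ} {A H θ τ F : ℝ} {J : ℕ}
    (hf : Dominated f A H θ τ J) (hA : 1 ≤ A) (hH : 0 ≤ H) (hH3 : H ≤ 3) (hθ : 1 ≤ θ)
    (hθ4 : θ ^ 4 ≤ 3 / 2) (hτ : 0 ≤ τ) (hJ : 48 * A ≤ 2 ^ J) {j₁ : ℕ}
    (hj₁ : 12 * A * 6 ^ j₁ * τ ≤ 1) (hF : ∀ x, f x ≤ F) {j : ℕ} (hj : j ≤ j₁) :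
    ∑ r with ‖ft f r‖ < (1 / 2) ^ j * M, ‖ft f r‖ ^ 3 ≤
      (144 * A * (3 / 4) ^ j + A * F * (1 / 2) ^ j₁) * M ^ 3 := by
  have hM : (0 : ℝ) < M := by exact_mod_cast NeZero.pos M
  have hF0 : 0 ≤ F := (hf.nonneg 0).trans (hF 0)
  have h := PrimeSum.sum_cube_le (F := fun r => ‖ft f r‖) (B := 6 * A) (D := A * F) (j₁ := j₁)
    (fun r => norm_nonneg _) hM.le (fun i hi => hf.card_le hA hH hH3 hθ hθ4 hτ hJ (by
      refine le_trans ?_ hj₁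
      have : (6 : ℝ) ^ i ≤ 6 ^ j₁ := pow_le_pow_right₀ (by norm_num) hi
      gcongr)) (by
      rw [sum_norm_ft_sq]
      have : ∑ x, f x ^ 2 ≤ F * (A * M) := by
        refine le_trans ?_ (mul_le_mul_of_nonneg_left hf.sum_le hF0)
        rw [mul_sum]
        refine sum_le_sum fun x _ => ?_
        rw [pow_two]
        exact mul_le_mul_of_nonneg_right (hF x) (hf.nonneg x)
      nlinarith) hj
  convert h using 3
  ring

end PrimeSum

namespace PrimeSum
open Finset ZMod

variable {M : ℕ} [NeZero M]

lemma stdAddChar_intCast (k : ℤ) : stdAddChar (k : ZMod M) = ee (k / M) := by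
  rw [stdAddChar_coe, ee]
  congr 1
  push_cast
  ring

lemma norm_stdAddChar_sub_one_le {n : ℕ} (hn : 0 < n) {k : ℤ} (hk : |k| * n ≤ (M : ℤ)) :
    ‖stdAddChar (k : ZMod M) - 1‖ ≤ 2 * Real.pi / n := by
  rw [stdAddChar_intCast]
  refine (norm_ee_sub_one_le _).trans ?_
  have hM : (0 : ℝ) < M := by exact_mod_cast NeZero.pos M
  have hn' : (0 : ℝ) < n := by exact_mod_cast hn
  have hk' : |(k : ℝ)| * n ≤ M := by exact_mod_cast hk
  rw [abs_div, abs_of_pos hM, div_eq_mul_one_div (2 * Real.pi)]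
  refine mul_le_mul_of_nonneg_left ?_ (by positivity)
  rw [div_le_div_iff₀ hM hn', one_mul]
  exact hk'

/-- A probability measure concentrated on a Bohr set. -/
lemma exists_bohr_measure (S : Finset (ZMod M)) (hS : (1 : ZMod M) ∈ S) {n : ℕ} (hn : 0 < n) :
    ∃ μ : ZMod M → ℝ, (∀ x, 0 ≤ μ x) ∧ ∑ x, μ x = 1 ∧
      (∀ x, μ x ≠ 0 → ∃ d : ℤ, x = d ∧ |d| * n ≤ (M : ℤ)) ∧
      (∀ r ∈ S, ‖ft μ r - 1‖ ≤ 2 * Real.pi / n) ∧ ∑ r, ‖ft μ r‖ ^ 2 ≤ (n : ℝ) ^ #S := by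
  have hM0 : 0 < M := NeZero.pos M
  have hM : (0 : ℝ) < M := by exact_mod_cast hM0
  have : NeZero n := ⟨hn.ne'⟩
  set φ : ZMod M → S → Fin n := fun x r => ⟨n * (r.1 * x).val / M, by
    rw [Nat.div_lt_iff_lt_mul hM0]
    exact Nat.mul_lt_mul_of_pos_left (ZMod.val_lt _) hn⟩ with hφ
  obtain ⟨y, hy⟩ := Fintype.exists_le_card_fiber_of_nsmul_le_card (M := ℝ) φ
    (b := (M : ℝ) / n ^ #S) (by
      rw [Fintype.card_fun, Fintype.card_fin, Fintype.card_coe, ZMod.card, nsmul_eq_mul]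
      push_cast
      rw [mul_div_cancel₀]
      positivity)
  set C : Finset (ZMod M) := {x | φ x = y} with hC
  have hCpos : (0 : ℝ) < #C := lt_of_lt_of_le (by positivity) hy
  obtain ⟨x₀, hx₀⟩ : C.Nonempty := card_pos.mp (by exact_mod_cast hCpos)
  have hval : ∀ x ∈ C, ∀ r ∈ S, ∃ k : ℤ, r * (x - x₀) = k ∧ |k| * n ≤ (M : ℤ) := by
    intro x hx r hr
    refine ⟨((r * x).val : ℤ) - (r * x₀).val, by simp [mul_sub], ?_⟩
    have h1 : φ x = φ x₀ := (mem_filter.mp hx).2.trans (mem_filter.mp hx₀).2.symm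
    have h2 : n * (r * x).val / M = n * (r * x₀).val / M :=
      congrArg Fin.val (congrFun h1 ⟨r, hr⟩)
    have h3 := Nat.div_add_mod (n * (r * x).val) M
    have h4 := Nat.div_add_mod (n * (r * x₀).val) M
    have h5 := Nat.mod_lt (n * (r * x).val) hM0
    have h6 := Nat.mod_lt (n * (r * x₀).val) hM0
    rw [h2] at h3
    have h7 : |(n : ℤ) * (((r * x).val : ℤ) - (r * x₀).val)| ≤ M := by
      rw [abs_le]
      generalize n * (r * x).val % M = u at h3 h5
      generalize n * (r * x₀).val % M = v at h4 h6
      zify at h3 h4 h5 h6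
      constructor <;> linarith [Int.natCast_nonneg u, Int.natCast_nonneg v]
    rwa [abs_mul, Nat.abs_cast, mul_comm] at h7
  set μ : ZMod M → ℝ := fun x => if x + x₀ ∈ C then (#C : ℝ)⁻¹ else 0 with hμ
  have hμ0 : ∀ x, 0 ≤ μ x := fun x => by
    rw [hμ]
    dsimp only
    split_ifs <;> positivity
  have hsum : ∀ g : ℝ → ℝ, g 0 = 0 → ∑ x, g (μ x) = #C * g (#C : ℝ)⁻¹ := fun g hg => by
    rw [← Equiv.sum_comp (Equiv.subRight x₀)]
    simp only [hμ, Equiv.subRight_apply, sub_add_cancel, apply_ite g, hg]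
    rw [sum_ite_mem, univ_inter, sum_const, nsmul_eq_mul]
  have hmem : ∀ x, μ x ≠ 0 → x + x₀ ∈ C := fun x hx => by
    by_contra h
    exact hx (if_neg h)
  have hsum1 : ∑ x, μ x = 1 := by
    rw [hsum (fun x => x) rfl, mul_inv_cancel₀ hCpos.ne']
  refine ⟨μ, hμ0, hsum1, fun x hx => ?_, fun r hr => ?_, ?_⟩
  · obtain ⟨k, h1, h2⟩ := hval _ (hmem x hx) 1 hS
    exact ⟨k, by rw [← h1]; ring, h2⟩
  · have h1 : ft μ r - 1 = ∑ x, (μ x : ℂ) * (stdAddChar (r * x) - 1) := by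
      simp_rw [mul_sub, sum_sub_distrib, mul_one]
      rw [ft, ← Complex.ofReal_sum, hsum1, Complex.ofReal_one]
    rw [h1]
    calc _ ≤ ∑ x, μ x * (2 * Real.pi / n) := by
          refine (norm_sum_le _ _).trans (sum_le_sum fun x _ => ?_)
          rw [norm_mul, Complex.norm_real, Real.norm_of_nonneg (hμ0 x)]
          rcases eq_or_ne (μ x) 0 with h0 | h0
          · rw [h0, zero_mul, zero_mul]
          · refine mul_le_mul_of_nonneg_left ?_ (hμ0 x)
            obtain ⟨k, h2, h3⟩ := hval _ (hmem x h0) r hr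
            rw [add_sub_cancel_right] at h2
            rw [h2]
            exact norm_stdAddChar_sub_one_le hn h3
      _ = _ := by rw [← sum_mul, hsum1, one_mul]
  · rw [sum_norm_ft_sq, hsum (fun x => x ^ 2) (by norm_num)]
    have h1 : (M : ℝ) ≤ #C * n ^ #S := by rwa [div_le_iff₀ (by positivity)] at hy
    calc (M : ℝ) * (#C * (#C : ℝ)⁻¹ ^ 2) = M / #C := by field_simp
      _ ≤ _ := by rwa [div_le_iff₀ hCpos, mul_comm]

end PrimeSum

namespace PrimeSum
open Finset ZMod

variable {M : ℕ} [NeZero M]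

/-- Smoothing a majorized function bounds it pointwise. -/
lemma cv_cv_le {f V u μ : ZMod M → ℝ} {H E Z : ℝ} (hH : 0 ≤ H) (hfV : ∀ x, f x ≤ H * V x)
    (hu : ∀ x, u x ≤ 1) (hE : ∀ r, ‖ft V r - ft u r‖ ≤ E) (hμ : ∀ x, 0 ≤ μ x)
    (hμ1 : ∑ x, μ x = 1) (hZ : ∑ r, ‖ft μ r‖ ^ 2 ≤ Z) (x : ZMod M) :
    cv f (cv μ μ) x ≤ H * (1 + E * Z / M) := by
  have hM : (0 : ℝ) < M := by exact_mod_cast NeZero.pos M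
  have hE0 : 0 ≤ E := (norm_nonneg _).trans (hE 0)
  have hμμ : ∀ x, 0 ≤ cv μ μ x := cv_nonneg hμ hμ
  have hsum : ∑ x, cv μ μ x = 1 := by rw [sum_cv, hμ1, one_mul]
  have h1 : cv f (cv μ μ) x ≤ H * cv V (cv μ μ) x := by
    rw [cv, cv, mul_sum]
    refine sum_le_sum fun y _ => ?_
    rw [← mul_assoc]
    exact mul_le_mul_of_nonneg_right (hfV y) (hμμ _)
  have h2 : cv u (cv μ μ) x ≤ 1 := by
    rw [cv_comm, cv, ← hsum]
    exact sum_le_sum fun y _ => mul_le_of_le_one_right (hμμ y) (hu _)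
  have h3 : (M : ℝ) * (cv V (cv μ μ) x - cv u (cv μ μ) x) ≤ E * Z := by
    have h4 : ((M * (cv V (cv μ μ) x - cv u (cv μ μ) x) : ℝ) : ℂ) =
        ∑ r, (ft V r - ft u r) * ft μ r ^ 2 * stdAddChar (-(r * x)) := by
      push_cast
      rw [mul_sub, ← sum_ft_mul, ← sum_ft_mul, ← sum_sub_distrib]
      refine sum_congr rfl fun r _ => ?_
      simp only [ft_cv]
      ring
    calc _ ≤ ‖((M * (cv V (cv μ μ) x - cv u (cv μ μ) x) : ℝ) : ℂ)‖ := by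
          rw [Complex.norm_real]
          exact Real.le_norm_self _
      _ ≤ E * ∑ r, ‖ft μ r‖ ^ 2 := by
          rw [h4, mul_sum]
          refine (norm_sum_le _ _).trans (sum_le_sum fun r _ => ?_)
          rw [norm_mul, norm_mul, norm_stdAddChar, mul_one, norm_pow]
          exact mul_le_mul_of_nonneg_right (hE r) (sq_nonneg _)
      _ ≤ _ := by gcongr
  refine h1.trans (mul_le_mul_of_nonneg_left ?_ hH)
  have h5 : cv V (cv μ μ) x - cv u (cv μ μ) x ≤ E * Z / M := by
    rwa [le_div_iff₀ hM, mul_comm]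
  linarith

lemma norm_one_sub_pow_le {w : ℂ} (hw : ‖w‖ ≤ 1) (k : ℕ) : ‖1 - w ^ k‖ ≤ k * ‖w - 1‖ := by
  rw [← mul_neg_geom_sum, norm_mul, mul_comm, norm_sub_rev]
  refine mul_le_mul_of_nonneg_right ((norm_sum_le _ _).trans ?_) (norm_nonneg _)
  refine (sum_le_card_nsmul _ _ 1 fun i _ => ?_).trans (by simp)
  rw [norm_pow]
  exact pow_le_one₀ (norm_nonneg _) hw

/-- The number of weighted solutions barely changes under smoothing. -/
lemma abs_cv_sub_cv_le (f : Fin 3 → ZMod M → ℝ) {μ : ZMod M → ℝ} {A σ ρ D : ℝ}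
    (hf : ∀ i x, 0 ≤ f i x) (hA : ∀ i, ∑ x, f i x ≤ A * M) (hμ : ∀ x, 0 ≤ μ x)
    (hμ1 : ∑ x, μ x = 1) {S : Finset (ZMod M)} (hS : ∀ r ∈ S, ‖ft μ r - 1‖ ≤ ρ)
    (hsmall : ∀ i, ∀ r ∉ S, ‖ft (f i) r‖ < σ)
    (hD : ∀ i, ∑ r with ‖ft (f i) r‖ < σ, ‖ft (f i) r‖ ^ 3 ≤ D * M ^ 3) (t : ZMod M) :
    |cv (f 0) (cv (f 1) (f 2)) t - cv (cv (f 0) (cv μ μ)) (cv (cv (f 1) (cv μ μ))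
      (cv (f 2) (cv μ μ))) t| ≤ (#S * (6 * ρ * A ^ 3) + 6 * D) * M ^ 2 := by
  have hM : (0 : ℝ) < M := by exact_mod_cast NeZero.pos M
  have hnorm : ∀ r, ‖ft μ r‖ ≤ 1 := fun r => hμ1 ▸ norm_ft_le hμ r
  have hAM : 0 ≤ A * M := (sum_nonneg fun x _ => hf 0 x).trans (hA 0)
  set X := cv (f 0) (cv (f 1) (f 2)) t - cv (cv (f 0) (cv μ μ)) (cv (cv (f 1) (cv μ μ))
      (cv (f 2) (cv μ μ))) t with hX
  set P : ZMod M → ℂ := fun r => ft (f 0) r * ft (f 1) r * ft (f 2) r with hP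
  have h1 : ((M * X : ℝ) : ℂ) = ∑ r, P r * (1 - ft μ r ^ 6) * stdAddChar (-(r * t)) := by
    rw [hX]
    push_cast
    rw [mul_sub, ← sum_ft_mul, ← sum_ft_mul, ← sum_sub_distrib]
    refine sum_congr rfl fun r _ => ?_
    simp only [ft_cv, hP]
    ring
  have hPn : ∀ r, ‖P r‖ = ‖ft (f 0) r‖ * ‖ft (f 1) r‖ * ‖ft (f 2) r‖ := fun r => by
    rw [hP, norm_mul, norm_mul]
  have hPS : ∀ r ∈ S, ‖P r * (1 - ft μ r ^ 6) * stdAddChar (-(r * t))‖ ≤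
      (A * M) ^ 3 * (6 * ρ) := fun r hr => by
    rw [norm_mul, norm_stdAddChar, mul_one, norm_mul]
    have h2 : ∀ i, ‖ft (f i) r‖ ≤ A * M := fun i => (norm_ft_le (hf i) r).trans (hA i)
    have h3 : ‖1 - ft μ r ^ 6‖ ≤ 6 * ρ :=
      (norm_one_sub_pow_le (hnorm r) 6).trans (by push_cast; linarith [hS r hr])
    refine mul_le_mul ?_ h3 (norm_nonneg _) (by positivity)
    rw [hPn]
    calc _ ≤ (A * M) * (A * M) * (A * M) := by
          gcongr
          exacts [h2 0, h2 1, h2 2]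
      _ = _ := by ring
  have hPS' : ∀ r ∈ univ \ S, ‖P r * (1 - ft μ r ^ 6) * stdAddChar (-(r * t))‖ ≤
      2 * ∑ i, ‖ft (f i) r‖ ^ 3 := fun r hr => by
    rw [norm_mul, norm_stdAddChar, mul_one, norm_mul, mul_comm]
    have h3 : ‖1 - ft μ r ^ 6‖ ≤ 2 := by
      refine (norm_sub_le _ _).trans ?_
      rw [norm_one, norm_pow]
      linarith [pow_le_one₀ (norm_nonneg _) (hnorm r) (n := 6)]
    refine mul_le_mul h3 ?_ (norm_nonneg _) (by norm_num)
    rw [hPn, Fin.sum_univ_three]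
    have ha := norm_nonneg (ft (f 0) r)
    have hb := norm_nonneg (ft (f 1) r)
    have hc := norm_nonneg (ft (f 2) r)
    generalize ‖ft (f 0) r‖ = a at *
    generalize ‖ft (f 1) r‖ = b at *
    generalize ‖ft (f 2) r‖ = c at *
    have h4 : ∀ d, d = max a (max b c) → a * b * c ≤ d ^ 3 := fun d hd => by
      have h5 : a ≤ d := hd ▸ le_max_left _ _
      have h6 : b ≤ d := hd ▸ (le_max_left _ _).trans (le_max_right _ _)
      have h7 : c ≤ d := hd ▸ (le_max_right _ _).trans (le_max_right _ _)
      have hd0 : 0 ≤ d := ha.trans h5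
      calc _ ≤ d * d * d := by gcongr
        _ = _ := by ring
    have h5 := pow_nonneg ha 3
    have h6 := pow_nonneg hb 3
    have h7 := pow_nonneg hc 3
    refine (h4 _ rfl).trans ?_
    rcases max_choice a (max b c) with h | h <;> rw [h]
    · linarith
    rcases max_choice b c with h | h <;> rw [h] <;> linarith
  have h8 : M * |X| ≤ #S * ((A * M) ^ 3 * (6 * ρ)) + 2 * (3 * (D * M ^ 3)) := by
    have h9 : ‖((M * X : ℝ) : ℂ)‖ = M * |X| := by
      rw [Complex.norm_real, norm_mul, Real.norm_eq_abs, Real.norm_eq_abs, abs_of_pos hM]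
    rw [← h9, h1, ← sum_sdiff (subset_univ S), add_comm ((#S : ℝ) * _)]
    refine (norm_add_le _ _).trans (add_le_add ?_ ?_)
    · refine (norm_sum_le _ _).trans ((sum_le_sum hPS').trans ?_)
      rw [← mul_sum, sum_comm]
      gcongr
      calc _ ≤ ∑ _i : Fin 3, D * (M : ℝ) ^ 3 := sum_le_sum fun i _ => by
            refine le_trans (sum_le_sum_of_subset_of_nonneg (fun r hr => ?_)
              fun r _ _ => by positivity) (hD i)
            exact mem_filter.mpr ⟨mem_univ r, hsmall i r (mem_sdiff.mp hr).2⟩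
        _ = _ := by simp
    · rw [← nsmul_eq_mul]
      exact (norm_sum_le _ _).trans (sum_le_card_nsmul _ _ _ hPS)
  refine le_of_mul_le_mul_left (h8.trans (le_of_eq ?_)) hM
  ring

/-- Transference: dominated functions can be replaced by bounded averages of themselves. -/
theorem exists_dense_model {A ε : ℝ} (hA : 1 ≤ A) (hε : 0 < ε) :
    ∃ (J₀ : ℕ) (c : ℝ), 0 < c ∧ ∀ J ≥ J₀, ∀ (M : ℕ) [NeZero M] (f : Fin 3 → ZMod M → ℝ)
      (H θ τ F : ℝ) (j₁ : ℕ) (t : ZMod M), 0 ≤ H → H ≤ 3 → 1 ≤ θ → θ ^ 4 ≤ 3 / 2 → 0 ≤ τ →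
      (∀ i, Dominated (f i) A H θ τ J) → (∀ i x, f i x ≤ F) → 1 ≤ F → τ ≤ c →
      12 * A * 6 ^ j₁ * τ ≤ 1 → F * (1 / 2) ^ j₁ ≤ c →
      ∃ l : ZMod M → ℝ, (∀ x, 0 ≤ l x) ∧ ∑ x, l x = 1 ∧
        (∀ x, l x ≠ 0 → ∃ d : ℤ, x = d ∧ |(d : ℝ)| ≤ ε * M) ∧
        (∀ i x, cv (f i) l x ≤ H * (1 + ε)) ∧
        |cv (f 0) (cv (f 1) (f 2)) t - cv (cv (f 0) l) (cv (cv (f 1) l) (cv (f 2) l)) t| ≤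
          ε * M ^ 2 := by
  obtain ⟨j₀, hj₀⟩ := exists_pow_lt_of_lt_one (by positivity : 0 < ε / (4 * 864 * A))
    (by norm_num : (3 / 4 : ℝ) < 1)
  obtain ⟨k, hk⟩ := exists_nat_ge (18 * A * 6 ^ j₀ + 1)
  obtain ⟨n, hn⟩ := exists_nat_gt (max (2 / ε) (4 * (k * (6 * (2 * Real.pi) * A ^ 3)) / ε))
  have hn0' : (0 : ℝ) < n := lt_of_lt_of_le (by positivity) ((le_max_left _ _).trans hn.le)
  have hn0 : 0 < n := by exact_mod_cast hn0'
  have hn1 : 2 ≤ ε * n := by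
    have := ((le_max_left _ _).trans_lt hn).le
    rwa [div_le_iff₀ hε, mul_comm] at this
  have hn2 : k * (6 * (2 * Real.pi / n) * A ^ 3) ≤ ε / 4 := by
    have := ((le_max_right _ _).trans_lt hn).le
    rw [div_le_iff₀ hε] at this
    have e : k * (6 * (2 * Real.pi / n) * A ^ 3) = k * (6 * (2 * Real.pi) * A ^ 3) / n := by
      field_simp
    rw [e, div_le_iff₀ hn0']
    linarith
  have hnk : (0 : ℝ) < n ^ k := by positivity
  obtain ⟨J₀, hJ₀⟩ := pow_unbounded_of_one_lt (max (48 * A) (8 * n ^ k / ε))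
    (by norm_num : (1 : ℝ) < 2)
  refine ⟨J₀, min (min (ε / (24 * A)) (ε / (2 * n ^ k))) ((1 / 2) ^ j₀), by positivity, ?_⟩
  intro J hJ M _ f H θ τ F j₁ t hH hH3 hθ hθ4 hτ hf hF hF1 hτc hj₁ hFc
  have hM : (0 : ℝ) < M := by exact_mod_cast NeZero.pos M
  have h2J : (2 : ℝ) ^ J₀ ≤ 2 ^ J := pow_le_pow_right₀ (by norm_num) hJ
  have hJA : 48 * A ≤ 2 ^ J := ((le_max_left _ _).trans_lt hJ₀).le.trans h2J
  have hJn : 4 / 2 ^ J * (n : ℝ) ^ k ≤ ε / 2 := by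
    have := ((le_max_right _ _).trans_lt hJ₀).le.trans h2J
    rw [div_le_iff₀ hε] at this
    rw [div_mul_eq_mul_div, div_le_iff₀ (by positivity)]
    linarith
  have hτn : τ * (n : ℝ) ^ k ≤ ε / 2 := by
    have := hτc.trans ((min_le_left _ _).trans (min_le_right _ _))
    rw [le_div_iff₀ (by positivity)] at this
    linarith
  have hF2 : 6 * (A * F * (1 / 2) ^ j₁) ≤ ε / 4 := by
    have := hFc.trans ((min_le_left _ _).trans (min_le_left _ _))
    rw [le_div_iff₀ (by positivity)] at this
    linarith
  have hj : j₀ ≤ j₁ := by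
    have h1 := hFc.trans (min_le_right _ _)
    have h2 : ((1 : ℝ) / 2) ^ j₁ ≤ (1 / 2) ^ j₀ :=
      (le_mul_of_one_le_left (by positivity) hF1).trans h1
    exact (pow_le_pow_iff_right_of_lt_one₀ (by norm_num) (by norm_num)).mp h2
  set S : Finset (ZMod M) :=
    insert 1 (univ.biUnion fun i => {r | (1 / 2) ^ j₀ * (M : ℝ) ≤ ‖ft (f i) r‖}) with hSdef
  have hSk : #S ≤ k := by
    have h1 : (#S : ℝ) ≤ 18 * A * 6 ^ j₀ + 1 := by
      have h2 : #S ≤ (∑ i : Fin 3, #{r | (1 / 2) ^ j₀ * (M : ℝ) ≤ ‖ft (f i) r‖}) + 1 :=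
        (card_insert_le _ _).trans (Nat.add_le_add_right card_biUnion_le 1)
      have h3 : ((∑ i : Fin 3, #{r | (1 / 2) ^ j₀ * (M : ℝ) ≤ ‖ft (f i) r‖} : ℕ) : ℝ) ≤
          18 * A * 6 ^ j₀ := by
        push_cast
        refine (sum_le_sum (g := fun _ => 6 * A * 6 ^ j₀) fun i _ =>
          (hf i).card_le hA hH hH3 hθ hθ4 hτ hJA ?_).trans ?_
        · refine le_trans ?_ hj₁
          have : (6 : ℝ) ^ j₀ ≤ 6 ^ j₁ := pow_le_pow_right₀ (by norm_num) hj
          gcongr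
        · rw [sum_const, card_univ, Fintype.card_fin, nsmul_eq_mul]
          push_cast
          linarith
      have h4 : (#S : ℝ) ≤
          ((∑ i : Fin 3, #{r | (1 / 2) ^ j₀ * (M : ℝ) ≤ ‖ft (f i) r‖} : ℕ) : ℝ) + 1 := by
        exact_mod_cast h2
      linarith
    exact_mod_cast h1.trans hk
  obtain ⟨μ, hμ0, hμ1, hμs, hμS, hμ2⟩ := exists_bohr_measure S (mem_insert_self _ _) hn0
  have hμ2' : ∑ r, ‖ft μ r‖ ^ 2 ≤ (n : ℝ) ^ k :=
    hμ2.trans (pow_le_pow_right₀ (by exact_mod_cast hn0) hSk)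
  refine ⟨cv μ μ, cv_nonneg hμ0 hμ0, by rw [sum_cv, hμ1, one_mul], fun x hx => ?_,
    fun i x => ?_, ?_⟩
  · obtain ⟨y, -, hy⟩ := exists_ne_zero_of_sum_ne_zero hx
    obtain ⟨d, hd1, hd2⟩ := hμs y (left_ne_zero_of_mul hy)
    obtain ⟨e, he1, he2⟩ := hμs (x - y) (right_ne_zero_of_mul hy)
    refine ⟨d + e, by push_cast; rw [← hd1, ← he1]; ring, ?_⟩
    have h1 : |(d : ℝ)| * n ≤ M := by exact_mod_cast hd2
    have h2 : |(e : ℝ)| * n ≤ M := by exact_mod_cast he2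
    push_cast
    have h3 := abs_add_le (d : ℝ) e
    refine le_of_mul_le_mul_right ?_ hn0'
    nlinarith
  · obtain ⟨V, u, h1, h2, h3⟩ := (hf i).maj 0
    rw [pow_zero, mul_one, add_zero] at *
    refine (cv_cv_le hH h1 h2 h3 hμ0 hμ1 hμ2' x).trans ?_
    gcongr
    rw [div_le_iff₀ hM]
    nlinarith
  · refine (abs_cv_sub_cv_le f (A := A) (σ := (1 / 2) ^ j₀ * M) (fun i => (hf i).nonneg)
      (fun i => (hf i).sum_le) hμ0 hμ1 hμS (fun i r hr => ?_) (fun i =>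
      (hf i).sum_cube_le hA hH hH3 hθ hθ4 hτ hJA hj₁ (hF i) hj) t).trans ?_
    · by_contra h
      refine hr (mem_insert_of_mem (mem_biUnion.mpr ⟨i, mem_univ i, ?_⟩))
      exact mem_filter.mpr ⟨mem_univ r, not_lt.mp h⟩
    · gcongr
      have h1 : (#S : ℝ) * (6 * (2 * Real.pi / n) * A ^ 3) ≤ ε / 4 := by
        refine le_trans ?_ hn2
        gcongr
      have h2 : 6 * (144 * A * (3 / 4) ^ j₀) ≤ ε / 4 := by
        rw [lt_div_iff₀ (by positivity)] at hj₀
        linarith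
      linarith

end PrimeSum

namespace PrimeSum
open Finset

lemma sum_range_two_mul (f : ℕ → ℝ) (m : ℕ) :
    ∑ x ∈ range (2 * m), f x = ∑ h ∈ range m, f (2 * h) + ∑ h ∈ range m, f (1 + 2 * h) := by
  induction m with
  | zero => simp
  | succ m ih =>
    rw [mul_add, mul_one, sum_range_succ, sum_range_succ, ih, sum_range_succ, sum_range_succ,
      add_comm 1 (2 * m)]
    ring

lemma abs_sub_one_sub_le {a u : ℝ} (ha : 0 ≤ a) (ha1 : a ≤ 1) (hu : 0 ≤ u) (hu1 : u ≤ 1) :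
    |u - (1 - a)| ≤ 1 - a - u + 2 * (a * u) := by
  rw [abs_le]
  constructor <;> nlinarith [mul_nonneg ha hu, mul_nonneg (sub_nonneg.2 ha1) (sub_nonneg.2 hu1)]

/-- A dense enough subset of an interval has two elements at distance `h` or `2 * h`. -/
lemma exists_mem_add_mem {U : Finset ℕ} {w h : ℕ} (hU : U ⊆ range w) (hc : w + 2 * h < 3 * #U) :
    ∃ z ∈ U, z + h ∈ U ∨ z + 2 * h ∈ U := by
  by_contra! hcon
  have h1 : Disjoint U (U.image (· + h)) := by
    rw [disjoint_left]
    intro y hy hy'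
    obtain ⟨z, hz, rfl⟩ := mem_image.mp hy'
    exact (hcon z hz).1 hy
  have h2 : Disjoint (U ∪ U.image (· + h)) (U.image (· + 2 * h)) := by
    rw [disjoint_left]
    intro y hy hy'
    obtain ⟨z, hz, rfl⟩ := mem_image.mp hy'
    rcases mem_union.mp hy with hy | hy
    · exact (hcon z hz).2 hy
    · obtain ⟨z', hz', h3⟩ := mem_image.mp hy
      have h4 : z' = z + h := by grind
      exact (hcon z hz).1 (h4 ▸ hz')
  have h3 : (U ∪ U.image (· + h)) ∪ U.image (· + 2 * h) ⊆ range (w + 2 * h) := by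
    intro y hy
    simp only [mem_union, mem_image] at hy
    rw [mem_range]
    rcases hy with (hy | ⟨z, hz, rfl⟩) | ⟨z, hz, rfl⟩
    · have := mem_range.mp (hU hy)
      lia
    · have := mem_range.mp (hU hz)
      lia
    · have := mem_range.mp (hU hz)
      lia
  have h4 := card_le_card h3
  rw [card_union_of_disjoint h2, card_union_of_disjoint h1,
    card_image_of_injective _ (add_left_injective h),
    card_image_of_injective _ (add_left_injective (2 * h)), card_range] at h4
  lia

/-- Three functions whose averages along short progressions of difference `2` are almost `1 / 2`
have many weighted solutions. -/
theorem sq_le_sum_sum_mul {k : ℕ} (hk : 0 < k) {a b c : ℕ → ℝ} (ha : ∀ x, 0 ≤ a x)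
    (ha1 : ∀ x, a x ≤ 1) (hb : ∀ x, 0 ≤ b x) (hb1 : ∀ x, b x ≤ 1) (hc : ∀ x, 0 ≤ c x)
    (hc1 : ∀ x, c x ≤ 1)
    (hab : ∀ x m, x + 2 * m ≤ 220 * k → 49 / 100 * m - k / 50 ≤ ∑ h ∈ range m, a (x + 2 * h))
    (hbb : ∀ x m, x + 2 * m ≤ 220 * k → 49 / 100 * m - k / 50 ≤ ∑ h ∈ range m, b (x + 2 * h))
    (hcb : ∀ x m, x + 2 * m ≤ 220 * k → 49 / 100 * m - k / 50 ≤ ∑ h ∈ range m, c (x + 2 * h)) :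
    (k : ℝ) ^ 2 ≤ ∑ x ∈ range (200 * k), ∑ z ∈ range (10 * k), a x * b z * c (x + z) := by
  have hk' : (0 : ℝ) < k := by exact_mod_cast hk
  have interval : ∀ f : ℕ → ℝ, (∀ x m, x + 2 * m ≤ 220 * k →
      49 / 100 * m - k / 50 ≤ ∑ h ∈ range m, f (x + 2 * h)) → ∀ x m, x + 2 * m + 1 ≤ 220 * k →
      98 / 100 * m - k / 25 ≤ ∑ y ∈ range (2 * m), f (x + y) := by
    intro f hf x m hxm
    rw [sum_range_two_mul fun y => f (x + y)]
    have h1 := hf x m (by lia)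
    have h2 := hf (x + 1) m (by lia)
    simp only [← add_assoc]
    linarith
  by_contra! hlt
  set s : ℕ → ℝ := fun z => ∑ x ∈ range (200 * k), a x * c (x + z) with hs
  have hs0 : ∀ z, 0 ≤ s z := fun z => sum_nonneg fun x _ => mul_nonneg (ha x) (hc _)
  have htot : ∑ z ∈ range (10 * k), b z * s z < (k : ℝ) ^ 2 := by
    refine lt_of_eq_of_lt ?_ hlt
    rw [sum_comm]
    refine sum_congr rfl fun z _ => ?_
    rw [hs, mul_sum]
    exact sum_congr rfl fun x _ => by ring
  set U := {z ∈ range (10 * k) | s z ≤ 2 * k} with hU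
  have hUc : (4 * k : ℝ) < #U := by
    have h1 : ∑ z ∈ range (10 * k), b z * s z ≥ 2 * k * ∑ z ∈ range (10 * k) with ¬ s z ≤ 2 * k,
        b z := by
      rw [mul_sum]
      refine le_trans (sum_le_sum fun z hz => ?_) (sum_le_sum_of_subset_of_nonneg
        (filter_subset (fun z => ¬ s z ≤ 2 * k) _) fun z _ _ => mul_nonneg (hb z) (hs0 z))
      rw [mul_comm]
      exact mul_le_mul_of_nonneg_left (not_le.mp (mem_filter.mp hz).2).le (hb z)
    have h2 : ∑ z ∈ range (10 * k) with ¬ s z ≤ 2 * k, b z < k / 2 := by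
      by_contra h
      have h := not_lt.mp h
      nlinarith
    have h3 : ∑ z ∈ U, b z ≤ #U := by
      refine (sum_le_card_nsmul _ _ 1 fun z _ => hb1 z).trans (by simp)
    have h4 := sum_filter_add_sum_filter_not (range (10 * k)) (fun z => s z ≤ 2 * k) b
    have h5 := interval b hbb 0 (5 * k) (by lia)
    simp only [zero_add] at h5
    rw [← mul_assoc, show 2 * 5 = 10 from rfl] at h5
    push_cast at h5
    linarith
  have hnear : ∀ z ∈ U, ∑ x ∈ range (200 * k), |c (x + z) - (1 - a x)| ≤ 808 / 100 * k := by
    intro z hz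
    have hz1 := (mem_filter.mp hz)
    have hz2 := mem_range.mp hz1.1
    have h1 := interval a hab 0 (100 * k) (by lia)
    have h2 := interval c hcb z (100 * k) (by lia)
    have h3 : ∑ x ∈ range (200 * k), |c (x + z) - (1 - a x)| ≤
        ∑ x ∈ range (200 * k), (1 - a x - c (x + z) + 2 * (a x * c (x + z))) :=
      sum_le_sum fun x _ => abs_sub_one_sub_le (ha x) (ha1 x) (hc _) (hc1 _)
    rw [sum_add_distrib, sum_sub_distrib, sum_sub_distrib, ← mul_sum, sum_const, card_range,
      nsmul_eq_mul, mul_one] at h3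
    simp only [zero_add, add_comm z] at h1 h2
    rw [← mul_assoc, show 2 * 100 = 200 from rfl] at h1 h2
    push_cast at h1 h2 h3
    have h4 := hz1.2
    rw [hs] at h4
    linarith
  have hpair : ∀ z ∈ U, ∀ z' ∈ U, ∑ x ∈ range (200 * k), |c (x + z) - c (x + z')| ≤
      1616 / 100 * k := by
    intro z hz z' hz'
    have h1 := hnear z hz
    have h2 := hnear z' hz'
    have h3 : ∑ x ∈ range (200 * k), |c (x + z) - c (x + z')| ≤ ∑ x ∈ range (200 * k),
        (|c (x + z) - (1 - a x)| + |c (x + z') - (1 - a x)|) := sum_le_sum fun x _ => by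
      rw [abs_sub_comm (c (x + z'))]
      exact abs_sub_le _ _ _
    rw [sum_add_distrib] at h3
    linarith
  have hshift : ∀ z ∈ U, ∀ d, z + d ∈ U → ∀ y n, 10 * k ≤ y → y + n ≤ 200 * k →
      ∑ x ∈ range n, |c (y + x) - c (y + x + d)| ≤ 1616 / 100 * k := by
    intro z hz d hd y n hy hn
    have hz2 := mem_range.mp (mem_filter.mp hz).1
    refine le_trans ?_ (hpair z hz (z + d) hd)
    have h1 : ∑ x ∈ range n, |c (y + x) - c (y + x + d)| =
        ∑ x ∈ (range n).map (addLeftEmbedding (y - z)), |c (x + z) - c (x + (z + d))| := by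
      rw [sum_map]
      refine sum_congr rfl fun x _ => ?_
      rw [addLeftEmbedding_apply, show y - z + x + z = y + x by lia,
        show y - z + x + (z + d) = y + x + d by lia]
    rw [h1]
    refine sum_le_sum_of_subset_of_nonneg (fun x hx => ?_) fun x _ _ => abs_nonneg _
    obtain ⟨x', hx', rfl⟩ := mem_map.mp hx
    rw [mem_range, addLeftEmbedding_apply]
    have := mem_range.mp hx'
    lia
  have htwo : ∀ h < k, ∀ y n, 10 * k ≤ y → y + n ≤ 199 * k →
      ∑ x ∈ range n, |c (y + x) - c (y + x + 2 * h)| ≤ 3232 / 100 * k := by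
    intro h hh y n hy hn
    have hUc' : 4 * k < #U := by exact_mod_cast hUc
    obtain ⟨z, hz, hz1 | hz1⟩ := exists_mem_add_mem (U := U) (h := h) (filter_subset _ _)
      (by lia)
    · have h1 := hshift z hz h hz1 y n hy (by lia)
      have h2 := hshift z hz h hz1 (y + h) n (by lia) (by lia)
      have h3 : ∑ x ∈ range n, |c (y + x) - c (y + x + 2 * h)| ≤ ∑ x ∈ range n,
          (|c (y + x) - c (y + x + h)| + |c (y + h + x) - c (y + h + x + h)|) :=
        sum_le_sum fun x _ => by
          rw [show y + x + 2 * h = y + h + x + h by lia, show y + x + h = y + h + x by lia]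
          exact abs_sub_le _ _ _
      rw [sum_add_distrib] at h3
      linarith
    · have h1 := hshift z hz (2 * h) hz1 y n hy (by lia)
      linarith
  obtain ⟨z, hz⟩ : U.Nonempty := by
    rw [← card_pos]
    have : (0 : ℝ) < #U := by linarith
    exact_mod_cast this
  have hz1 := (mem_filter.mp hz)
  have hz2 := mem_range.mp hz1.1
  set A := ∑ x ∈ range (170 * k), a (10 * k + x) with hA
  have hA1 : 8326 / 100 * k ≤ A := by
    have h1 := interval a hab (10 * k) (85 * k) (by lia)
    rw [← mul_assoc, show 2 * 85 = 170 from rfl] at h1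
    push_cast at h1
    linarith
  set T := ∑ x ∈ range (170 * k), a (10 * k + x) * c (10 * k + z + x) with hT
  have hTs : T ≤ 2 * k := by
    refine le_trans ?_ hz1.2
    have h1 : T = ∑ x ∈ (range (170 * k)).map (addLeftEmbedding (10 * k)), a x * c (x + z) := by
      rw [sum_map]
      refine sum_congr rfl fun x _ => ?_
      rw [addLeftEmbedding_apply, show 10 * k + x + z = 10 * k + z + x by lia]
    rw [h1]
    refine sum_le_sum_of_subset_of_nonneg (fun x hx => ?_) fun x _ _ => mul_nonneg (ha x) (hc _)
    obtain ⟨x', hx', rfl⟩ := mem_map.mp hx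
    rw [mem_range, addLeftEmbedding_apply]
    have := mem_range.mp hx'
    lia
  have hlow : ∑ h ∈ range k, ∑ x ∈ range (170 * k), a (10 * k + x) *
      c (10 * k + z + x + 2 * h) ≤ ∑ h ∈ range k, (T + 3232 / 100 * k) := by
    refine sum_le_sum fun h hh => ?_
    have h1 := htwo h (mem_range.mp hh) (10 * k + z) (170 * k) (by lia) (by lia)
    rw [hT, ← sub_le_iff_le_add', ← sum_sub_distrib]
    refine (sum_le_sum fun x _ => ?_).trans h1
    rw [← mul_sub, abs_sub_comm]
    exact (mul_le_mul_of_nonneg_left (le_abs_self _) (ha _)).trans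
      (mul_le_of_le_one_left (abs_nonneg _) (ha1 _))
  rw [sum_const, card_range, nsmul_eq_mul, sum_comm] at hlow
  have hup : A * (47 / 100 * k) ≤ ∑ x ∈ range (170 * k), ∑ h ∈ range k, a (10 * k + x) *
      c (10 * k + z + x + 2 * h) := by
    rw [hA, sum_mul]
    refine sum_le_sum fun x hx => ?_
    have hx' := mem_range.mp hx
    rw [← mul_sum]
    refine mul_le_mul_of_nonneg_left ?_ (ha _)
    have h1 := hcb (10 * k + z + x) k (by lia)
    linarith
  nlinarith [mul_le_mul_of_nonneg_left hTs hk'.le, mul_le_mul_of_nonneg_right hA1 hk'.le]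

end PrimeSum

namespace PrimeSum
open Finset ZMod

/-- Smoothing preserves lower bounds for sums along progressions. -/
lemma le_sum_cv {M : ℕ} [NeZero M] {f l : ZMod M → ℝ} {E : ℝ} {D B : ℕ} (hl : ∀ x, 0 ≤ l x)
    (hl1 : ∑ x, l x = 1) (hls : ∀ x, l x ≠ 0 → ∃ d : ℤ, x = d ∧ |(d : ℝ)| ≤ D)
    (hf : ∀ x m : ℕ, x + 2 * m ≤ B → m - E ≤ ∑ h ∈ range m, f ((x + 2 * h : ℕ) : ZMod M))
    {x m : ℕ} (hx : D ≤ x) (hxm : x + 2 * m + D ≤ B) :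
    m - E ≤ ∑ h ∈ range m, cv f l ((x + 2 * h : ℕ) : ZMod M) := by
  simp only [cv_comm f l]
  unfold cv
  rw [sum_comm, ← one_mul ((m : ℝ) - E), ← hl1, sum_mul]
  refine sum_le_sum fun y _ => ?_
  rw [← mul_sum]
  rcases eq_or_ne (l y) 0 with h | h
  · simp [h]
  refine mul_le_mul_of_nonneg_left ?_ (hl y)
  obtain ⟨d, rfl, hd⟩ := hls y h
  have hd' : |d| ≤ D := by exact_mod_cast hd
  rw [abs_le] at hd'
  have h1 := hf (x - d).toNat m (by lia)
  refine h1.trans (le_of_eq (sum_congr rfl fun h _ => ?_))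
  congr 1
  have h2 : (((x - d).toNat + 2 * h : ℕ) : ℤ) = ((x + 2 * h : ℕ) : ℤ) - d := by
    push_cast
    rw [Int.toNat_of_nonneg (by lia)]
    ring
  have h3 := congrArg (Int.cast : ℤ → ZMod M) h2
  push_cast at h3 ⊢
  exact h3

/-- A sum over a rectangle is at most the corresponding double convolution. -/
lemma sum_sum_le_cv_cv {M : ℕ} [NeZero M] {f g h : ZMod M → ℝ} (hf : ∀ x, 0 ≤ f x)
    (hg : ∀ x, 0 ≤ g x) (hh : ∀ x, 0 ≤ h x) (t : ZMod M) (x₀ z₀ : ℕ) {n w : ℕ} (hn : n ≤ M)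
    (hw : w ≤ M) :
    ∑ x ∈ range n, ∑ z ∈ range w, f ((x₀ + x : ℕ) : ZMod M) * g ((z₀ + z : ℕ) : ZMod M) *
      h (t - ((x₀ + x : ℕ) : ZMod M) - ((z₀ + z : ℕ) : ZMod M)) ≤ cv f (cv g h) t := by
  have key : ∀ (F : ZMod M → ℝ), (∀ x, 0 ≤ F x) → ∀ a m : ℕ, m ≤ M →
      ∑ x ∈ range m, F ((a + x : ℕ) : ZMod M) ≤ ∑ x, F x := fun F hF a m hm => by
    have hinj : Set.InjOn (fun x : ℕ => ((a + x : ℕ) : ZMod M)) (range m : Finset ℕ) := by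
      intro x hx y hy hxy
      rw [mem_coe, mem_range] at hx hy
      have h1 : ((x : ℕ) : ZMod M) = y := by
        have : ((a : ZMod M) + x) = a + y := by exact_mod_cast hxy
        exact add_left_cancel this
      rw [ZMod.natCast_eq_natCast_iff'] at h1
      rwa [Nat.mod_eq_of_lt (hx.trans_le hm), Nat.mod_eq_of_lt (hy.trans_le hm)] at h1
    rw [← sum_image hinj (f := F)]
    exact sum_le_sum_of_subset_of_nonneg (subset_univ _) fun x _ _ => hF x
  refine le_trans (sum_le_sum fun x _ => ?_)
    (key (fun x => f x * cv g h (t - x)) (fun x => mul_nonneg (hf x) (cv_nonneg hg hh _)) x₀ n hn)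
  simp only [mul_assoc]
  rw [← mul_sum]
  refine mul_le_mul_of_nonneg_left ?_ (hf _)
  exact key (fun z => g z * h (t - ((x₀ + x : ℕ) : ZMod M) - z))
    (fun z => mul_nonneg (hg _) (hh _)) z₀ w hw

/-- Dominated functions with the expected averages along progressions of difference `2`
represent every element near the centre of their threefold sumset. -/
theorem exists_add_add_eq {A : ℝ} (hA : 1 ≤ A) :
    ∃ (J₀ : ℕ) (c : ℝ), 0 < c ∧ ∀ J ≥ J₀, ∀ k > 0, ∀ [NeZero (3000 * k)]
      (f : Fin 3 → ZMod (3000 * k) → ℝ) (θ τ F : ℝ) (j₁ t : ℕ), 1 ≤ θ → θ ^ 4 ≤ 3 / 2 → 0 ≤ τ →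
      (∀ i, Dominated (f i) A (201 / 100) θ τ J) → (∀ i x, f i x ≤ F) → 1 ≤ F → τ ≤ c →
      12 * A * 6 ^ j₁ * τ ≤ 1 → F * (1 / 2) ^ j₁ ≤ c → 1500 * k ≤ t → t < 1500 * k + 3 →
      (∀ i, ∀ x m : ℕ, x + 2 * m ≤ 1000 * k → (m : ℝ) - k / 50 ≤
        ∑ h ∈ range m, f i ((x + 2 * h : ℕ) : ZMod (3000 * k))) →
      ∃ x y z, f 0 x ≠ 0 ∧ f 1 y ≠ 0 ∧ f 2 z ≠ 0 ∧ x + y + z = t := by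
  obtain ⟨J₀, c, hc, key⟩ := exists_dense_model hA (ε := 1 / 10 ^ 7) (by norm_num)
  refine ⟨J₀, c, hc, ?_⟩
  intro J hJ k hk _ f θ τ F j₁ t hθ hθ4 hτ hf hF hF1 hτc hj₁ hFc ht ht3 hblock
  obtain ⟨l, hl, hl1, hls, hgK, hdiff⟩ := key J hJ (3000 * k) f (201 / 100) θ τ F j₁ t
    (by norm_num) (by norm_num) hθ hθ4 hτ hf hF hF1 hτc hj₁ hFc
  have hk' : (1 : ℝ) ≤ k := by exact_mod_cast hk
  set K : ℝ := 201 / 100 * (1 + 1 / 10 ^ 7) with hK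
  have hK2 : 2 ≤ K := by rw [hK]; norm_num
  have hK49 : K ≤ 100 / 49 := by rw [hK]; norm_num
  have hK0 : 0 < K := by linarith
  have hg0 : ∀ i x, 0 ≤ cv (f i) l x := fun i => cv_nonneg (hf i).nonneg hl
  have hgb : ∀ i, ∀ x m : ℕ, 100 * k ≤ x → x + 2 * m ≤ 900 * k →
      49 / 100 * (m : ℝ) - k / 50 ≤ ∑ h ∈ range m, cv (f i) l ((x + 2 * h : ℕ) : ZMod _) / K := by
    intro i x m hx hxm
    have h1 : ((m : ℝ) - k / 50) ≤ ∑ h ∈ range m, cv (f i) l ((x + 2 * h : ℕ) : ZMod _) := by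
      refine le_sum_cv (D := 100 * k) (B := 1000 * k) hl hl1 (fun y hy => ?_) (hblock i) hx
        (by lia)
      obtain ⟨d, hd, hd'⟩ := hls y hy
      refine ⟨d, hd, hd'.trans ?_⟩
      push_cast
      linarith
    rw [← sum_div, le_div_iff₀ hK0]
    nlinarith [Nat.cast_nonneg (α := ℝ) m]
  have ha1 : ∀ i x, cv (f i) l x / K ≤ 1 := fun i x => (div_le_one hK0).2 (hgK i x)
  have hcomb := sq_le_sum_sum_mul hk
    (a := fun x => cv (f 0) l ((400 * k + x : ℕ) : ZMod _) / K)
    (b := fun x => cv (f 1) l ((400 * k + x : ℕ) : ZMod _) / K)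
    (c := fun x => cv (f 2) l ((t : ZMod (3000 * k)) - (800 * k + x : ℕ)) / K)
    (fun _ => div_nonneg (hg0 _ _) hK0.le) (fun _ => ha1 _ _)
    (fun _ => div_nonneg (hg0 _ _) hK0.le) (fun _ => ha1 _ _)
    (fun _ => div_nonneg (hg0 _ _) hK0.le) (fun _ => ha1 _ _)
    (fun x m hxm => by
      simp only [← add_assoc]
      exact hgb 0 (400 * k + x) m (by lia) (by lia))
    (fun x m hxm => by
      simp only [← add_assoc]
      exact hgb 1 (400 * k + x) m (by lia) (by lia))
    (fun x m hxm => by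
      rw [← sum_range_reflect]
      rcases Nat.eq_zero_or_pos m with rfl | hm
      · simpa using div_nonneg (Nat.cast_nonneg (α := ℝ) k) (by norm_num : (0 : ℝ) ≤ 50)
      refine (hgb 2 (t - 800 * k - x - 2 * (m - 1)) m (by lia) (by lia)).trans
        (le_of_eq (sum_congr rfl fun h hh => ?_))
      have := mem_range.mp hh
      congr 2
      rw [eq_sub_iff_add_eq]
      norm_cast
      congr 1
      lia)
  have hle := sum_sum_le_cv_cv (hg0 0) (hg0 1) (hg0 2) (t : ZMod (3000 * k)) (400 * k) (400 * k)
    (n := 200 * k) (w := 10 * k) (by lia) (by lia)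
  have h8 : 8 * (k : ℝ) ^ 2 ≤ cv (cv (f 0) l) (cv (cv (f 1) l) (cv (f 2) l)) t := by
    refine le_trans ?_ hle
    have h9 : K ^ 3 * (k : ℝ) ^ 2 ≤ _ := mul_le_mul_of_nonneg_left hcomb (by positivity)
    have h10 : (8 : ℝ) ≤ K ^ 3 := by
      have := pow_le_pow_left₀ (by norm_num) hK2 3
      linarith
    refine le_trans (mul_le_mul_of_nonneg_right h10 (by positivity)) (h9.trans (le_of_eq ?_))
    rw [mul_sum]
    refine sum_congr rfl fun x _ => ?_
    rw [mul_sum]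
    refine sum_congr rfl fun z _ => ?_
    have e : (t : ZMod (3000 * k)) - ((800 * k + (x + z) : ℕ) : ZMod (3000 * k)) =
        t - ((400 * k + x : ℕ) : ZMod (3000 * k)) - ((400 * k + z : ℕ) : ZMod (3000 * k)) := by
      push_cast
      ring
    rw [e]
    field_simp
  have hpos : 0 < cv (f 0) (cv (f 1) (f 2)) (t : ZMod (3000 * k)) := by
    have := (abs_le.mp hdiff).1
    push_cast at this
    nlinarith
  obtain ⟨x, -, hx⟩ := exists_ne_zero_of_sum_ne_zero hpos.ne'
  obtain ⟨y, -, hy⟩ := exists_ne_zero_of_sum_ne_zero (right_ne_zero_of_mul hx)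
  exact ⟨x, y, t - x - y, left_ne_zero_of_mul hx, left_ne_zero_of_mul hy,
    right_ne_zero_of_mul hy, by ring⟩

end PrimeSum

namespace PrimeSum
open Finset ZMod

/-- Lower bounds for primes in progressions are uniform over the residue classes. -/
lemma exists_le_sum_log_prime_uniform {q : ℕ} (hq : 0 < q) {δ : ℝ} (hδ : 0 < δ) :
    ∃ N₀ : ℕ, ∀ N ≥ N₀, ∀ b x y : ℕ, b.Coprime q → x ≤ y → y ≤ N →
      ((y : ℝ) - x) / q.totient - δ * N ≤
        ∑ k ∈ Ioc x y with k.Prime ∧ k ≡ b [MOD q], Real.log k := by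
  have h : ∀ b, ∃ N₀ : ℕ, b.Coprime q → ∀ N ≥ N₀, ∀ x y : ℕ, x ≤ y → y ≤ N →
      ((y : ℝ) - x) / q.totient - δ * N ≤
        ∑ k ∈ Ioc x y with k.Prime ∧ k ≡ b [MOD q], Real.log k := fun b => by
    by_cases hb : b.Coprime q
    · obtain ⟨N₀, h⟩ := exists_le_sum_log_prime hq hb hδ
      exact ⟨N₀, fun _ => h⟩
    · exact ⟨0, fun h => absurd h hb⟩
  choose N₀ hN₀ using h
  refine ⟨(range q).sup N₀, fun N hN b x y hb hxy hy => ?_⟩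
  have h1 := hN₀ (b % q) ((Nat.mod_modEq b q).gcd_eq.trans hb) N
    ((le_sup (mem_range.mpr (Nat.mod_lt b hq))).trans hN) x y hxy hy
  have h2 : ∀ k, k ≡ b % q [MOD q] ↔ k ≡ b [MOD q] := fun k => by
    simp [Nat.ModEq]
  simpa only [h2] using h1

/-- The normalised indicator of the primes in a segment of a residue class. -/
noncomputable def primeWeight (N W L m₀ b M : ℕ) (x : ZMod M) : ℝ :=
  if x.val < L ∧ (W * (m₀ + x.val) + b).Prime then (W.totient : ℝ) / W * Real.log N else 0

lemma sum_zmod_eq_sum_range {M : ℕ} [NeZero M] {β : Type*} [AddCommMonoid β] (F : ℕ → β) :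
    ∑ x : ZMod M, F x.val = ∑ x ∈ range M, F x := by
  refine sum_nbij' (fun x => x.val) (fun n => (n : ZMod M)) (fun x _ => ?_) (fun _ _ => mem_univ _)
    (fun x _ => by simp) (fun n hn => ?_) (fun _ _ => rfl)
  · exact mem_range.mpr (val_lt x)
  · exact val_cast_of_lt (mem_range.mp hn)

lemma primeWeight_nonneg (N W L m₀ b M : ℕ) (x : ZMod M) : 0 ≤ primeWeight N W L m₀ b M x := by
  unfold primeWeight
  split_ifs
  · exact mul_nonneg (by positivity) (Real.log_natCast_nonneg _)
  · exact le_rfl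

lemma primeWeight_le (N W L m₀ b M : ℕ) (x : ZMod M) :
    primeWeight N W L m₀ b M x ≤ Real.log N := by
  unfold primeWeight
  split_ifs
  · refine mul_le_of_le_one_left (Real.log_natCast_nonneg _) (div_le_one_of_le₀ ?_ (by positivity))
    exact_mod_cast Nat.totient_le W
  · exact Real.log_natCast_nonneg _

lemma dominated_primeWeight {N W J k m₀ b R : ℕ} {κ : ℝ} [NeZero (3000 * k)]
    (hLN : 1000 * k ≤ N) (hR : R < W * m₀) (hτ : (N : ℝ) ^ (1 - κ) / (3000 * k) ≤ 1)
    (hmaj : ∀ m ≥ J, ∃ ν : ℕ → ℝ, (∀ n, 0 ≤ ν n) ∧ (∀ p : ℕ, p.Prime → R < p →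
      (W.totient : ℝ) / W * Real.log N ≤ (2 + 1 / 100) * (11 / 10) ^ (m - J) * ν p) ∧
      ∀ (b L : ℕ) (α : ℝ), L ≤ N → ‖∑ x ∈ range L, ((ν (W * x + b) - 1 : ℝ) : ℂ) * ee (x * α)‖ ≤
        8 * (L / 2 ^ m) + (N : ℝ) ^ (1 - κ)) :
    Dominated (primeWeight N W (1000 * k) m₀ b (3000 * k)) 18 (201 / 100) (11 / 10)
      ((N : ℝ) ^ (1 - κ) / (3000 * k)) J := by
  have hk : 0 < k := by
    have := NeZero.pos (3000 * k)
    lia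
  have hk' : (0 : ℝ) < k := by exact_mod_cast hk
  have hM : ((3000 * k : ℕ) : ℝ) = 3000 * k := by push_cast; rfl
  have maj : ∀ i : ℕ, ∃ V u : ZMod (3000 * k) → ℝ,
      (∀ x, primeWeight N W (1000 * k) m₀ b (3000 * k) x ≤ 201 / 100 * (11 / 10) ^ i * V x) ∧
      (∀ x, u x ≤ 1) ∧ ∀ r, ‖ft V r - ft u r‖ ≤
        (3000 * k : ℕ) * (4 / 2 ^ (J + i) + (N : ℝ) ^ (1 - κ) / (3000 * k)) := by
    intro i
    obtain ⟨ν, hν0, hν1, hν2⟩ := hmaj (J + i) (Nat.le_add_right _ _)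
    rw [Nat.add_sub_cancel_left] at hν1
    refine ⟨fun x => if x.val < 1000 * k then ν (W * (m₀ + x.val) + b) else 0,
      fun x => if x.val < 1000 * k then 1 else 0, fun x => ?_, fun x => ?_, fun r => ?_⟩
    · unfold primeWeight
      by_cases h1 : x.val < 1000 * k ∧ (W * (m₀ + x.val) + b).Prime
      · rw [if_pos h1]
        dsimp only
        rw [if_pos h1.1]
        refine (hν1 _ h1.2 ?_).trans (le_of_eq (by norm_num))
        have : W * m₀ ≤ W * (m₀ + x.val) := by gcongr; lia
        lia
      · rw [if_neg h1]
        refine mul_nonneg (by positivity) ?_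
        dsimp only
        split_ifs
        exacts [hν0 _, le_rfl]
    · dsimp only
      split_ifs <;> norm_num
    · have h1 := hν2 (W * m₀ + b) (1000 * k) (r.val / (3000 * k : ℕ)) hLN
      have h2 : ft (fun x : ZMod (3000 * k) =>
          if x.val < 1000 * k then ν (W * (m₀ + x.val) + b) else 0) r -
          ft (fun x => if x.val < 1000 * k then 1 else 0) r = ∑ x ∈ range (1000 * k),
          ((ν (W * x + (W * m₀ + b)) - 1 : ℝ) : ℂ) * ee (x * (r.val / (3000 * k : ℕ))) := by
        unfold ft
        rw [← sum_sub_distrib]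
        have h3 : ∀ x : ZMod (3000 * k), stdAddChar (r * x) =
            ee (x.val * (r.val / (3000 * k : ℕ))) := fun x => by
          have h4 := stdAddChar_intCast (M := 3000 * k) ((r.val * x.val : ℕ) : ℤ)
          have h5 : (((r.val * x.val : ℕ) : ℤ) : ZMod (3000 * k)) = r * x := by
            push_cast
            simp
          rw [h5] at h4
          rw [h4]
          congr 1
          push_cast
          ring
        have h6 : ∀ x : ZMod (3000 * k),
            ((if x.val < 1000 * k then ν (W * (m₀ + x.val) + b) else 0 : ℝ) : ℂ) *
              stdAddChar (r * x) - ((if x.val < 1000 * k then 1 else 0 : ℝ) : ℂ) *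
              stdAddChar (r * x) = (fun n : ℕ => if n < 1000 * k then
                ((ν (W * n + (W * m₀ + b)) - 1 : ℝ) : ℂ) * ee (n * (r.val / (3000 * k : ℕ)))
                else 0) x.val := fun x => by
          rw [h3]
          dsimp only
          split_ifs
          · rw [show W * (m₀ + x.val) + b = W * x.val + (W * m₀ + b) by ring]
            push_cast
            ring
          · simp
        rw [sum_congr rfl fun x _ => h6 x, sum_zmod_eq_sum_range (fun n : ℕ =>
          if n < 1000 * k then ((ν (W * n + (W * m₀ + b)) - 1 : ℝ) : ℂ) *
            ee (n * (r.val / (3000 * k : ℕ))) else 0), ← sum_filter]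
        refine sum_congr (ext fun n => ?_) fun _ _ => rfl
        simp only [mem_filter, mem_range]
        lia
      rw [h2]
      refine h1.trans ?_
      rw [hM, mul_add, mul_div_cancel₀ _ (by positivity)]
      push_cast
      have h7 : (0 : ℝ) < 2 ^ (J + i) := by positivity
      have h8 : 8 * (1000 * (k : ℝ) / 2 ^ (J + i)) ≤ 3000 * k * (4 / 2 ^ (J + i)) := by
        rw [div_eq_mul_inv, div_eq_mul_inv]
        nlinarith [mul_pos hk' (inv_pos.mpr h7)]
      linarith
  refine ⟨primeWeight_nonneg _ _ _ _ _ _, ?_, maj⟩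
  obtain ⟨V, u, h1, h2, h3⟩ := maj 0
  have h4 : ∀ w : ZMod (3000 * k) → ℝ, ft w 0 = ((∑ x, w x : ℝ) : ℂ) := fun w => by
    unfold ft
    simp
  have h5 := h3 0
  rw [h4, h4, ← Complex.ofReal_sub, Complex.norm_real] at h5
  have h6 := (Real.le_norm_self _).trans h5
  have h7 : ∑ x, u x ≤ (3000 * k : ℕ) :=
    (sum_le_card_nsmul _ _ 1 fun x _ => h2 x).trans (by simp [ZMod.card])
  have h8 : ∑ x, primeWeight N W (1000 * k) m₀ b (3000 * k) x ≤ 201 / 100 * ∑ x, V x := by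
    rw [mul_sum]
    exact sum_le_sum fun x _ => by simpa using h1 x
  have h9 : (4 : ℝ) / 2 ^ (J + 0) ≤ 4 := div_le_self (by norm_num) (one_le_pow₀ (by norm_num))
  have h10 : ((3000 * k : ℕ) : ℝ) * (4 / 2 ^ (J + 0) + (N : ℝ) ^ (1 - κ) / (3000 * k)) ≤
      (3000 * k : ℕ) * (4 + 1) := by gcongr
  rw [hM] at *
  linarith

lemma le_sum_primeWeight {N W k m₀ b : ℕ} {δ : ℝ} (hW : Even W) (hW0 : 0 < W)
    (hb : b.Coprime W) (hN : W * (m₀ + 1000 * k) + b ≤ N) (hδ : δ * N ≤ k / 50)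
    (hpr : ∀ b x y : ℕ, b.Coprime (2 * W) → x ≤ y → y ≤ N →
      ((y : ℝ) - x) / (2 * W).totient - δ * N ≤
        ∑ k ∈ Ioc x y with k.Prime ∧ k ≡ b [MOD 2 * W], Real.log k) {x m : ℕ}
    (hxm : x + 2 * m ≤ 1000 * k) :
    (m : ℝ) - k / 50 ≤ ∑ h ∈ range m,
      primeWeight N W (1000 * k) m₀ b (3000 * k) ((x + 2 * h : ℕ) : ZMod (3000 * k)) := by
  have hk : 0 < k ∨ m = 0 := by lia
  rcases hk with hk | rfl
  swap
  · simpa using div_nonneg (Nat.cast_nonneg (α := ℝ) k) (by norm_num : (0 : ℝ) ≤ 50)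
  have hb0 : 0 < b := by
    rcases Nat.eq_zero_or_pos b with rfl | h
    · rw [Nat.coprime_zero_left] at hb
      subst hb
      exact absurd hW (by decide)
    · exact h
  have hlog : 0 ≤ Real.log N := Real.log_natCast_nonneg _
  have hW' : (0 : ℝ) < W := by exact_mod_cast hW0
  have hφ : (0 : ℝ) < W.totient := by exact_mod_cast Nat.totient_pos.mpr hW0
  set B := W * (m₀ + x) + b with hB
  have hBW : B.Coprime W := by rwa [hB, Nat.coprime_mul_left_add_left]
  have hle : W * (m₀ + (x + 2 * m)) ≤ W * (m₀ + 1000 * k) := by gcongr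
  have hexp : W * (m₀ + (x + 2 * m)) + b = B + 2 * W * m := by rw [hB]; ring
  have h1 := hpr B (B - 1) (B - 1 + 2 * W * m)
    (Nat.Coprime.mul_right (Nat.Coprime.coprime_dvd_right hW.two_dvd hBW) hBW)
    (Nat.le_add_right _ _) (by lia)
  set P := {h ∈ range m | (B + 2 * W * h).Prime} with hP
  have h2 : ∑ k ∈ Ioc (B - 1) (B - 1 + 2 * W * m) with k.Prime ∧ k ≡ B [MOD 2 * W],
      Real.log k ≤ #P * Real.log N := by
    have hsub : {k ∈ Ioc (B - 1) (B - 1 + 2 * W * m) | k.Prime ∧ k ≡ B [MOD 2 * W]} ⊆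
        P.image fun h => B + 2 * W * h := by
      intro n hn
      obtain ⟨hn1, hn2, hn3⟩ := mem_filter.mp hn
      rw [mem_Ioc] at hn1
      obtain ⟨h, hh⟩ := (Nat.modEq_iff_dvd' (by lia)).mp hn3.symm
      have hn4 : n = B + 2 * W * h := by lia
      refine mem_image.mpr ⟨h, mem_filter.mpr ⟨mem_range.mpr ?_, hn4 ▸ hn2⟩, hn4.symm⟩
      refine lt_of_mul_lt_mul_left (a := 2 * W) ?_ (Nat.zero_le _)
      lia
    have hbound : ∀ n ∈ {k ∈ Ioc (B - 1) (B - 1 + 2 * W * m) | k.Prime ∧ k ≡ B [MOD 2 * W]},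
        Real.log n ≤ Real.log N := fun n hn => by
      obtain ⟨hn1, hn2, -⟩ := mem_filter.mp hn
      rw [mem_Ioc] at hn1
      refine Real.log_le_log (by exact_mod_cast hn2.pos) ?_
      have : n ≤ N := by lia
      exact_mod_cast this
    refine (sum_le_card_nsmul _ _ _ hbound).trans ?_
    rw [nsmul_eq_mul]
    refine mul_le_mul_of_nonneg_right ?_ hlog
    exact_mod_cast (card_le_card hsub).trans card_image_le
  have h3 : ∑ h ∈ range m, primeWeight N W (1000 * k) m₀ b (3000 * k)
      ((x + 2 * h : ℕ) : ZMod (3000 * k)) = #P * ((W.totient : ℝ) / W * Real.log N) := by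
    rw [← nsmul_eq_mul, ← sum_const, hP, sum_filter]
    refine sum_congr rfl fun h hh => ?_
    have hh' := mem_range.mp hh
    unfold primeWeight
    rw [val_cast_of_lt (by lia), show W * (m₀ + (x + 2 * h)) + b = B + 2 * W * h by rw [hB]; ring]
    exact if_congr (and_iff_right (by lia)) rfl rfl
  rw [h3, Nat.totient_two_mul_of_even hW] at *
  have h4 := mul_le_mul_of_nonneg_left (h1.trans h2) (div_pos hφ hW').le
  have h5 : (W.totient : ℝ) / W * ((((B - 1 + 2 * W * m : ℕ) : ℝ) - ((B - 1 : ℕ) : ℝ)) /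
      ((2 * W.totient : ℕ) : ℝ) - δ * N) = m - W.totient / W * (δ * N) := by
    push_cast
    field_simp
    ring
  rw [h5] at h4
  have h6 : (W.totient : ℝ) / W * (δ * N) ≤ k / 50 := by
    have h7 : (W.totient : ℝ) / W ≤ 1 := div_le_one_of_le₀
      (by exact_mod_cast Nat.totient_le W) hW'.le
    calc _ ≤ (W.totient : ℝ) / W * (k / 50) := by gcongr
      _ ≤ _ := mul_le_of_le_one_left (by positivity) h7
  linarith

end PrimeSum

namespace PrimeSum
open Finset ZMod

/-- Every odd number is, modulo `W`, a sum of `1` and two residues coprime to `W`. -/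
lemma exists_coprime_add_modEq {W N : ℕ} (hW : 0 < W) (hN : Odd N) :
    ∃ b c : ℕ, b < W ∧ c < W ∧ b.Coprime W ∧ c.Coprime W ∧ 1 + b + c ≡ N [MOD W] := by
  have hp : ∀ p : ℕ, ∃ a : ℕ, p.Prime → ¬ p ∣ a ∧ ¬ (p : ℤ) ∣ N - 1 - a := by
    intro p
    by_cases hpN : (p : ℤ) ∣ N - 2
    · refine ⟨2, fun hp => ⟨fun h => ?_, fun h => hp.one_lt.ne' ?_⟩⟩
      · obtain rfl := (Nat.prime_dvd_prime_iff_eq hp Nat.prime_two).mp h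
        obtain ⟨r, hr⟩ := hN
        lia
      · have h1 := dvd_sub hpN h
        ring_nf at h1
        exact Nat.dvd_one.mp (by exact_mod_cast h1)
    · exact ⟨1, fun hp => ⟨hp.one_lt.ne' ∘ Nat.dvd_one.mp, fun h => hpN (by
        convert h using 1
        push_cast
        ring)⟩⟩
  choose a ha using hp
  obtain ⟨k, hk⟩ := Nat.chineseRemainderOfFinset a id W.primeFactors
    (fun p hp => (Nat.prime_of_mem_primeFactors hp).ne_zero) fun p hp q hq hpq =>
      (Nat.coprime_primes (Nat.prime_of_mem_primeFactors hp)
        (Nat.prime_of_mem_primeFactors hq)).mpr hpq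
  have hW' : (0 : ℤ) < W := by exact_mod_cast hW
  have hcast : ((((N - 1 - k : ℤ) % W).toNat : ℕ) : ℤ) = (N - 1 - k) % W :=
    Int.toNat_of_nonneg (Int.emod_nonneg _ hW'.ne')
  refine ⟨k % W, ((N - 1 - k : ℤ) % W).toNat, Nat.mod_lt _ hW, ?_, ?_, ?_, ?_⟩
  · have := Int.emod_lt_of_pos (N - 1 - k : ℤ) hW'
    lia
  · refine Nat.coprime_of_dvd fun p hp hpk hpW => (ha p hp).1 ?_
    rw [Nat.dvd_mod_iff hpW] at hpk
    exact ((hk p (Nat.mem_primeFactors.mpr ⟨hp, hpW, hW.ne'⟩)).dvd_iff dvd_rfl).mp hpk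
  · refine Nat.coprime_of_dvd fun p hp hpk hpW => (ha p hp).2 ?_
    have h1 : (p : ℤ) ∣ (N - 1 - k) % W := by
      rw [← hcast]
      exact_mod_cast hpk
    rw [EuclideanDomain.dvd_mod_iff (by exact_mod_cast hpW)] at h1
    have h2 : (p : ℤ) ∣ a p - k :=
      Nat.modEq_iff_dvd.mp (hk p (Nat.mem_primeFactors.mpr ⟨hp, hpW, hW.ne'⟩))
    have h4 : (N - 1 - k : ℤ) - (a p - k) = N - 1 - a p := by ring
    exact h4 ▸ dvd_sub h1 h2
  · rw [← Int.natCast_modEq_iff]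
    push_cast
    rw [hcast]
    calc (1 + k % W + (N - 1 - k) % W : ℤ) ≡ 1 + k + (N - 1 - k) [ZMOD W] :=
          ((Int.ModEq.refl 1).add (Int.mod_modEq _ _)).add (Int.mod_modEq _ _)
      _ = N := by ring

lemma eventually_exists_pow {κ c c₁ : ℝ} (hκ : 0 < κ) (hc : 0 < c) (hc₁ : 0 < c₁) :
    ∀ᶠ N : ℕ in atTop, ∀ k : ℝ, c₁ * N ≤ k → ∃ j₁ : ℕ, (N : ℝ) ^ (1 - κ) / (3000 * k) ≤ c ∧
      (N : ℝ) ^ (1 - κ) / (3000 * k) ≤ 1 ∧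
      12 * 18 * 6 ^ j₁ * ((N : ℝ) ^ (1 - κ) / (3000 * k)) ≤ 1 ∧
      Real.log N * (1 / 2) ^ j₁ ≤ c ∧ 1 ≤ Real.log N := by
  set c' := min c 1 with hc'
  have hc0 : 0 < c' := lt_min hc one_pos
  have h1 : ∀ᶠ N : ℕ in atTop, Real.log N ^ (3 : ℝ) ≤ 3000 * c₁ * c' ^ 3 / 1728 * (N : ℝ) ^ κ := by
    have h2 := ((isLittleO_log_rpow_rpow_atTop 3 hκ).bound
      (by positivity : 0 < 3000 * c₁ * c' ^ 3 / 1728))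
    filter_upwards [tendsto_natCast_atTop_atTop.eventually h2] with N hN
    refine (Real.le_norm_self _).trans (hN.trans_eq ?_)
    rw [Real.norm_of_nonneg (by positivity)]
  filter_upwards [h1, eventually_gt_atTop 0,
    (Real.tendsto_log_atTop.comp tendsto_natCast_atTop_atTop).eventually_ge_atTop 1]
    with N hN hN0 hlog k hk
  have hN0' : (0 : ℝ) < N := by exact_mod_cast hN0
  have hlog' : 1 ≤ Real.log N := hlog
  have hk0 : 0 < k := lt_of_lt_of_le (by positivity) hk
  have e3 : Real.log N ^ (3 : ℝ) = Real.log N ^ 3 := by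
    exact_mod_cast Real.rpow_natCast (Real.log N) 3
  rw [e3] at hN
  set τ := (N : ℝ) ^ (1 - κ) / (3000 * k) with hτ
  have hτ0 : 0 ≤ τ := by positivity
  have h3 : Real.log N ^ 3 * τ ≤ c' ^ 3 / 1728 := by
    have h4 : τ ≤ (N : ℝ) ^ (1 - κ) / (3000 * (c₁ * N)) := by
      rw [hτ]
      gcongr
    have h5 : (N : ℝ) ^ (1 - κ) / (3000 * (c₁ * N)) = 1 / (3000 * c₁ * (N : ℝ) ^ κ) := by
      rw [Real.rpow_sub hN0', Real.rpow_one]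
      field_simp
    calc _ ≤ (3000 * c₁ * c' ^ 3 / 1728 * (N : ℝ) ^ κ) * (1 / (3000 * c₁ * (N : ℝ) ^ κ)) :=
          mul_le_mul hN (h5 ▸ h4) hτ0 (by positivity)
      _ = _ := by field_simp
  have hτc : τ ≤ c' := by
    have h4 : τ ≤ Real.log N ^ 3 * τ := le_mul_of_one_le_left hτ0 (one_le_pow₀ hlog')
    have h5 : c' ^ 3 ≤ c' := pow_le_of_le_one hc0.le (min_le_right _ _) (by norm_num)
    linarith
  obtain ⟨j, hj, hj'⟩ := exists_nat_pow_near
    (x := Real.log N / c') (y := 2) (by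
      rw [one_le_div hc0]
      exact (min_le_right _ _).trans hlog') (by norm_num)
  refine ⟨j + 1, hτc.trans (min_le_left _ _), hτc.trans (min_le_right _ _), ?_, ?_, hlog'⟩
  · have h6 : (6 : ℝ) ^ (j + 1) ≤ 8 * (Real.log N / c') ^ 3 := by
      calc (6 : ℝ) ^ (j + 1) ≤ 8 ^ (j + 1) := by gcongr; norm_num
        _ = 8 * (2 ^ j) ^ 3 := by
            rw [pow_succ, ← pow_mul, mul_comm j, pow_mul]
            norm_num
            ring
        _ ≤ _ := by gcongr
    calc _ ≤ 12 * 18 * (8 * (Real.log N / c') ^ 3) * τ := by gcongr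
      _ = 1728 / c' ^ 3 * (Real.log N ^ 3 * τ) := by field_simp; ring
      _ ≤ 1728 / c' ^ 3 * (c' ^ 3 / 1728) := by gcongr
      _ = 1 := by field_simp
  · rw [div_lt_iff₀ hc0] at hj'
    rw [one_div_pow, mul_one_div, div_le_iff₀ (by positivity), mul_comm]
    exact hj'.le.trans (mul_le_mul_of_nonneg_left (min_le_left _ _) (by positivity))

/-- Every large odd number is the sum of three almost equal primes. -/
theorem exists_three_primes {ω : ℝ} (hω : 0 < ω) (hω1 : ω ≤ 1 / 100) :
    ∃ N₀ : ℕ, ∀ N ≥ N₀, Odd N → ∃ p q r : ℕ, p.Prime ∧ q.Prime ∧ r.Prime ∧ p + q + r = N ∧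
      (1 / 3 - ω) * N ≤ p ∧ (1 / 3 - ω) * N ≤ q ∧ (1 / 3 - ω) * N ≤ r := by
  obtain ⟨J₀, c, hc, hD⟩ := exists_add_add_eq (A := 18) (by norm_num)
  obtain ⟨κ, hκ, -, J₁, hB⟩ := exists_majorant (η := 1 / 100) (θ := 11 / 10) (by norm_num)
    (by norm_num)
  set J := max (max J₀ J₁) 1 with hJ
  obtain ⟨N₁, hN₁⟩ := hB J ((le_max_right _ _).trans (le_max_left _ _))
  set W := primorial (2 ^ J) with hW
  have hW0 : 0 < W := primorial_pos _
  have hWe : Even W := by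
    rw [even_iff_two_dvd, hW, Nat.prime_two.dvd_primorial_iff]
    exact Nat.le_self_pow (by lia) 2
  have hW' : (1 : ℝ) ≤ W := by exact_mod_cast hW0
  set c₁ := ω / (2000 * W) with hc₁
  have hc₁0 : 0 < c₁ := by positivity
  obtain ⟨N₂, hN₂⟩ := exists_le_sum_log_prime_uniform (q := 2 * W) (by lia)
    (by positivity : 0 < c₁ / 50)
  obtain ⟨N₃, hN₃⟩ := eventually_atTop.mp (eventually_exists_pow hκ hc hc₁0)
  obtain ⟨N₄, hN₄⟩ := exists_nat_ge (2000 * W / ω)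
  refine ⟨max (max N₁ N₂) (max (max N₃ N₄) 17), fun N hN hNo => ?_⟩
  simp only [ge_iff_le, max_le_iff] at hN
  obtain ⟨⟨hNN₁, hNN₂⟩, ⟨hNN₃, hNN₄⟩, hN17⟩ := hN
  have hNW : 2000 * W ≤ ω * N := by
    have : (N₄ : ℝ) ≤ N := by exact_mod_cast hNN₄
    have := hN₄.trans this
    rwa [div_le_iff₀ hω, mul_comm (N : ℝ)] at this
  have hN0 : (0 : ℝ) < N := by
    have : 0 < N := by lia
    exact_mod_cast this
  have hωN : ω * N ≤ 1 / 100 * N := mul_le_mul_of_nonneg_right hω1 hN0.le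
  obtain ⟨k, hk1, hk2⟩ : ∃ k : ℕ, 1000 * W * k ≤ ω * N ∧ c₁ * N ≤ k := by
    refine ⟨⌊ω * N / (1000 * W)⌋₊, ?_, ?_⟩
    · have := Nat.floor_le (by positivity : 0 ≤ ω * N / (1000 * W))
      rwa [le_div_iff₀ (by positivity), mul_comm] at this
    · have h1 := Nat.lt_floor_add_one (ω * N / (1000 * W))
      have h2 : 2 ≤ ω * N / (1000 * W) := by
        rw [le_div_iff₀ (by positivity)]
        linarith
      have h3 : c₁ * N = ω * N / (1000 * W) / 2 := by
        rw [hc₁]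
        field_simp
        norm_num
      linarith
  have hk0 : 0 < k := by
    have : (0 : ℝ) < k := lt_of_lt_of_le (by positivity) hk2
    exact_mod_cast this
  have : NeZero (3000 * k) := ⟨by lia⟩
  obtain ⟨j₁, hτc, hτ1, hj₁, hFc, hF1⟩ := hN₃ N hNN₃ k hk2
  obtain ⟨R, hRN, hR⟩ := hN₁ N hNN₁
  obtain ⟨b₂, b₃, hb₂, hb₃, hb₂W, hb₃W, hbN⟩ := exists_coprime_add_modEq hW0 hNo
  have h3W : 2000 * W ≤ N := by
    have : (2000 * W : ℝ) ≤ N := by linarith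
    exact_mod_cast this
  obtain ⟨T, hT⟩ := (Nat.modEq_iff_dvd' (by lia)).mp hbN
  have hT' : N = W * T + (1 + b₂ + b₃) := by lia
  have hTR : (N : ℝ) = W * T + (1 + b₂ + b₃) := by exact_mod_cast hT'
  have hb₂R : (b₂ : ℝ) ≤ W := by exact_mod_cast hb₂.le
  have hb₃R : (b₃ : ℝ) ≤ W := by exact_mod_cast hb₃.le
  have hT3 : (T : ℝ) ≤ 3 * (T / 3 : ℕ) + 2 := by
    have : T ≤ 3 * (T / 3) + 2 := by lia
    exact_mod_cast this
  have hT3' : 3 * ((T / 3 : ℕ) : ℝ) ≤ T := by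
    have : 3 * (T / 3) ≤ T := by lia
    exact_mod_cast this
  have hWT := mul_le_mul_of_nonneg_left hT3 (by positivity : (0 : ℝ) ≤ W)
  have hWT' := mul_le_mul_of_nonneg_left hT3' (by positivity : (0 : ℝ) ≤ W)
  have hkT : 500 * k ≤ T / 3 := by
    have : (W * (500 * k) : ℝ) ≤ W * (T / 3 : ℕ) := by linarith
    have := le_of_mul_le_mul_left this (by positivity)
    exact_mod_cast this
  obtain ⟨m₀, hm₀⟩ := Nat.exists_eq_add_of_le hkT
  have hm₀R : ((T / 3 : ℕ) : ℝ) = 500 * k + m₀ := by exact_mod_cast hm₀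
  rw [hm₀R] at hWT hWT'
  have hlow : (1 / 3 - ω) * N ≤ W * m₀ := by linarith
  have hlow' : N < 4 * (W * m₀) := by
    have : (N : ℝ) < 4 * (W * m₀) := by linarith
    exact_mod_cast this
  have hup : W * (m₀ + 1000 * k) + W ≤ N := by
    have : (W * (m₀ + 1000 * k) + W : ℝ) ≤ N := by linarith
    exact_mod_cast this
  have hRm : R < W * m₀ := by
    by_contra! h
    have h1 := (Nat.pow_le_pow_left h 2).trans hRN
    have h2 : W * m₀ < 4 := by
      by_contra! h3
      have := Nat.mul_le_mul_right (W * m₀) h3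
      lia
    lia
  have hkN : 1000 * k ≤ N := by
    have := Nat.le_mul_of_pos_left (1000 * k) hW0
    rw [mul_add] at hup
    lia
  set b : Fin 3 → ℕ := ![1, b₂, b₃] with hb
  have hbW : ∀ i, (b i).Coprime W := by
    intro i
    fin_cases i
    exacts [Nat.coprime_one_left W, hb₂W, hb₃W]
  have hble : ∀ i, b i ≤ W := by
    intro i
    fin_cases i
    exacts [hW0, hb₂.le, hb₃.le]
  obtain ⟨x, y, z, hx, hy, hz, hxyz⟩ := hD J ((le_max_left _ _).trans (le_max_left _ _)) k hk0
    (fun i => primeWeight N W (1000 * k) m₀ (b i) (3000 * k)) (11 / 10)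
    ((N : ℝ) ^ (1 - κ) / (3000 * k)) (Real.log N) j₁ (1500 * k + T % 3) (by norm_num)
    (by norm_num) (by positivity) (fun i => dominated_primeWeight hkN hRm hτ1 hR)
    (fun i x => primeWeight_le _ _ _ _ _ _ x) hF1 hτc hj₁ hFc (by lia) (by lia)
    (fun i x m hxm => le_sum_primeWeight (δ := c₁ / 50) hWe hW0 (hbW i) (by linarith [hble i])
      (by linarith) (hN₂ N hNN₂) hxm)
  have hval : ∀ i w, primeWeight N W (1000 * k) m₀ (b i) (3000 * k) w ≠ 0 → w.val < 1000 * k ∧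
      (W * (m₀ + w.val) + b i).Prime := fun i w hw => by
    by_contra h
    exact hw (if_neg h)
  obtain ⟨hx1, hx2⟩ := hval 0 x hx
  obtain ⟨hy1, hy2⟩ := hval 1 y hy
  obtain ⟨hz1, hz2⟩ := hval 2 z hz
  have hsum : x.val + y.val + z.val = 1500 * k + T % 3 := by
    have h1 : ((x.val + y.val + z.val : ℕ) : ZMod (3000 * k)) = ((1500 * k + T % 3 : ℕ) : ZMod _) := by
      rw [← hxyz]
      push_cast
      simp
    rw [ZMod.natCast_eq_natCast_iff'] at h1
    rwa [Nat.mod_eq_of_lt (by lia), Nat.mod_eq_of_lt (by lia)] at h1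
  have hge : ∀ v d : ℕ, (1 / 3 - ω) * N ≤ ((W * (m₀ + v) + d : ℕ) : ℝ) := fun v d => by
    refine hlow.trans ?_
    have : W * m₀ ≤ W * (m₀ + v) + d :=
      (Nat.mul_le_mul_left W (Nat.le_add_right _ _)).trans (Nat.le_add_right _ _)
    exact_mod_cast this
  refine ⟨_, _, _, hx2, hy2, hz2, ?_, hge _ _, hge _ _, hge _ _⟩
  have h3 : T = 3 * m₀ + (x.val + y.val + z.val) := by lia
  change W * (m₀ + x.val) + 1 + (W * (m₀ + y.val) + b₂) + (W * (m₀ + z.val) + b₃) = N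
  rw [hT', h3]
  ring

end PrimeSum

namespace PrimeSum

lemma tendsto_nthPrime : Tendsto nthPrime atTop atTop :=
  (Nat.nth_strictMono Nat.infinite_setOfPred_prime).tendsto_atTop.comp (tendsto_sub_atTop_nat 1)

/-- The elements of `S n` below three times the smallest generator. -/
lemma eq_zero_or_of_mem_S {n m : ℕ} (hn : 3 ≤ nthPrime n) (hm : m ∈ S n) :
    m = 0 ∨ (m.Prime ∧ nthPrime n ≤ m) ∨ (Even m ∧ 2 * nthPrime n ≤ m) ∨ 3 * nthPrime n ≤ m := by
  induction hm using AddSubmonoid.closure_induction with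
  | mem x hx => exact Or.inr (Or.inl hx)
  | zero => exact Or.inl rfl
  | add x y _ _ hx hy =>
    have hodd : ∀ z : ℕ, z.Prime ∧ nthPrime n ≤ z → Odd z := fun z hz =>
      hz.1.odd_of_ne_two (by lia)
    rcases hx with rfl | hx | hx | hx
    · rwa [zero_add]
    · rcases hy with rfl | hy | hy | hy
      · exact Or.inr (Or.inl hx)
      · exact Or.inr (Or.inr (Or.inl ⟨(hodd x hx).add_odd (hodd y hy), by lia⟩))
      · exact Or.inr (Or.inr (Or.inr (by lia)))
      · exact Or.inr (Or.inr (Or.inr (by lia)))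
    · rcases hy with rfl | hy | hy | hy
      · exact Or.inr (Or.inr (Or.inl hx))
      all_goals exact Or.inr (Or.inr (Or.inr (by lia)))
    · exact Or.inr (Or.inr (Or.inr (by lia)))

lemma three_mul_sub_two_notMem_S {n : ℕ} (hn : 5 ≤ nthPrime n) : 3 * (nthPrime n - 2) ∉ S n := by
  intro h
  have hp : (nthPrime n).Prime := Nat.prime_nth_prime _
  obtain ⟨r, hr⟩ := hp.odd_of_ne_two (by lia)
  rcases eq_zero_or_of_mem_S (by lia) h with h | h | h | h
  · lia
  · exact Nat.not_prime_mul (by norm_num) (by lia) h.1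
  · obtain ⟨s, hs⟩ := h.1
    lia
  · lia

/-- An odd value of `frob` is attained and bounds the gaps. -/
lemma isGreatest_frob {n : ℕ} (h : Odd (frob n)) : IsGreatest {m | m ∉ S n} (frob n) := by
  have hb : BddAbove {m | m ∉ S n} := by
    by_contra hb
    rw [frob, Nat.sSup_of_not_bddAbove hb] at h
    exact absurd h (by decide)
  have hne : {m | m ∉ S n}.Nonempty := by
    by_contra hne
    rw [frob, Set.not_nonempty_iff_eq_empty.mp hne, csSup_empty] at h
    exact absurd h (by decide)
  exact ⟨Nat.sSup_mem hne hb, fun m hm => le_csSup hb hm⟩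

lemma mem_S_of_prime {n p : ℕ} (hp : p.Prime) (hnp : nthPrime n ≤ p) : p ∈ S n :=
  AddSubmonoid.subset_closure ⟨hp, hnp⟩

end PrimeSum

theorem frob_asymptotic_of_eventually_odd
    (h : ∃ n₀ : ℕ, ∀ n ≥ n₀, Odd (frob n)) :
    Filter.Tendsto (fun n => (frob n : ℝ) / (nthPrime n : ℝ)) Filter.atTop (nhds 3) := by
  obtain ⟨n₀, h⟩ := h
  have hp0 : ∀ n, (0 : ℝ) < nthPrime n := fun n => by
    exact_mod_cast (Nat.prime_nth_prime (n - 1)).pos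
  have hlow : ∀ᶠ n in atTop, 3 * ((nthPrime n : ℝ) - 2) ≤ frob n := by
    filter_upwards [eventually_ge_atTop n₀, PrimeSum.tendsto_nthPrime.eventually_ge_atTop 5]
      with n hn hn5
    have h1 := (PrimeSum.isGreatest_frob (h n hn)).2 (PrimeSum.three_mul_sub_two_notMem_S hn5)
    have h2 : 3 * nthPrime n ≤ frob n + 6 := by lia
    have h3 : (3 * nthPrime n : ℝ) ≤ frob n + 6 := by exact_mod_cast h2
    linarith
  have htend : Tendsto (fun n => (nthPrime n : ℝ)) atTop atTop :=
    tendsto_natCast_atTop_atTop.comp PrimeSum.tendsto_nthPrime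
  refine tendsto_order.2 ⟨fun a ha => ?_, fun a ha => ?_⟩
  · filter_upwards [hlow, htend.eventually_gt_atTop (6 / (3 - a))] with n h1 h2
    rw [div_lt_iff₀ (by linarith)] at h2
    rw [lt_div_iff₀ (hp0 n)]
    linarith
  · have ha0 : 0 < a := by linarith
    have hω : 0 < min (1 / 100) (1 / 3 - 1 / a) :=
      lt_min (by norm_num) (sub_pos.2 (one_div_lt_one_div_of_lt (by norm_num) ha))
    obtain ⟨N₀, hN₀⟩ := PrimeSum.exists_three_primes hω (min_le_left _ _)
    set ω := min (1 / 100) (1 / 3 - 1 / a)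
    have hωa : 1 / a ≤ 1 / 3 - ω := by
      have : ω ≤ 1 / 3 - 1 / a := min_le_right _ _
      linarith
    rw [div_le_iff₀ ha0] at hωa
    filter_upwards [hlow, eventually_ge_atTop n₀, htend.eventually_ge_atTop (N₀ + 6)]
      with n h1 hn hN
    have hfN : N₀ ≤ frob n := by
      have : (N₀ : ℝ) ≤ frob n := by linarith [Nat.cast_nonneg (α := ℝ) N₀]
      exact_mod_cast this
    obtain ⟨p, q, r, hp, hq, hr, hsum, hp', hq', hr'⟩ := hN₀ _ hfN (h n hn)
    rw [div_lt_iff₀ (hp0 n)]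
    by_contra! hcon
    have hge : (nthPrime n : ℝ) ≤ (1 / 3 - ω) * frob n := by
      have hω3 : 0 < 1 / 3 - ω := by
        by_contra! hneg
        nlinarith
      calc (nthPrime n : ℝ) ≤ (1 / 3 - ω) * a * nthPrime n :=
            le_mul_of_one_le_left (hp0 n).le hωa
        _ = (1 / 3 - ω) * (a * nthPrime n) := mul_assoc _ _ _
        _ ≤ _ := by gcongr
    refine (PrimeSum.isGreatest_frob (h n hn)).1 ?_
    rw [← hsum]
    exact add_mem (add_mem (PrimeSum.mem_S_of_prime hp (by exact_mod_cast hge.trans hp'))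
      (PrimeSum.mem_S_of_prime hq (by exact_mod_cast hge.trans hq')))
      (PrimeSum.mem_S_of_prime hr (by exact_mod_cast hge.trans hr'))
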